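/- Let n ≥ 2, α ∈ ℝ, let Σ be a domain of class C² in S^{n−1}, and let Ω = C_Σ ∩ Bⁿ or Ω = C_Σ ∖ B̄ⁿ, where Bⁿ is the open unit ball. Then for every u ∈ C²_c(Ω), ∫_Ω |x|^α |Δu|² dx − μ_D(C_Σ;α) ∫_Ω |x|^{α−4} |u|² dx ≥ ((γ̄_{n,α} + λ_Σ)/2) ∫_Ω |x|^{α−4} |log|x||^{−2} |u|² dx + (9/16) ∫_Ω |x|^{α−4} |log|x||^{−4} |u|² dx. -/

import Mathlib

open MeasureTheory Metric Set Filter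
open scoped RealInnerProductSpace

noncomputable section

/-- The Euclidean Laplacian of `u : ℝⁿ → ℝ` at a point. -/
def lap {n : ℕ} (u : EuclideanSpace ℝ (Fin n) → ℝ) (x : EuclideanSpace ℝ (Fin n)) : ℝ :=
  ∑ i : Fin n, iteratedFDeriv ℝ 2 u x ![EuclideanSpace.single i 1, EuclideanSpace.single i 1]

/-- The Laplace–Beltrami operator on the unit sphere, computed via the
`0`-homogeneous extension: for a `0`-homogeneous function the Euclidean Laplacian
restricted to the unit sphere is exactly the Laplace–Beltrami operator. -/
def sphLap {n : ℕ} (φ : EuclideanSpace ℝ (Fin n) → ℝ) (σ : EuclideanSpace ℝ (Fin n)) : ℝ :=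
  lap (fun x => φ (‖x‖⁻¹ • x)) σ

/-- Squared norm of the spherical gradient, via the `0`-homogeneous extension. -/
def sphGradNormSq {n : ℕ} (φ : EuclideanSpace ℝ (Fin n) → ℝ) (σ : EuclideanSpace ℝ (Fin n)) : ℝ :=
  ‖fderiv ℝ (fun x => φ (‖x‖⁻¹ • x)) σ‖ ^ 2

/-- The open cone `C_Σ = {rσ : r > 0, σ ∈ Σ}` over a subset of the unit sphere. -/
def coneOf {n : ℕ} (S : Set (EuclideanSpace ℝ (Fin n))) : Set (EuclideanSpace ℝ (Fin n)) :=
  {x | x ≠ 0 ∧ ‖x‖⁻¹ • x ∈ S}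

/-- The canonical surface measure `dσ` on the unit sphere of `ℝⁿ`, as a measure on `ℝⁿ`. -/
def sphMeasure (n : ℕ) : Measure (EuclideanSpace ℝ (Fin n)) :=
  Measure.map Subtype.val
    ((volume : Measure (EuclideanSpace ℝ (Fin n))).toSphere)

/-- A (Dirichlet) eigenfunction of the Laplace–Beltrami operator on `S ⊆ 𝕊^{n-1}`
relative to the eigenvalue `lam`. -/
def IsEigenfun {n : ℕ} (S : Set (EuclideanSpace ℝ (Fin n))) (lam : ℝ)
    (φ : EuclideanSpace ℝ (Fin n) → ℝ) : Prop :=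
  ContinuousOn (fun x => φ (‖x‖⁻¹ • x)) (coneOf (closure S)) ∧
  ContDiffOn ℝ 2 (fun x => φ (‖x‖⁻¹ • x)) (coneOf S) ∧
  (∀ σ ∈ closure S \ S, φ σ = 0) ∧
  (∃ σ ∈ S, φ σ ≠ 0) ∧
  (∀ σ ∈ S, - sphLap φ σ = lam * φ σ)

/-- The Dirichlet spectrum `Λ(Σ)` of the Laplace–Beltrami operator on `S`. -/
def spec {n : ℕ} (S : Set (EuclideanSpace ℝ (Fin n))) : Set ℝ :=
  {lam | ∃ φ, IsEigenfun S lam φ}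

/-- `S` is a domain in the unit sphere `𝕊^{n-1}`: a relatively open connected
nonempty subset. -/
def IsSphDomain {n : ℕ} (S : Set (EuclideanSpace ℝ (Fin n))) : Prop :=
  S ⊆ Metric.sphere (0 : EuclideanSpace ℝ (Fin n)) 1 ∧
  IsOpen (Subtype.val ⁻¹' S : Set (Metric.sphere (0 : EuclideanSpace ℝ (Fin n)) 1)) ∧
  IsConnected S

/-- `S` is a domain of class `C²` in the unit sphere: a domain such that the cone
over it admits local `C²` defining functions away from the origin. -/
def IsC2SphDomain {n : ℕ} (S : Set (EuclideanSpace ℝ (Fin n))) : Prop :=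
  IsSphDomain S ∧
  ∀ x ∈ frontier (coneOf S) \ {0}, ∃ (U : Set (EuclideanSpace ℝ (Fin n)))
    (f : EuclideanSpace ℝ (Fin n) → ℝ), IsOpen U ∧ x ∈ U ∧ ContDiff ℝ 2 f ∧
    fderiv ℝ f x ≠ 0 ∧ coneOf S ∩ U = {y ∈ U | f y < 0}

/-- `γ_{n,α} = ((n-2)/2)² - ((α-2)/2)²`. -/
def gam (n : ℕ) (α : ℝ) : ℝ := (((n : ℝ) - 2) / 2) ^ 2 - ((α - 2) / 2) ^ 2

/-- `γ̄_{n,α} = ((n-2)/2)² + ((α-2)/2)²`. -/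
def gbar (n : ℕ) (α : ℝ) : ℝ := (((n : ℝ) - 2) / 2) ^ 2 + ((α - 2) / 2) ^ 2

/-- The class `C²_c(Ω̄ ∖ {0})` of Navier test functions: `C²` up to the closure of
`Ω`, vanishing on `∂Ω` and in a neighborhood of `0` and of `∞`. -/
def NavierAdm {n : ℕ} (Ω : Set (EuclideanSpace ℝ (Fin n)))
    (u : EuclideanSpace ℝ (Fin n) → ℝ) : Prop :=
  ContDiffOn ℝ 2 u (closure Ω) ∧
  (∀ x ∈ frontier Ω, u x = 0) ∧
  (∃ ε > 0, ∀ x : EuclideanSpace ℝ (Fin n), ‖x‖ < ε → u x = 0) ∧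
  (∃ R : ℝ, ∀ x : EuclideanSpace ℝ (Fin n), R < ‖x‖ → u x = 0)

/-- The class `C²_c(Ω)` of Dirichlet test functions: globally `C²` with compact
support contained in `Ω`. -/
def DirichletAdm {n : ℕ} (Ω : Set (EuclideanSpace ℝ (Fin n)))
    (u : EuclideanSpace ℝ (Fin n) → ℝ) : Prop :=
  ContDiff ℝ 2 u ∧ HasCompactSupport u ∧ tsupport u ⊆ Ω

/-- The best Rellich constant `μ_N(Ω;α)` under Navier boundary conditions. -/
def muN {n : ℕ} (Ω : Set (EuclideanSpace ℝ (Fin n))) (α : ℝ) : ℝ :=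
  sInf {q : ℝ | ∃ u, NavierAdm Ω u ∧ (∃ x ∈ Ω, u x ≠ 0) ∧
    q = (∫ x in Ω, ‖x‖ ^ α * (lap u x) ^ 2) / (∫ x in Ω, ‖x‖ ^ (α - 4) * (u x) ^ 2)}

/-- The best Rellich constant `μ_D(Ω;α)` under Dirichlet boundary conditions. -/
def muD {n : ℕ} (Ω : Set (EuclideanSpace ℝ (Fin n))) (α : ℝ) : ℝ :=
  sInf {q : ℝ | ∃ u, DirichletAdm Ω u ∧ (∃ x ∈ Ω, u x ≠ 0) ∧
    q = (∫ x in Ω, ‖x‖ ^ α * (lap u x) ^ 2) / (∫ x in Ω, ‖x‖ ^ (α - 4) * (u x) ^ 2)}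

/-- The surrogate of `H² ∩ H¹₀(Σ)`: functions whose `0`-homogeneous extension is
`C²` up to the closure of the cone, vanishing on the relative boundary of `S`. -/
def NavAdmS {n : ℕ} (S : Set (EuclideanSpace ℝ (Fin n)))
    (φ : EuclideanSpace ℝ (Fin n) → ℝ) : Prop :=
  ContDiffOn ℝ 2 (fun x => φ (‖x‖⁻¹ • x)) (coneOf (closure S)) ∧
  (∀ σ ∈ closure S \ S, φ σ = 0)

/-- The surrogate of `H²₀(Σ)`: as `NavAdmS`, with in addition vanishing gradient
on the relative boundary of `S`. -/
def DirAdmS {n : ℕ} (S : Set (EuclideanSpace ℝ (Fin n)))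
    (φ : EuclideanSpace ℝ (Fin n) → ℝ) : Prop :=
  NavAdmS S φ ∧
  ∀ σ ∈ closure S \ S,
    fderivWithin ℝ (fun x => φ (‖x‖⁻¹ • x)) (coneOf (closure S)) σ = 0

/-- The Rayleigh-type quotient `∫_Σ |Lφ|² dσ / ∫_Σ |φ|² dσ` with
`Lφ = -Δ_σ φ + γ φ`. -/
def sphQuot {n : ℕ} (S : Set (EuclideanSpace ℝ (Fin n))) (γ : ℝ)
    (φ : EuclideanSpace ℝ (Fin n) → ℝ) : ℝ :=
  (∫ σ in S, (- sphLap φ σ + γ * φ σ) ^ 2 ∂(sphMeasure n)) /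
    (∫ σ in S, (φ σ) ^ 2 ∂(sphMeasure n))

/-- Partial derivative `w_s` of a function on the cylinder `ℝ × 𝕊^{n-1}`. -/
def ws {n : ℕ} (w : ℝ × EuclideanSpace ℝ (Fin n) → ℝ)
    (p : ℝ × EuclideanSpace ℝ (Fin n)) : ℝ :=
  deriv (fun t => w (t, p.2)) p.1

/-- Second partial derivative `w_ss` of a function on the cylinder. -/
def wss {n : ℕ} (w : ℝ × EuclideanSpace ℝ (Fin n) → ℝ)
    (p : ℝ × EuclideanSpace ℝ (Fin n)) : ℝ :=
  deriv (fun t => ws w (t, p.2)) p.1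

end

noncomputable section Aux

open scoped ContDiff Topology

local notation "𝔼" n => EuclideanSpace ℝ (Fin n)

variable {n : ℕ}

/-- Derivation along a linear vector field. -/
def Dv (A : (𝔼 n) →L[ℝ] (𝔼 n)) (f : (𝔼 n) → ℝ) (x : 𝔼 n) : ℝ := fderiv ℝ f x (A x)

/-- standard basis vector -/
def eb (i : Fin n) : 𝔼 n := EuclideanSpace.single i 1

/-- infinitesimal rotations -/
def rot (i j : Fin n) : (𝔼 n) →L[ℝ] (𝔼 n) :=
  (EuclideanSpace.proj i : (𝔼 n) →L[ℝ] ℝ).smulRight (eb j) -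
    (EuclideanSpace.proj j : (𝔼 n) →L[ℝ] ℝ).smulRight (eb i)

lemma rot_apply (i j : Fin n) (x : 𝔼 n) : rot i j x = x i • eb j - x j • eb i := by
  simp [rot]

local notation:max "Eu" => Dv (ContinuousLinearMap.id ℝ _)
local notation:max "Lr" i:max j:max => Dv (rot i j)

/-- spherical Laplacian -/
def Ds (f : (𝔼 n) → ℝ) (x : 𝔼 n) : ℝ := (1 / 2) * ∑ i, ∑ j, Lr i j (Lr i j f) x

/-- spherical gradient norm squared -/
def Gs (f : (𝔼 n) → ℝ) (x : 𝔼 n) : ℝ := (1 / 2) * ∑ i, ∑ j, (Lr i j f x) ^ 2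

/-- Smooth compactly supported test functions in `W`. -/
def TF (W : Set (𝔼 n)) (f : (𝔼 n) → ℝ) : Prop :=
  ContDiff ℝ ∞ f ∧ HasCompactSupport f ∧ tsupport f ⊆ W

section rules

lemma Dv_add {A : (𝔼 n) →L[ℝ] (𝔼 n)} {f g : (𝔼 n) → ℝ} {x : 𝔼 n}
    (hf : DifferentiableAt ℝ f x) (hg : DifferentiableAt ℝ g x) :
    Dv A (fun y => f y + g y) x = Dv A f x + Dv A g x := by
  simp only [Dv]; rw [fderiv_fun_add hf hg]; simp

lemma Dv_sub {A : (𝔼 n) →L[ℝ] (𝔼 n)} {f g : (𝔼 n) → ℝ} {x : 𝔼 n}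
    (hf : DifferentiableAt ℝ f x) (hg : DifferentiableAt ℝ g x) :
    Dv A (fun y => f y - g y) x = Dv A f x - Dv A g x := by
  simp only [Dv]; rw [fderiv_fun_sub hf hg]; simp

lemma Dv_mul {A : (𝔼 n) →L[ℝ] (𝔼 n)} {f g : (𝔼 n) → ℝ} {x : 𝔼 n}
    (hf : DifferentiableAt ℝ f x) (hg : DifferentiableAt ℝ g x) :
    Dv A (fun y => f y * g y) x = f x * Dv A g x + g x * Dv A f x := by
  simp only [Dv]; rw [fderiv_fun_mul hf hg]; simp

lemma Dv_const_mul {A : (𝔼 n) →L[ℝ] (𝔼 n)} {f : (𝔼 n) → ℝ} {x : 𝔼 n} (c : ℝ)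
    (hf : DifferentiableAt ℝ f x) :
    Dv A (fun y => c * f y) x = c * Dv A f x := by
  simp only [Dv]; rw [fderiv_const_mul hf]; simp

lemma Dv_comp {A : (𝔼 n) →L[ℝ] (𝔼 n)} {f : (𝔼 n) → ℝ} {x : 𝔼 n} {h : ℝ → ℝ} {h' : ℝ}
    (hh : HasDerivAt h h' (f x)) (hf : DifferentiableAt ℝ f x) :
    Dv A (fun y => h (f y)) x = h' * Dv A f x := by
  simp only [Dv]
  have := hh.comp_hasFDerivAt x hf.hasFDerivAt
  have h2 : fderiv ℝ (fun y => h (f y)) x = h' • fderiv ℝ f x := this.fderiv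
  rw [h2]; simp

lemma Dv_congr {A : (𝔼 n) →L[ℝ] (𝔼 n)} {f g : (𝔼 n) → ℝ} {x : 𝔼 n}
    (h : f =ᶠ[𝓝 x] g) : Dv A f x = Dv A g x := by
  simp only [Dv]; rw [h.fderiv_eq]

lemma Dv_congr_open {A : (𝔼 n) →L[ℝ] (𝔼 n)} {f g : (𝔼 n) → ℝ} {W : Set (𝔼 n)}
    (hW : IsOpen W) (h : EqOn f g W) : EqOn (Dv A f) (Dv A g) W := fun x hx =>
  Dv_congr (h.eventuallyEq_of_mem (hW.mem_nhds hx))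

lemma Dv_dil {A : (𝔼 n) →L[ℝ] (𝔼 n)} {f : (𝔼 n) → ℝ} {x : 𝔼 n} {t : ℝ}
    (hf : DifferentiableAt ℝ f (t • x)) :
    Dv A (fun y => f (t • y)) x = Dv A f (t • x) := by
  simp only [Dv]
  have h1 : HasFDerivAt (fun y : 𝔼 n => t • y) (t • ContinuousLinearMap.id ℝ (𝔼 n)) x :=
    (hasFDerivAt_id x).const_smul t
  have := (hf.hasFDerivAt).comp x h1
  have h2 : fderiv ℝ (fun y => f (t • y)) x = _ := this.fderiv
  rw [h2]; simp

lemma contDiffAt_Dv {A : (𝔼 n) →L[ℝ] (𝔼 n)} {f : (𝔼 n) → ℝ} {x : 𝔼 n} {k m : ℕ∞ω}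
    (hf : ContDiffAt ℝ m f x) (hk : k + 1 ≤ m) : ContDiffAt ℝ k (Dv A f) x := by
  have h1 := hf.fderiv_right hk
  exact h1.clm_apply A.contDiff.contDiffAt

lemma contDiffOn_Dv {A : (𝔼 n) →L[ℝ] (𝔼 n)} {f : (𝔼 n) → ℝ} {W : Set (𝔼 n)}
    (hW : IsOpen W) (hf : ContDiffOn ℝ ∞ f W) : ContDiffOn ℝ ∞ (Dv A f) W := fun x hx =>
  (contDiffAt_Dv (hf.contDiffAt (hW.mem_nhds hx)) (by simp)).contDiffWithinAt

lemma Dv_Dv {A B : (𝔼 n) →L[ℝ] (𝔼 n)} {f : (𝔼 n) → ℝ} {x : 𝔼 n} (hf : ContDiffAt ℝ 2 f x) :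
    Dv A (Dv B f) x = fderiv ℝ (fderiv ℝ f) x (A x) (B x) + fderiv ℝ f x (B (A x)) := by
  have h1 : HasFDerivAt (fderiv ℝ f) (fderiv ℝ (fderiv ℝ f) x) x :=
    ((hf.fderiv_right (m := 1) (by norm_num)).differentiableAt (by norm_num)).hasFDerivAt
  have h2 := h1.clm_apply (B.hasFDerivAt (x := x))
  have h3 : fderiv ℝ (Dv B f) x = _ := h2.fderiv
  rw [Dv, h3]; simp; ring

lemma symm2 {f : (𝔼 n) → ℝ} {x : 𝔼 n} (hf : ContDiffAt ℝ 2 f x) (v w : 𝔼 n) :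
    fderiv ℝ (fderiv ℝ f) x v w = fderiv ℝ (fderiv ℝ f) x w v :=
  (hf.isSymmSndFDerivAt (by simp)) v w

lemma Dv_comm_Eu {A : (𝔼 n) →L[ℝ] (𝔼 n)} {f : (𝔼 n) → ℝ} {x : 𝔼 n} (hf : ContDiffAt ℝ 2 f x) :
    Dv A (Eu f) x = Eu (Dv A f) x := by
  rw [Dv_Dv hf, Dv_Dv hf]
  simp [symm2 hf (A x) x]

lemma eb_sum (x : 𝔼 n) : ∑ i, x i • eb i = x := by
  ext j; simp [eb, Finset.sum_apply, Pi.single_apply]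

lemma lap_eq {f : (𝔼 n) → ℝ} {x : 𝔼 n} :
    lap f x = ∑ i, fderiv ℝ (fderiv ℝ f) x (eb i) (eb i) := by
  simp [lap, iteratedFDeriv_two_apply, eb]

/-- polar form of the Laplacian -/
lemma lap_polar {f : (𝔼 n) → ℝ} {x : 𝔼 n} (hf : ContDiffAt ℝ 2 f x) :
    ‖x‖ ^ 2 * lap f x = Eu (Eu f) x + ((n : ℝ) - 2) * Eu f x + Ds f x := by
  have hEE : Eu (Eu f) x = fderiv ℝ (fderiv ℝ f) x x x + fderiv ℝ f x x := by
    rw [Dv_Dv hf]; simp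
  set H := fderiv ℝ (fderiv ℝ f) x with hH
  set d := fderiv ℝ f x with hd
  have hE : Eu f x = d x := rfl
  have hL : ∀ i j, Lr i j (Lr i j f) x =
      (x i ^ 2 * H (eb j) (eb j) + x j ^ 2 * H (eb i) (eb i)
        - x i * x j * H (eb i) (eb j) - x i * x j * H (eb j) (eb i))
      - (x i * d (eb i) + x j * d (eb j))
      + (if i = j then 2 * (x i * d (eb i)) else 0) := by
    intro i j
    rw [Dv_Dv hf, ← hH, ← hd]
    simp only [rot_apply]
    simp only [map_sub, map_smul, _root_.sub_apply, _root_.smul_apply,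
      smul_eq_mul]
    by_cases h : i = j
    · subst h; simp [eb]; ring
    · have h' : ¬ j = i := fun e => h e.symm
      simp [eb, h, h']; ring
  have hx : H x x = ∑ i, ∑ j, x i * x j * H (eb i) (eb j) := by
    conv_lhs => rw [← eb_sum x]
    simp only [map_sum, map_smul, _root_.sum_apply, _root_.smul_apply,
      smul_eq_mul, Finset.mul_sum]
    rw [Finset.sum_comm]
    refine Finset.sum_congr rfl fun i _ => Finset.sum_congr rfl fun j _ => by ring
  have hx' : H x x = ∑ i, ∑ j, x i * x j * H (eb j) (eb i) := by
    rw [hx]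
    refine Finset.sum_congr rfl fun i _ => Finset.sum_congr rfl fun j _ => ?_
    rw [hH, symm2 hf]
  have hdx : d x = ∑ i, x i * d (eb i) := by
    conv_lhs => rw [← eb_sum x]
    simp
  have hnx : ‖x‖ ^ 2 = ∑ i, x i ^ 2 := by
    rw [EuclideanSpace.norm_sq_eq]; simp
  have s1 : ∑ i, ∑ j, x i ^ 2 * H (eb j) (eb j) = ‖x‖ ^ 2 * lap f x := by
    rw [lap_eq, hnx, Finset.sum_mul_sum]
  have s2 : ∑ i, ∑ j, x j ^ 2 * H (eb i) (eb i) = ‖x‖ ^ 2 * lap f x := by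
    rw [Finset.sum_comm, s1]
  have s3 : ∑ i : Fin n, ∑ j : Fin n, (x i * d (eb i) + x j * d (eb j)) = 2 * (n * d x) := by
    simp only [Finset.sum_add_distrib, Finset.sum_const, Finset.card_univ, Fintype.card_fin,
      nsmul_eq_mul, ← hdx, ← Finset.mul_sum]
    ring
  have s4 : ∑ i : Fin n, ∑ j : Fin n, (if i = j then 2 * (x i * d (eb i)) else 0) = 2 * d x := by
    simp [hdx, Finset.mul_sum]
  rw [hEE, hE, Ds]
  simp only [hL, Finset.sum_add_distrib, Finset.sum_sub_distrib] at *
  rw [s1, s2, s3, s4, ← hx, ← hx']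
  ring

end rules

lemma cd_of_tsupp {f : (𝔼 n) → ℝ} {m : ℕ∞ω} (h : ∀ x ∈ tsupport f, ContDiffAt ℝ m f x) :
    ContDiff ℝ m f := by
  refine contDiff_iff_contDiffAt.2 fun x => ?_
  by_cases hx : x ∈ tsupport f
  · exact h x hx
  · exact (contDiffAt_const (c := (0:ℝ))).congr_of_eventuallyEq
      (notMem_tsupport_iff_eventuallyEq.1 hx)

section TFs

variable {W : Set (𝔼 n)} {f g : (𝔼 n) → ℝ}

lemma TF.cd (hf : TF W f) {m : ℕ∞} : ContDiff ℝ m f := hf.1.of_le (by exact_mod_cast le_top)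

lemma TF.cd2 (hf : TF W f) : ContDiff ℝ 2 f := hf.cd (m := 2)

lemma TF.da (hf : TF W f) {x : 𝔼 n} : DifferentiableAt ℝ f x :=
  (hf.1.differentiable (by simp)) x

lemma TF.eq_zero (hf : TF W f) {x : 𝔼 n} (hx : x ∉ W) : f x = 0 :=
  image_eq_zero_of_notMem_tsupport fun h => hx (hf.2.2 h)

lemma TF.mono {W' : Set (𝔼 n)} (hf : TF W f) (h : W ⊆ W') : TF W' f := ⟨hf.1, hf.2.1, hf.2.2.trans h⟩

lemma TF.of_supp (hf : TF W f) (hg : ContDiff ℝ ∞ g) (h : ∀ x, f x = 0 → g x = 0) : TF W g := by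
  have hs : tsupport g ⊆ tsupport f := by
    apply closure_mono
    intro x hx
    simp only [Function.mem_support] at *
    exact fun h0 => hx (h x h0)
  exact ⟨hg, hf.2.1.mono' ((subset_tsupport g).trans hs), hs.trans hf.2.2⟩

lemma TF.of_tsupp (hf : TF W f) (hg : ContDiff ℝ ∞ g) (hs : tsupport g ⊆ tsupport f) : TF W g :=
  ⟨hg, hf.2.1.mono' ((subset_tsupport g).trans hs), hs.trans hf.2.2⟩

lemma TF.zero : TF W (fun _ => (0:ℝ)) := by
  refine ⟨contDiff_const, HasCompactSupport.zero, ?_⟩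
  have : tsupport (fun _ : 𝔼 n => (0:ℝ)) = ∅ := by
    rw [tsupport_eq_empty_iff]; rfl
  rw [this]; exact empty_subset _

lemma TF.add (hf : TF W f) (hg : TF W g) : TF W (fun x => f x + g x) :=
  ⟨hf.1.add hg.1, hf.2.1.add hg.2.1, (tsupport_add f g).trans (union_subset hf.2.2 hg.2.2)⟩

lemma TF.cmul (hf : TF W f) (c : ℝ) : TF W (fun x => c * f x) :=
  hf.of_supp (contDiff_const.mul hf.1) fun x h => by simp [h]

lemma TF.sub (hf : TF W f) (hg : TF W g) : TF W (fun x => f x - g x) := by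
  have := hf.add (hg.cmul (-1))
  refine cast ?_ this
  congr; ext x; ring

lemma TF.gmul (hf : TF W f) (hg : ContDiff ℝ ∞ g) : TF W (fun x => f x * g x) :=
  hf.of_supp (hf.1.mul hg) fun x h => by simp [h]

lemma TF.sq (hf : TF W f) : TF W (fun x => f x ^ 2) :=
  hf.of_supp (hf.1.pow 2) fun x h => by simp [h]

lemma TF.sum {ι : Type*} {s : Finset ι} {F : ι → (𝔼 n) → ℝ} (h : ∀ i ∈ s, TF W (F i)) :
    TF W (fun x => ∑ i ∈ s, F i x) := by
  classical
  induction s using Finset.induction_on with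
  | empty => simpa using TF.zero
  | insert a s ha ih =>
    simp only [Finset.sum_insert ha]
    exact (h a (by simp)).add (ih fun i hi => h i (by simp [hi]))

lemma TF.lmul (hf : TF W f) (hW : IsOpen W) (hg : ContDiffOn ℝ ∞ g W) :
    TF W (fun x => g x * f x) := by
  refine hf.of_supp (cd_of_tsupp fun x hx => ?_) fun x h => by simp [h]
  have hx' : x ∈ tsupport f := (tsupport_mul_subset_right (f := g) (g := f)) hx
  exact (hg.contDiffAt (hW.mem_nhds (hf.2.2 hx'))).mul hf.1.contDiffAt

lemma TF.dv (hf : TF W f) {A : (𝔼 n) →L[ℝ] (𝔼 n)} : TF W (Dv A f) := by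
  refine hf.of_tsupp ?_ ?_
  · exact contDiff_iff_contDiffAt.2 fun x => contDiffAt_Dv hf.1.contDiffAt (by simp)
  · refine (closure_mono ?_).trans (tsupport_fderiv_subset ℝ (f := f))
    intro x hx
    simp only [Function.mem_support] at *
    intro h; apply hx; simp [Dv, h]

lemma TF.ds (hf : TF W f) : TF W (Ds f) :=
  (TF.sum fun _ _ => TF.sum fun _ _ => hf.dv.dv).cmul _

lemma TF.gs (hf : TF W f) : TF W (Gs f) :=
  (TF.sum fun _ _ => TF.sum fun _ _ => hf.dv.sq).cmul _

lemma TF.int (hf : TF W f) : Integrable f := hf.1.continuous.integrable_of_hasCompactSupport hf.2.1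

end TFs

lemma cd_norm : ContDiffOn ℝ ∞ (fun x : 𝔼 n => ‖x‖) {0}ᶜ := fun _ hx =>
  (contDiffAt_norm ℝ hx).contDiffWithinAt

lemma cd_norm_rpow (p : ℝ) : ContDiffOn ℝ ∞ (fun x : 𝔼 n => ‖x‖ ^ p) {0}ᶜ :=
  cd_norm.rpow_const_of_ne fun _ hx => by simpa using hx

lemma open0 : IsOpen ({0}ᶜ : Set (𝔼 n)) := isOpen_compl_singleton

lemma da_norm {x : 𝔼 n} (hx : x ≠ 0) : DifferentiableAt ℝ (fun x : 𝔼 n => ‖x‖) x :=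
  (contDiffAt_norm ℝ (n := 1) hx).differentiableAt (by simp)

lemma fderiv_norm_apply {x : 𝔼 n} (hx : x ≠ 0) (v : 𝔼 n) :
    fderiv ℝ (fun x : 𝔼 n => ‖x‖) x v = ⟪x, v⟫ / ‖x‖ := by
  have h := (da_norm hx).hasFDerivAt
  have h1 : HasFDerivAt (fun x : 𝔼 n => ‖x‖ ^ 2) _ x := h.pow 2
  have h2 : HasFDerivAt (fun x : 𝔼 n => ‖x‖ ^ 2) (2 • (innerSL ℝ x)) x :=
    (hasStrictFDerivAt_norm_sq x).hasFDerivAt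
  have h3 := congrArg (fun L => L v) (h1.unique h2)
  simp at h3
  have : ‖x‖ ≠ 0 := by simpa using hx
  field_simp
  linarith

lemma Eu_norm {x : 𝔼 n} (hx : x ≠ 0) : Eu (fun x : 𝔼 n => ‖x‖) x = ‖x‖ := by
  have : ‖x‖ ≠ 0 := by simpa using hx
  rw [Dv, fderiv_norm_apply hx]; simp [real_inner_self_eq_norm_sq]; field_simp

lemma Lr_norm (i j : Fin n) {x : 𝔼 n} (hx : x ≠ 0) : Lr i j (fun x : 𝔼 n => ‖x‖) x = 0 := by
  rw [Dv, fderiv_norm_apply hx, rot_apply]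
  simp [inner_sub_right, inner_smul_right, eb, EuclideanSpace.inner_single_right, mul_comm]

lemma Eu_rad {h : ℝ → ℝ} {h' : ℝ} {x : 𝔼 n} (hx : x ≠ 0) (hh : HasDerivAt h h' ‖x‖) :
    Eu (fun x : 𝔼 n => h ‖x‖) x = h' * ‖x‖ := by
  rw [Dv_comp hh (da_norm hx), Eu_norm hx]

lemma Lr_rad (i j : Fin n) {h : ℝ → ℝ} {x : 𝔼 n} (hx : x ≠ 0) (hh : DifferentiableAt ℝ h ‖x‖) :
    Lr i j (fun x : 𝔼 n => h ‖x‖) x = 0 := by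
  rw [Dv_comp hh.hasDerivAt (da_norm hx), Lr_norm i j hx, mul_zero]

lemma Eu_rpow (p : ℝ) {x : 𝔼 n} (hx : x ≠ 0) : Eu (fun x : 𝔼 n => ‖x‖ ^ p) x = p * ‖x‖ ^ p := by
  have hp : 0 < ‖x‖ := by simpa using hx
  rw [Eu_rad (h := fun r => r ^ p) hx (Real.hasDerivAt_rpow_const (Or.inl hp.ne')), mul_assoc]
  congr 1
  rw [← Real.rpow_add_one hp.ne']; simp

lemma Lr_rpow (i j : Fin n) (p : ℝ) {x : 𝔼 n} (hx : x ≠ 0) :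
    Lr i j (fun x : 𝔼 n => ‖x‖ ^ p) x = 0 := by
  have hp : 0 < ‖x‖ := by simpa using hx
  exact Lr_rad i j (h := fun r => r ^ p) hx
    (Real.hasDerivAt_rpow_const (Or.inl hp.ne')).differentiableAt

lemma da_rpow (p : ℝ) {x : 𝔼 n} (hx : x ≠ 0) : DifferentiableAt ℝ (fun x : 𝔼 n => ‖x‖ ^ p) x :=
  ((cd_norm_rpow p).contDiffAt (open0.mem_nhds hx)).differentiableAt (by simp)

lemma ibp_coord {f : (𝔼 n) → ℝ} (hf : ContDiff ℝ 1 f) (hc : HasCompactSupport f) (i j : Fin n) :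
    Integrable (fun x : 𝔼 n => x i * fderiv ℝ f x (eb j)) ∧
    ∫ x : 𝔼 n, x i * fderiv ℝ f x (eb j) = - ((if i = j then 1 else 0) * ∫ x, f x) := by
  have hco : Continuous (fun x : 𝔼 n => x i) := by fun_prop
  have hfd : Continuous (fun x : 𝔼 n => fderiv ℝ f x (eb j)) :=
    (hf.continuous_fderiv (by simp)).clm_apply continuous_const
  have hcd : HasCompactSupport (fun x : 𝔼 n => fderiv ℝ f x (eb j)) := hc.fderiv_apply ℝ (eb j)
  have h1 : ∀ x, fderiv ℝ (fun x : 𝔼 n => x i) x (eb j) = if i = j then 1 else 0 := by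
    intro x
    have : HasFDerivAt (fun x : 𝔼 n => x i) (EuclideanSpace.proj i : (𝔼 n) →L[ℝ] ℝ) x :=
      (EuclideanSpace.proj i : (𝔼 n) →L[ℝ] ℝ).hasFDerivAt
    rw [this.fderiv]; simp [eb, Pi.single_apply]
  have hIntg : Integrable (fun x : 𝔼 n => x i * fderiv ℝ f x (eb j)) :=
    (hco.mul hfd).integrable_of_hasCompactSupport hcd.mul_left
  have hfi := hf.continuous.integrable_of_hasCompactSupport (μ := volume) hc
  refine ⟨hIntg, ?_⟩
  rw [integral_mul_fderiv_eq_neg_fderiv_mul_of_integrable]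
  · simp only [h1]; rw [integral_const_mul]
  · simp only [h1]; exact hfi.const_mul _
  · exact hIntg
  · exact (hco.mul hf.continuous).integrable_of_hasCompactSupport hc.mul_left
  · intro x _; fun_prop
  · intro x _; exact (hf.differentiable (by simp)) x

lemma int_Lr {f : (𝔼 n) → ℝ} (hf : ContDiff ℝ 1 f) (hc : HasCompactSupport f) (i j : Fin n) :
    ∫ x, Lr i j f x = 0 := by
  simp only [Dv, rot_apply, map_sub, map_smul, smul_eq_mul]
  rw [integral_sub (ibp_coord hf hc i j).1 (ibp_coord hf hc j i).1, (ibp_coord hf hc i j).2,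
    (ibp_coord hf hc j i).2]
  simp [eq_comm]

lemma int_Eu {f : (𝔼 n) → ℝ} (hf : ContDiff ℝ 1 f) (hc : HasCompactSupport f) :
    ∫ x, Eu f x = - (n * ∫ x, f x) := by
  have : ∀ x, Eu f x = ∑ i, x i * fderiv ℝ f x (eb i) := by
    intro x
    have h : fderiv ℝ f x x = fderiv ℝ f x (∑ i, x i • eb i) := by rw [eb_sum]
    simp only [Dv, ContinuousLinearMap.id_apply]
    rw [h]; simp
  simp only [this]
  rw [integral_finsetSum _ fun i _ => (ibp_coord hf hc i i).1]
  simp only [(ibp_coord hf hc _ _).2]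
  simp

/-- Integration against the scale invariant measure. -/
def In (f : (𝔼 n) → ℝ) : ℝ := ∫ x, ‖x‖ ^ (-(n:ℝ)) * f x

section Inn
variable {f g : (𝔼 n) → ℝ}

lemma TF.wt (hf : TF {0}ᶜ f) (p : ℝ) : TF {0}ᶜ (fun x => ‖x‖ ^ p * f x) :=
  hf.lmul open0 (cd_norm_rpow p)

lemma In_add (hf : TF {0}ᶜ f) (hg : TF {0}ᶜ g) : In (fun x => f x + g x) = In f + In g := by
  simp only [In, mul_add]; exact integral_add (hf.wt _).int (hg.wt _).int

lemma In_sub (hf : TF {0}ᶜ f) (hg : TF {0}ᶜ g) : In (fun x => f x - g x) = In f - In g := by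
  simp only [In, mul_sub]; exact integral_sub (hf.wt _).int (hg.wt _).int

lemma In_cmul (c : ℝ) (f : (𝔼 n) → ℝ) : In (fun x => c * f x) = c * In f := by
  simp only [In]; rw [← integral_const_mul]; congr; ext x; ring

lemma In_sum {ι : Type*} {s : Finset ι} {F : ι → (𝔼 n) → ℝ} (h : ∀ i ∈ s, TF {0}ᶜ (F i)) :
    In (fun x => ∑ i ∈ s, F i x) = ∑ i ∈ s, In (F i) := by
  simp only [In, Finset.mul_sum]
  exact integral_finsetSum _ fun i hi => ((h i hi).wt _).int

lemma In_nonneg (h : ∀ x, 0 ≤ f x) : 0 ≤ In f :=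
  integral_nonneg fun x => mul_nonneg (Real.rpow_nonneg (norm_nonneg _) _) (h x)

lemma In_Lr (hf : TF {0}ᶜ f) (i j : Fin n) : In (Lr i j f) = 0 := by
  have h := hf.wt (-(n:ℝ))
  rw [← int_Lr (h.cd (m := 1)) h.2.1 i j]
  unfold In
  congr; ext x
  by_cases hx : x = 0
  · subst hx; rw [hf.dv.eq_zero (x := 0) (by simp), h.dv.eq_zero (x := 0) (by simp), mul_zero]
  · rw [Dv_mul (da_rpow _ hx) hf.da, Lr_rpow _ _ _ hx]; simp

lemma In_Eu (hf : TF {0}ᶜ f) : In (Eu f) = 0 := by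
  have h := hf.wt (-(n:ℝ))
  have h1 := int_Eu (h.cd (m := 1)) h.2.1
  have : ∀ x, Eu (fun x => ‖x‖ ^ (-(n:ℝ)) * f x) x
      = ‖x‖ ^ (-(n:ℝ)) * Eu f x - n * (‖x‖ ^ (-(n:ℝ)) * f x) := by
    intro x
    by_cases hx : x = 0
    · subst hx; rw [hf.dv.eq_zero (x := 0) (by simp), h.dv.eq_zero (x := 0) (by simp),
        hf.eq_zero (x := 0) (by simp)]; simp
    · rw [Dv_mul (da_rpow _ hx) hf.da, Eu_rpow _ hx]; ring
  simp only [this] at h1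
  rw [integral_sub (hf.dv.wt _).int ((h.int).const_mul _), integral_const_mul] at h1
  unfold In; linarith

lemma In_Eu_ibp (hf : TF {0}ᶜ f) (hg : TF {0}ᶜ g) :
    In (fun x => f x * Eu g x) = - In (fun x => g x * Eu f x) := by
  have h := In_Eu (hf.gmul hg.1)
  have : Eu (fun x => f x * g x) = fun x => f x * Eu g x + g x * Eu f x := by
    ext x; exact Dv_mul hf.da hg.da
  rw [this, In_add (hf.gmul hg.dv.1) (hg.gmul hf.dv.1)] at h
  linarith

lemma In_Lr_ibp (i j : Fin n) (hf : TF {0}ᶜ f) (hg : TF {0}ᶜ g) :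
    In (fun x => f x * Lr i j g x) = - In (fun x => g x * Lr i j f x) := by
  have h := In_Lr (hf.gmul hg.1) i j
  have : Lr i j (fun x => f x * g x) = fun x => f x * Lr i j g x + g x * Lr i j f x := by
    ext x; exact Dv_mul hf.da hg.da
  rw [this, In_add (hf.gmul hg.dv.1) (hg.gmul hf.dv.1)] at h
  linarith

end Inn

section rell
variable {w u : (𝔼 n) → ℝ}

lemma Eu_wt {W : Set (𝔼 n)} (hW : W ⊆ {0}ᶜ) (hf : TF W u) (p : ℝ) :
    Eu (fun x => ‖x‖ ^ p * u x) = fun x => ‖x‖ ^ p * (Eu u x + p * u x) := by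
  have hf := hf.mono hW
  ext x
  by_cases hx : x = 0
  · subst hx
    rw [(hf.wt p).dv.eq_zero (x := 0) (by simp), hf.dv.eq_zero (x := 0) (by simp),
        hf.eq_zero (x := 0) (by simp)]; simp
  · rw [Dv_mul (da_rpow _ hx) hf.da, Eu_rpow _ hx]; ring

lemma Lr_wt {W : Set (𝔼 n)} (hW : W ⊆ {0}ᶜ) (hf : TF W u) (p : ℝ) (i j : Fin n) :
    Lr i j (fun x => ‖x‖ ^ p * u x) = fun x => ‖x‖ ^ p * (Lr i j u x) := by
  have hf := hf.mono hW
  ext x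
  by_cases hx : x = 0
  · subst hx
    rw [(hf.wt p).dv.eq_zero (x := 0) (by simp), hf.dv.eq_zero (x := 0) (by simp)]; simp
  · rw [Dv_mul (da_rpow _ hx) hf.da, Lr_rpow _ _ _ hx]; ring

lemma Ds_wt (hf : TF {0}ᶜ u) (p : ℝ) :
    Ds (fun x => ‖x‖ ^ p * u x) = fun x => ‖x‖ ^ p * (Ds u x) := by
  ext x
  simp only [Ds, Lr_wt subset_rfl hf p, Lr_wt subset_rfl hf.dv p, ← Finset.mul_sum]
  ring

lemma rellich_id (hw : TF {0}ᶜ w) (α : ℝ) :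
    In (fun x => (Eu (Eu w) x - (α - 2) * Eu w x + Ds w x - gam n α * w x) ^ 2) =
      In (fun x => (Eu (Eu w) x) ^ 2) + In (fun x => (Ds w x - gam n α * w x) ^ 2)
      + 2 * In (Gs (Eu w)) + 2 * gbar n α * In (fun x => (Eu w x) ^ 2) := by
  have hY : TF {0}ᶜ (Eu w) := hw.dv
  have hX : TF {0}ᶜ (Eu (Eu w)) := hw.dv.dv
  have hZ : TF {0}ᶜ (Ds w) := hw.ds
  set γ := gam n α
  -- XY
  have hXY : In (fun x => Eu w x * Eu (Eu w) x) = 0 := by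
    have := In_Eu_ibp hY hY; linarith
  have hYW : In (fun x => w x * Eu w x) = 0 := by
    have := In_Eu_ibp hw hw; linarith
  have hXW : In (fun x => w x * Eu (Eu w) x) = - In (fun x => (Eu w x) ^ 2) := by
    rw [In_Eu_ibp hw hY]; congr; ext x; ring
  have hcomm : ∀ i j : Fin n, Lr i j (Eu w) = Eu (Lr i j w) := fun i j => by
    ext x; exact Dv_comm_Eu hw.cd2.contDiffAt
  have hcomm2 : ∀ i j : Fin n, Eu (Lr i j (Lr i j w)) = Lr i j (Lr i j (Eu w)) := fun i j => by
    rw [hcomm]; ext x; exact (Dv_comm_Eu hw.dv.cd2.contDiffAt).symm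
  have hYZ : In (fun x => Eu w x * Ds w x) = 0 := by
    have : (fun x => Eu w x * Ds w x) =
        fun x => (1 / 2) * ∑ i, ∑ j, Eu w x * Lr i j (Lr i j w) x := by
      ext x; simp only [Ds, ← Finset.mul_sum]; ring
    rw [this, In_cmul, In_sum fun i _ => TF.sum fun j _ => hY.gmul hw.dv.dv.1]
    simp_rw [In_sum fun j _ => hY.gmul hw.dv.dv.1]
    rw [mul_eq_zero]; right
    refine Finset.sum_eq_zero fun i _ => Finset.sum_eq_zero fun j _ => ?_
    rw [In_Lr_ibp i j hY hw.dv, hcomm]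
    have := In_Eu_ibp (hw.dv (A := rot i j)) (hw.dv (A := rot i j)); linarith
  have hXZ : In (fun x => Eu (Eu w) x * Ds w x) = In (Gs (Eu w)) := by
    have : (fun x => Eu (Eu w) x * Ds w x) =
        fun x => (1 / 2) * ∑ i, ∑ j, Lr i j (Lr i j w) x * Eu (Eu w) x := by
      ext x; simp only [Ds, ← Finset.sum_mul]; ring
    rw [this, In_cmul, In_sum fun i _ => TF.sum fun j _ => hw.dv.dv.gmul hX.1]
    simp_rw [In_sum fun j _ => hw.dv.dv.gmul hX.1]
    have h2 : In (Gs (Eu w)) = (1 / 2) * ∑ i, ∑ j, In (fun x => (Lr i j (Eu w) x) ^ 2) := by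
      have : Gs (Eu w) = fun x => (1 / 2) * ∑ i, ∑ j, (Lr i j (Eu w) x) ^ 2 := rfl
      rw [this, In_cmul, In_sum fun i _ => TF.sum fun j _ => hY.dv.sq]
      simp_rw [In_sum fun j _ => hY.dv.sq]
    rw [h2]; congr 1
    refine Finset.sum_congr rfl fun i _ => Finset.sum_congr rfl fun j _ => ?_
    rw [In_Eu_ibp hw.dv.dv hY, hcomm2, In_Lr_ibp i j hY hY.dv, neg_neg]
    congr; ext x; ring
  have e : (fun x => (Eu (Eu w) x - (α - 2) * Eu w x + Ds w x - γ * w x) ^ 2) =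
      fun x => ((((((((Eu (Eu w) x) ^ 2 + (Ds w x - γ * w x) ^ 2) + (α - 2) ^ 2 * (Eu w x) ^ 2)
        + (-2 * (α - 2)) * (Eu w x * Eu (Eu w) x)) + 2 * (Eu (Eu w) x * Ds w x))
        + (-2 * γ) * (w x * Eu (Eu w) x)) + (-2 * (α - 2)) * (Eu w x * Ds w x))
        + (2 * (α - 2) * γ) * (w x * Eu w x)) := by
    ext x; ring
  have t1 := hX.sq
  have t2 : TF {0}ᶜ (fun x => (Ds w x - γ * w x) ^ 2) := (hZ.sub (hw.cmul γ)).sq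
  have t3 := hY.sq.cmul ((α - 2) ^ 2)
  have t4 := (hY.gmul hX.1).cmul (-2 * (α - 2))
  have t5 := (hX.gmul hZ.1).cmul 2
  have t6 := (hw.gmul hX.1).cmul (-2 * γ)
  have t7 := (hY.gmul hZ.1).cmul (-2 * (α - 2))
  have t8 := (hw.gmul hY.1).cmul (2 * (α - 2) * γ)
  rw [e, In_add ((((((t1.add t2).add t3).add t4).add t5).add t6).add t7) t8,
    In_add (((((t1.add t2).add t3).add t4).add t5).add t6) t7,
    In_add ((((t1.add t2).add t3).add t4).add t5) t6,
    In_add (((t1.add t2).add t3).add t4) t5,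
    In_add ((t1.add t2).add t3) t4, In_add (t1.add t2) t3, In_add t1 t2]
  simp only [In_cmul, hXY, hYW, hXW, hYZ, hXZ]
  have : (α - 2) ^ 2 + 2 * γ = 2 * gbar n α := by simp only [γ, gam, gbar]; ring
  linear_combination (In fun x => Eu w x ^ 2) * this

/-- the exponent of the Emden-Fowler transform -/
def bet (n : ℕ) (α : ℝ) : ℝ := ((n:ℝ) + α - 4) / 2

lemma lap_zero (hu : TF {0}ᶜ u) : lap u 0 = 0 := by
  rw [lap_eq]
  have h0 : (0 : 𝔼 n) ∉ tsupport u := fun h => hu.2.2 h rfl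
  have h1 : (0 : 𝔼 n) ∉ tsupport (fderiv ℝ u) := fun h => h0 (tsupport_fderiv_subset ℝ h)
  have h2 : (0 : 𝔼 n) ∉ tsupport (fderiv ℝ (fderiv ℝ u)) := fun h => h1 (tsupport_fderiv_subset ℝ h)
  simp [image_eq_zero_of_notMem_tsupport h2]

lemma ef_lap (hw : TF {0}ᶜ w) (α : ℝ) (x : 𝔼 n) :
    ‖x‖ ^ α * (lap (fun x => ‖x‖ ^ (- bet n α) * w x) x) ^ 2 =
      ‖x‖ ^ (-(n:ℝ)) * (Eu (Eu w) x - (α - 2) * Eu w x + Ds w x - gam n α * w x) ^ 2 := by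
  set b := - bet n α with hb
  have hu := hw.wt b
  by_cases hx : x = 0
  · subst hx
    rw [lap_zero hu, hw.dv.dv.eq_zero (x := 0) (by simp), hw.dv.eq_zero (x := 0) (by simp),
        hw.eq_zero (x := 0) (by simp), hw.ds.eq_zero (x := 0) (by simp)]; simp
  have hp : 0 < ‖x‖ := by simpa using hx
  have h := lap_polar (x := x) hu.cd2.contDiffAt
  rw [Eu_wt subset_rfl hw b] at h
  have hw1 : TF {0}ᶜ (fun x => Eu w x + b * w x) := hw.dv.add (hw.cmul b)
  rw [Eu_wt subset_rfl hw1 b, Ds_wt hw b] at h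
  have e1 : Eu (fun x => Eu w x + b * w x) x = Eu (Eu w) x + b * Eu w x := by
    rw [Dv_add hw.dv.da (hw.cmul b).da, Dv_const_mul _ hw.da]
  simp only [e1] at h
  have h2 : lap (fun x => ‖x‖ ^ b * w x) x = ‖x‖ ^ (b - 2) *
      (Eu (Eu w) x - (α - 2) * Eu w x + Ds w x - gam n α * w x) := by
    have : ‖x‖ ^ (b - 2) * ‖x‖ ^ 2 = ‖x‖ ^ b := by
      rw [← Real.rpow_natCast, ← Real.rpow_add hp]; simp
    have hne : ‖x‖ ^ 2 ≠ 0 := by positivity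
    apply mul_left_cancel₀ hne
    rw [h, ← this]
    have hb' : b = - (((n:ℝ) + α - 4) / 2) := hb
    simp only [gam]
    rw [hb']; ring
  rw [h2, mul_pow, ← mul_assoc]
  congr 1
  rw [← Real.rpow_natCast, ← Real.rpow_mul hp.le, ← Real.rpow_add hp]
  congr 1
  rw [hb, bet]; push_cast; ring

lemma ef_wt (hw : TF {0}ᶜ w) (α : ℝ) (x : 𝔼 n) :
    ‖x‖ ^ (α - 4) * ((fun x => ‖x‖ ^ (- bet n α) * w x) x) ^ 2 =
      ‖x‖ ^ (-(n:ℝ)) * (w x) ^ 2 := by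
  by_cases hx : x = 0
  · subst hx
    simp [hw.eq_zero (x := 0) (by simp)]
  have hp : 0 < ‖x‖ := by simpa using hx
  simp only
  rw [mul_pow, ← mul_assoc]
  congr 1
  rw [← Real.rpow_natCast, ← Real.rpow_mul hp.le, ← Real.rpow_add hp]
  congr 1
  rw [bet]; push_cast; ring

/-- complement of the origin and the unit sphere -/
def W1 (n : ℕ) : Set (𝔼 n) := {x | x ≠ 0 ∧ ‖x‖ ≠ 1}

lemma W1_open : IsOpen (W1 n) :=
  (isOpen_ne).inter (isOpen_ne_fun continuous_norm continuous_const)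

lemma W1_sub : W1 n ⊆ {0}ᶜ := fun _ hx => hx.1

lemma log_ne {x : 𝔼 n} (hx : x ∈ W1 n) : Real.log ‖x‖ ≠ 0 := by
  have : ‖x‖ ≠ 0 := by simpa using hx.1
  refine Real.log_ne_zero_of_pos_of_ne_one (by positivity) hx.2

lemma cd_slog (m : ℕ) : ContDiffOn ℝ ∞ (fun x : 𝔼 n => ((Real.log ‖x‖) ^ m)⁻¹) (W1 n) := by
  have h1 : ContDiffOn ℝ ∞ (fun x : 𝔼 n => Real.log ‖x‖) (W1 n) :=
    (cd_norm.mono W1_sub).log fun x hx => by simpa using hx.1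
  exact (h1.pow m).inv fun x hx => pow_ne_zero _ (log_ne hx)

lemma Eu_slog (m : ℕ) {x : 𝔼 n} (hx : x ∈ W1 n) :
    Eu (fun x : 𝔼 n => ((Real.log ‖x‖) ^ (m + 1))⁻¹) x =
      - (m + 1) * ((Real.log ‖x‖) ^ (m + 2))⁻¹ := by
  have hp : 0 < ‖x‖ := by simpa using hx.1
  have hl := log_ne hx
  have h1 : HasDerivAt (fun r : ℝ => ((Real.log r) ^ (m + 1))⁻¹) _ ‖x‖ :=
    ((Real.hasDerivAt_log hp.ne').pow (m + 1)).inv (pow_ne_zero _ hl)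
  rw [Eu_rad (h := fun r => ((Real.log r) ^ (m + 1))⁻¹) hx.1 h1]
  simp
  field_simp
  ring

lemma hardy {v : (𝔼 n) → ℝ} (hv : TF (W1 n) v) (k : ℕ) :
    ((2 * k + 1 : ℝ) / 2) ^ 2 * In (fun x => ((Real.log ‖x‖) ^ (2 * k + 2))⁻¹ * v x ^ 2) ≤
      In (fun x => ((Real.log ‖x‖) ^ (2 * k))⁻¹ * Eu v x ^ 2) := by
  set c : ℝ := (2 * k + 1 : ℝ) / 2 with hc
  have t1 := ((hv.sq).lmul W1_open (cd_slog (2 * k + 1))).mono W1_sub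
  have h0 := In_Eu t1
  have t2 := ((hv.sq).lmul W1_open (cd_slog (2 * k + 2))).mono W1_sub
  have t3 := ((hv.dv (A := ContinuousLinearMap.id ℝ _)).sq.lmul W1_open (cd_slog (2 * k))).mono W1_sub
  have h1 : 0 ≤ In (fun x => (((Real.log ‖x‖) ^ (2 * k))⁻¹ * Eu v x ^ 2
      - c ^ 2 * (((Real.log ‖x‖) ^ (2 * k + 2))⁻¹ * v x ^ 2))
      - c * (Eu (fun x => ((Real.log ‖x‖) ^ (2 * k + 1))⁻¹ * v x ^ 2) x)) := by
    apply In_nonneg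
    intro x
    by_cases hx : x ∈ W1 n
    · rw [Dv_mul (((cd_slog _).contDiffAt (W1_open.mem_nhds hx)).differentiableAt (by simp)) hv.sq.da,
        Eu_slog _ hx, Dv_comp (h := fun t => t ^ 2) (h' := 2 * v x)
          (by simpa using hasDerivAt_pow 2 (v x)) hv.da]
      have hl := log_ne hx
      have : ((Real.log ‖x‖) ^ (2 * k))⁻¹ * Eu v x ^ 2
        - c ^ 2 * (((Real.log ‖x‖) ^ (2 * k + 2))⁻¹ * v x ^ 2)
        - c * (((Real.log ‖x‖) ^ (2 * k + 1))⁻¹ * (2 * v x * Eu v x)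
          + v x ^ 2 * (-(((2 * k : ℕ) : ℝ) + 1) * ((Real.log ‖x‖) ^ (2 * k + 2))⁻¹)) =
          (((Real.log ‖x‖) ^ k)⁻¹ * (Eu v x - c * v x * (Real.log ‖x‖)⁻¹)) ^ 2 := by
        rw [hc]; push_cast
        field_simp
        ring
      rw [this]; positivity
    · rw [hv.dv.eq_zero hx, hv.eq_zero hx,
        ((hv.sq).lmul W1_open (cd_slog (2 * k + 1))).dv.eq_zero hx]; simp
  rw [In_sub (t3.sub (t2.cmul _)) (t1.dv.cmul _), In_sub t3 (t2.cmul _)] at h1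
  simp only [In_cmul] at h1
  rw [h0] at h1
  linarith

/-- Core: the Hardy-type lower bounds. -/
lemma core_hardy (hw : TF (W1 n) w) :
    (1 / 4) * In (fun x => ((Real.log ‖x‖) ^ 2)⁻¹ * w x ^ 2) ≤ In (fun x => Eu w x ^ 2) ∧
    (9 / 16) * In (fun x => ((Real.log ‖x‖) ^ 4)⁻¹ * w x ^ 2) ≤ In (fun x => Eu (Eu w) x ^ 2) := by
  have h1 := hardy hw 0
  have h2 := hardy hw 1
  have h3 := hardy (hw.dv (A := ContinuousLinearMap.id ℝ _)) 0
  norm_num at h1 h2 h3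
  constructor <;> linarith
end rell

/-- spherical integral -/
def Js (f : (𝔼 n) → ℝ) : ℝ :=
  ∫ σ : sphere (0 : 𝔼 n) 1, f σ ∂((volume : Measure (𝔼 n)).toSphere)

lemma ntr (hn : 2 ≤ n) : Nontrivial (𝔼 n) := by
  have : 0 < n := by omega
  refine ⟨⟨eb ⟨0, this⟩, 0, ?_⟩⟩
  simp [eb]

lemma polar_int (hn : 2 ≤ n) (g : (𝔼 n) → ℝ) :
    ∫ x, g x = ∫ p : sphere (0 : 𝔼 n) 1 × Ioi (0 : ℝ), g (p.2.1 • p.1.1)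
      ∂((volume : Measure (𝔼 n)).toSphere.prod (Measure.volumeIoiPow (n - 1))) := by
  have := ntr hn
  have h := (volume : Measure (𝔼 n)).measurePreserving_homeomorphUnitSphereProd.integral_comp
    (Homeomorph.measurableEmbedding _) (fun p => g (p.2.1 • p.1.1))
  rw [show Module.finrank ℝ (𝔼 n) = n by simp] at h
  rw [← h]
  rw [← restrict_compl_singleton (μ := (volume : Measure (𝔼 n))) 0,
    ← integral_subtype_comap (measurableSet_singleton _).compl]
  simp only [restrict_compl_singleton]
  congr; ext x
  have : ‖x.1‖ ≠ 0 := norm_ne_zero_iff.2 x.2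
  simp [smul_smul, this]

lemma polar_integrable (hn : 2 ≤ n) {g : (𝔼 n) → ℝ} (hg : Integrable g) :
    Integrable (fun p : sphere (0 : 𝔼 n) 1 × Ioi (0 : ℝ) => g (p.2.1 • p.1.1))
      ((volume : Measure (𝔼 n)).toSphere.prod (Measure.volumeIoiPow (n - 1))) := by
  have := ntr hn
  have h := (volume : Measure (𝔼 n)).measurePreserving_homeomorphUnitSphereProd.integrable_comp_emb
    (Homeomorph.measurableEmbedding _) (g := fun p => g (p.2.1 • p.1.1))
  rw [show Module.finrank ℝ (𝔼 n) = n by simp] at h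
  rw [← h]
  rw [← restrict_compl_singleton (μ := (volume : Measure (𝔼 n))) 0] at hg
  have h2 := (integrableOn_iff_comap_subtypeVal (measurableSet_singleton (0 : 𝔼 n)).compl).1 hg
  refine h2.congr (ae_of_all _ fun x => ?_)
  have : ‖x.1‖ ≠ 0 := norm_ne_zero_iff.2 x.2
  simp [smul_smul, this]

lemma norm_smul_sph (r : Ioi (0 : ℝ)) (σ : sphere (0 : 𝔼 n) 1) : ‖r.1 • σ.1‖ = r.1 := by
  have : 0 < r.1 := r.2
  simp [norm_smul, abs_of_pos this]

lemma In_slice (hn : 2 ≤ n) {G : (𝔼 n) → ℝ} (hG : TF {0}ᶜ G)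
    (h : ∀ r : ℝ, 0 < r → 0 ≤ Js (fun x => G (r • x))) : 0 ≤ In G := by
  unfold In
  rw [polar_int hn, integral_prod_symm _ (polar_integrable hn (hG.wt _).int)]
  refine integral_nonneg fun r => ?_
  simp only [norm_smul_sph]
  rw [integral_const_mul]
  exact mul_nonneg (Real.rpow_nonneg (le_of_lt r.2) _) (h r.1 r.2)

lemma In_hom (hn : 2 ≤ n) {f : (𝔼 n) → ℝ} (hf : ∀ t : ℝ, 0 < t → ∀ x, f (t • x) = f x)
    (ζ : ℝ → ℝ) : In (fun x => ζ (Real.log ‖x‖) * f x) = (∫ s, ζ s) * Js f := by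
  unfold In
  rw [polar_int hn]
  have : ∀ p : sphere (0 : 𝔼 n) 1 × Ioi (0 : ℝ), ‖p.2.1 • p.1.1‖ ^ (-(n:ℝ)) *
      (ζ (Real.log ‖p.2.1 • p.1.1‖) * f (p.2.1 • p.1.1)) =
      f p.1.1 * (p.2.1 ^ (-(n:ℝ)) * ζ (Real.log p.2.1)) := by
    intro p
    rw [norm_smul_sph, hf _ p.2.2]; ring
  simp only [this]
  rw [integral_prod_mul (fun σ : sphere (0 : 𝔼 n) 1 => f σ.1)
    (fun r : Ioi (0 : ℝ) => r.1 ^ (-(n:ℝ)) * ζ (Real.log r.1)), mul_comm]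
  congr 1
  simp only [Measure.volumeIoiPow, ENNReal.ofReal]
  rw [integral_withDensity_eq_integral_smul
    ((measurable_subtype_coe.pow_const _).real_toNNReal)]
  rw [integral_subtype_comap measurableSet_Ioi
    fun a : ℝ ↦ Real.toNNReal (a ^ (n - 1)) • (a ^ (-(n:ℝ)) * ζ (Real.log a))]
  have h1 : Ioi (0:ℝ) = Real.exp '' univ := by simp [Real.range_exp]
  rw [h1, integral_image_eq_integral_abs_deriv_smul MeasurableSet.univ
    (fun x _ => (Real.hasDerivAt_exp x).hasDerivWithinAt) Real.exp_injective.injOn]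
  simp only [Measure.restrict_univ]
  congr; ext s
  rw [NNReal.smul_def, Real.coe_toNNReal _ (pow_nonneg (Real.exp_pos s).le _)]
  simp only [Real.log_exp, smul_eq_mul, abs_of_pos (Real.exp_pos s)]
  have : Real.exp s * (Real.exp s ^ (n - 1) * Real.exp s ^ (-(n:ℝ))) = 1 := by
    rw [← mul_assoc, ← pow_succ', Nat.sub_add_cancel (by omega), Real.rpow_neg (Real.exp_pos s).le,
      Real.rpow_natCast, mul_inv_cancel₀ (pow_ne_zero _ (Real.exp_pos s).ne')]
  linear_combination ζ s * this

/-- homogeneous extension -/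
def Hx (v : (𝔼 n) → ℝ) (x : 𝔼 n) : ℝ := v (‖x‖⁻¹ • x)

/-- dilation invariant open sets away from 0 -/
structure IsCone (C : Set (𝔼 n)) : Prop where
  op : IsOpen C
  ne : C ⊆ {0}ᶜ
  dil : ∀ t : ℝ, 0 < t → ∀ x ∈ C, t • x ∈ C

/-- homogeneous test functions -/
structure HF (C : Set (𝔼 n)) (f : (𝔼 n) → ℝ) : Prop where
  hom : ∀ t : ℝ, 0 < t → ∀ x, f (t • x) = f x
  cd : ContDiffOn ℝ ∞ f {0}ᶜ
  sup : tsupport f ∩ {0}ᶜ ⊆ C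
  z : f 0 = 0

lemma isCone_coneOf {S : Set (𝔼 n)} (hS : IsSphDomain S) : IsCone (coneOf S) := by
  refine ⟨?_, fun x hx => hx.1, ?_⟩
  · obtain ⟨O, hO, hOS⟩ := isOpen_induced_iff.1 hS.2.1
    have : coneOf S = {0}ᶜ ∩ (fun x : 𝔼 n => ‖x‖⁻¹ • x) ⁻¹' O := by
      ext x
      simp only [coneOf, mem_ofPred_eq, mem_inter_iff, mem_compl_iff, mem_singleton_iff, mem_preimage]
      refine and_congr_right fun hx => ?_
      have h1 : ‖x‖⁻¹ • x ∈ sphere (0 : 𝔼 n) 1 := by simp [norm_smul, hx]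
      have := Set.ext_iff.1 hOS ⟨_, h1⟩
      simpa using this.symm
    rw [this]
    refine ContinuousOn.isOpen_inter_preimage ?_ open0 hO
    exact (continuous_norm.continuousOn.inv₀ fun x hx => by simpa using hx).smul continuousOn_id
  · intro t ht x hx
    refine ⟨smul_ne_zero ht.ne' hx.1, ?_⟩
    rw [norm_smul, smul_smul, Real.norm_of_nonneg ht.le]
    rw [show (t * ‖x‖)⁻¹ * t = ‖x‖⁻¹ by field_simp]
    exact hx.2

section H
variable {C : Set (𝔼 n)} {f v : (𝔼 n) → ℝ}

lemma IsCone.dil_iff (hC : IsCone C) {t : ℝ} (ht : 0 < t) {x : 𝔼 n} : t • x ∈ C ↔ x ∈ C := by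
  refine ⟨fun h => ?_, hC.dil t ht x⟩
  have := hC.dil t⁻¹ (inv_pos.2 ht) _ h
  rwa [smul_smul, inv_mul_cancel₀ ht.ne', one_smul] at this

lemma cd_proj : ContDiffOn ℝ ∞ (fun x : 𝔼 n => ‖x‖⁻¹ • x) {0}ᶜ :=
  (cd_norm.inv fun x hx => by simpa using hx).smul contDiffOn_id

lemma Hx_hom (v : (𝔼 n) → ℝ) (t : ℝ) (ht : 0 < t) (x : 𝔼 n) : Hx v (t • x) = Hx v x := by
  unfold Hx
  rw [norm_smul, smul_smul, Real.norm_of_nonneg ht.le]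
  by_cases hx : x = 0
  · simp [hx]
  rw [show (t * ‖x‖)⁻¹ * t = ‖x‖⁻¹ by field_simp]

lemma TF.Hx (hC : IsCone C) (hv : TF C v) : HF C (Hx v) := by
  refine ⟨Hx_hom v, hv.1.comp_contDiffOn cd_proj, ?_, ?_⟩
  swap
  · simpa [_root_.Hx] using hv.eq_zero (fun h => hC.ne h rfl)
  rintro x ⟨hx, hx0⟩
  have hx0' : x ≠ 0 := hx0
  have hp : 0 < ‖x‖ := by simpa using hx0'
  have h1 : ‖x‖⁻¹ • x ∈ tsupport v := by
    have hc : ContinuousAt (fun x : 𝔼 n => ‖x‖⁻¹ • x) x :=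
      cd_proj.continuousOn.continuousAt (open0.mem_nhds hx0)
    by_contra hcon
    have : ∀ᶠ y in 𝓝 x, ‖y‖⁻¹ • y ∈ (tsupport v)ᶜ :=
      hc ((isClosed_tsupport v).isOpen_compl.mem_nhds hcon)
    obtain ⟨y, hy1, hy2⟩ := mem_closure_iff_nhds.1 hx _ this
    exact hy2 (image_eq_zero_of_notMem_tsupport (f := v) hy1)
  exact (hC.dil_iff (inv_pos.2 hp)).1 (hv.2.2 h1)

lemma Lr_Hx (i j : Fin n) {x : 𝔼 n} (hx : x ≠ 0) (hv : DifferentiableAt ℝ v (‖x‖⁻¹ • x)) :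
    Lr i j (Hx v) x = Hx (Lr i j v) x := by
  have hn : HasFDerivAt (fun x : 𝔼 n => ‖x‖⁻¹) _ x :=
    (hasDerivAt_inv (by simpa using hx)).comp_hasFDerivAt x (da_norm hx).hasFDerivAt
  have h1 : HasFDerivAt (fun x : 𝔼 n => ‖x‖⁻¹ • x) _ x := hn.smul (hasFDerivAt_id x)
  have h2 := HasFDerivAt.comp (f := fun x : 𝔼 n => ‖x‖⁻¹ • x) x hv.hasFDerivAt h1
  have h3 : fderiv ℝ (Hx v) x = _ := h2.fderiv
  have h4 := Lr_norm i j hx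
  simp only [Dv] at h4
  simp only [Dv, h3]
  simp [Hx, h4, Dv]

lemma Lr_Hx_on (i j : Fin n) (hv : Differentiable ℝ v) :
    EqOn (Lr i j (Hx v)) (Hx (Lr i j v)) {0}ᶜ := fun _ hx => Lr_Hx i j hx (hv _)

lemma Ds_Hx (hv : TF C v) {x : 𝔼 n} (hx : x ≠ 0) : Ds (Hx v) x = Hx (Ds v) x := by
  simp only [Ds, Hx]
  congr 1
  refine Finset.sum_congr rfl fun i _ => Finset.sum_congr rfl fun j _ => ?_
  rw [Dv_congr_open open0 (Lr_Hx_on i j (hv.1.differentiable (by simp))) hx]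
  exact Lr_Hx i j hx hv.dv.da

lemma Gs_Hx (hv : TF C v) {x : 𝔼 n} (hx : x ≠ 0) : Gs (Hx v) x = Hx (Gs v) x := by
  simp only [Gs, Hx]
  congr 1
  refine Finset.sum_congr rfl fun i _ => Finset.sum_congr rfl fun j _ => ?_
  rw [Lr_Hx i j hx hv.da]; rfl

lemma Js_congr {f g : (𝔼 n) → ℝ} (h : ∀ x, ‖x‖ = 1 → f x = g x) : Js f = Js g := by
  unfold Js; congr; ext σ; exact h _ (by simp)

lemma Hx_sph (v : (𝔼 n) → ℝ) {x : 𝔼 n} (hx : ‖x‖ = 1) : Hx v x = v x := by simp [Hx, hx]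

lemma TF.dil (hC : IsCone C) (hv : TF C v) {r : ℝ} (hr : 0 < r) : TF C (fun x => v (r • x)) := by
  have hcd : ContDiff ℝ ∞ (fun x => v (r • x)) := hv.1.comp (contDiff_id.const_smul r)
  have hts : tsupport (fun x => v (r • x)) ⊆ (fun x => r • x) ⁻¹' tsupport v := by
    apply closure_minimal _ ((isClosed_tsupport v).preimage (continuous_const_smul r))
    intro x hx; exact subset_tsupport _ hx
  refine ⟨hcd, ?_, fun x hx => (hC.dil_iff hr).1 (hv.2.2 (hts hx))⟩
  exact hv.2.1.comp_homeomorph (Homeomorph.smulOfNeZero r hr.ne')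

lemma Ds_dil (hv : TF C v) {r : ℝ} (x : 𝔼 n) :
    Ds (fun x => v (r • x)) x = Ds v (r • x) := by
  simp only [Ds]
  congr 1
  refine Finset.sum_congr rfl fun i _ => Finset.sum_congr rfl fun j _ => ?_
  have : Lr i j (fun x => v (r • x)) = fun x => Lr i j v (r • x) := by
    ext y; exact Dv_dil hv.da
  rw [this]; exact Dv_dil hv.dv.da

lemma Gs_dil (hv : TF C v) {r : ℝ} (x : 𝔼 n) :
    Gs (fun x => v (r • x)) x = Gs v (r • x) := by
  simp only [Gs]
  congr 1
  refine Finset.sum_congr rfl fun i _ => Finset.sum_congr rfl fun j _ => ?_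
  rw [Dv_dil hv.da]

lemma slice_Gs (hn : 2 ≤ n) (hC : IsCone C) {lam : ℝ}
    (h : ∀ f, HF C f → 0 ≤ Js (fun x => Gs f x - lam * f x ^ 2)) (hv : TF C v) :
    0 ≤ In (fun x => Gs v x - lam * v x ^ 2) := by
  refine In_slice hn ((hv.gs.sub (hv.sq.cmul lam)).mono hC.ne) fun r hr => ?_
  have hd := hv.dil hC hr
  have := h _ (hd.Hx hC)
  refine this.trans_eq (Js_congr fun x hx => ?_)
  have hx0 : x ≠ 0 := by rintro rfl; simp at hx
  rw [Gs_Hx hd hx0, Hx_sph _ hx, Hx_sph _ hx, Gs_dil hv]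

lemma slice_Ds (hn : 2 ≤ n) (hC : IsCone C) {γ mu : ℝ}
    (h : ∀ f, HF C f → 0 ≤ Js (fun x => (Ds f x - γ * f x) ^ 2 - mu * f x ^ 2)) (hv : TF C v) :
    0 ≤ In (fun x => (Ds v x - γ * v x) ^ 2 - mu * v x ^ 2) := by
  refine In_slice hn (((hv.ds.sub (hv.cmul γ)).sq.sub (hv.sq.cmul mu)).mono hC.ne) fun r hr => ?_
  have hd := hv.dil hC hr
  have := h _ (hd.Hx hC)
  refine this.trans_eq (Js_congr fun x hx => ?_)
  have hx0 : x ≠ 0 := by rintro rfl; simp at hx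
  rw [Ds_Hx hd hx0, Hx_sph _ hx, Hx_sph _ hx, Ds_dil hv]

end H

section HFs
variable {C : Set (𝔼 n)} {f g : (𝔼 n) → ℝ}

lemma HF.da (hf : HF C f) {x : 𝔼 n} (hx : x ≠ 0) : DifferentiableAt ℝ f x :=
  (hf.cd.contDiffAt (open0.mem_nhds hx)).differentiableAt (by simp)

lemma HF.cda (hf : HF C f) {x : 𝔼 n} (hx : x ≠ 0) : ContDiffAt ℝ ∞ f x :=
  hf.cd.contDiffAt (open0.mem_nhds hx)

lemma HF.eq_zero (hf : HF C f) {x : 𝔼 n} (hx : x ∉ C) : f x = 0 := by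
  by_cases h0 : x = 0
  · rw [h0, hf.z]
  · exact image_eq_zero_of_notMem_tsupport fun h => hx (hf.sup ⟨h, h0⟩)

lemma HF.eu (hf : HF C f) (x : 𝔼 n) : Eu f x = 0 := by
  by_cases h0 : x = 0
  · simp [Dv, h0]
  have h1 : HasDerivAt (fun t : ℝ => t • x) x 1 := by
    simpa using (hasDerivAt_id (1:ℝ)).smul_const x
  have h2 : HasDerivAt (fun t : ℝ => f (t • x)) (fderiv ℝ f x x) 1 := by
    have : HasFDerivAt f (fderiv ℝ f x) ((1:ℝ) • x) := by
      rw [one_smul]; exact (hf.da h0).hasFDerivAt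
    exact this.comp_hasDerivAt (1:ℝ) h1
  have h3 : HasDerivAt (fun t : ℝ => f (t • x)) 0 1 := by
    refine (hasDerivAt_const (1:ℝ) (f x)).congr_of_eventuallyEq ?_
    filter_upwards [lt_mem_nhds (zero_lt_one (α := ℝ))] with t ht
    exact hf.hom t ht x
  simpa [Dv] using h2.unique h3

lemma HF.dv (hf : HF C f) {A : (𝔼 n) →L[ℝ] (𝔼 n)} : HF C (Dv A f) := by
  refine ⟨fun t ht x => ?_, contDiffOn_Dv open0 hf.cd, ?_, by simp [Dv]⟩
  · by_cases h0 : x = 0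
    · simp [h0]
    rw [← Dv_dil (hf.da (smul_ne_zero ht.ne' h0))]
    congr; ext y; exact hf.hom t ht y
  · refine (inter_subset_inter_left _ ?_).trans hf.sup
    refine (closure_mono ?_).trans (tsupport_fderiv_subset ℝ (f := f))
    intro x hx
    simp only [Function.mem_support] at *
    exact fun h0 => hx (by simp [Dv, h0])

lemma HF.of_supp (hf : HF C f) (hom : ∀ t : ℝ, 0 < t → ∀ x, g (t • x) = g x)
    (hg : ContDiffOn ℝ ∞ g {0}ᶜ) (h : ∀ x, f x = 0 → g x = 0) : HF C g := by
  refine ⟨hom, hg, (inter_subset_inter_left _ (closure_mono ?_)).trans hf.sup, h _ hf.z⟩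
  intro x hx
  simp only [Function.mem_support] at *
  exact fun h0 => hx (h x h0)

lemma HF.zero : HF C (fun _ => (0:ℝ)) := by
  refine ⟨fun _ _ _ => rfl, contDiffOn_const, ?_, rfl⟩
  have : tsupport (fun _ : 𝔼 n => (0:ℝ)) = ∅ := by
    rw [tsupport_eq_empty_iff]; rfl
  rw [this]; simp

lemma HF.add (hf : HF C f) (hg : HF C g) : HF C (fun x => f x + g x) := by
  refine ⟨fun t ht x => by rw [hf.hom t ht, hg.hom t ht], hf.cd.add hg.cd, ?_, by simp [hf.z, hg.z]⟩
  rintro x ⟨hx, h0⟩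
  rcases tsupport_add f g hx with h | h
  · exact hf.sup ⟨h, h0⟩
  · exact hg.sup ⟨h, h0⟩

lemma HF.cmul (hf : HF C f) (c : ℝ) : HF C (fun x => c * f x) :=
  hf.of_supp (fun t ht x => by rw [hf.hom t ht]) (contDiffOn_const.mul hf.cd) fun x h => by simp [h]

lemma HF.sub (hf : HF C f) (hg : HF C g) : HF C (fun x => f x - g x) := by
  have := hf.add (hg.cmul (-1))
  refine cast ?_ this
  congr; ext x; ring

lemma HF.sq (hf : HF C f) : HF C (fun x => f x ^ 2) :=
  hf.of_supp (fun t ht x => by rw [hf.hom t ht]) (hf.cd.pow 2) fun x h => by simp [h]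

lemma HF.sum {ι : Type*} {s : Finset ι} {F : ι → (𝔼 n) → ℝ} (h : ∀ i ∈ s, HF C (F i)) :
    HF C (fun x => ∑ i ∈ s, F i x) := by
  classical
  induction s using Finset.induction_on with
  | empty => simpa using HF.zero
  | insert a s ha ih =>
    simp only [Finset.sum_insert ha]
    exact (h a (by simp)).add (ih fun i hi => h i (by simp [hi]))

lemma HF.ds (hf : HF C f) : HF C (Ds f) :=
  (HF.sum fun _ _ => HF.sum fun _ _ => hf.dv.dv).cmul _

lemma HF.gs (hf : HF C f) : HF C (Gs f) :=
  (HF.sum fun _ _ => HF.sum fun _ _ => hf.dv.sq).cmul _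

lemma Gs_nonneg (f : (𝔼 n) → ℝ) (x : 𝔼 n) : 0 ≤ Gs f x :=
  mul_nonneg (by norm_num) (Finset.sum_nonneg fun _ _ => Finset.sum_nonneg fun _ _ => sq_nonneg _)

lemma HF.intS (hf : HF C f) : Integrable (fun σ : sphere (0 : 𝔼 n) 1 => f σ)
    ((volume : Measure (𝔼 n)).toSphere) := by
  have hc : Continuous (fun σ : sphere (0 : 𝔼 n) 1 => f σ) := by
    refine hf.cd.continuousOn.comp_continuous continuous_subtype_val fun σ => ?_
    have : ‖σ.1‖ = 1 := by simp
    intro h0; rw [mem_singleton_iff.1 h0] at this; simp at this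
  exact hc.integrable_of_hasCompactSupport (HasCompactSupport.of_compactSpace _)

lemma Js_sub (hf : HF C f) (hg : HF C g) : Js (fun x => f x - g x) = Js f - Js g :=
  integral_sub hf.intS hg.intS
lemma Js_add (hf : HF C f) (hg : HF C g) : Js (fun x => f x + g x) = Js f + Js g :=
  integral_add hf.intS hg.intS
lemma Js_cmul (c : ℝ) (f : (𝔼 n) → ℝ) : Js (fun x => c * f x) = c * Js f :=
  integral_const_mul _ _
lemma Js_nonneg {f : (𝔼 n) → ℝ} (h : ∀ x, 0 ≤ f x) : 0 ≤ Js f := integral_nonneg fun _ => h _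

variable {ζ : ℝ → ℝ}

lemma cd_log : ContDiffOn ℝ ∞ (fun x : 𝔼 n => Real.log ‖x‖) {0}ᶜ :=
  cd_norm.log fun x hx => by simpa using hx

/-- radial cutoff of homogeneous test functions -/
lemma HF.cut (hf : HF C f) (hz : ContDiff ℝ ∞ ζ) (hc : HasCompactSupport ζ) :
    TF C (fun x => ζ (Real.log ‖x‖) * f x) := by
  obtain ⟨M, hM⟩ := hc.isCompact.isBounded.subset_closedBall (0:ℝ)
  set K : Set (𝔼 n) := {x | Real.exp (-M) ≤ ‖x‖ ∧ ‖x‖ ≤ Real.exp M} with hK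
  have hKc : IsClosed K := (isClosed_le continuous_const continuous_norm).inter
    (isClosed_le continuous_norm continuous_const)
  have hs : Function.support (fun x => ζ (Real.log ‖x‖) * f x) ⊆ K := by
    intro x hx
    have hx0 : x ≠ 0 := by rintro rfl; simp [hf.z] at hx
    have hp : 0 < ‖x‖ := by simpa using hx0
    have h1 : ζ (Real.log ‖x‖) ≠ 0 := left_ne_zero_of_mul hx
    have h2 := hM (subset_tsupport ζ h1)
    rw [mem_closedBall, dist_zero_right, Real.norm_eq_abs, abs_le] at h2
    exact ⟨(Real.le_log_iff_exp_le hp).1 h2.1, (Real.log_le_iff_le_exp hp).1 h2.2⟩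
  have hts : tsupport (fun x => ζ (Real.log ‖x‖) * f x) ⊆ K := closure_minimal hs hKc
  have hK0 : K ⊆ {0}ᶜ := by
    rintro x hx h0
    rw [mem_singleton_iff.1 h0, hK] at hx
    have := hx.1; simp at this
    exact absurd this (not_le.2 (Real.exp_pos _))
  refine ⟨cd_of_tsupp fun x hx => ?_, ?_, ?_⟩
  · have h0 := open0.mem_nhds (hK0 (hts hx))
    exact (hz.contDiffAt.comp x (cd_log.contDiffAt h0)).mul (hf.cd.contDiffAt h0)
  · refine HasCompactSupport.intro' (isCompact_closedBall (0 : 𝔼 n) (Real.exp M)) isClosed_closedBall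
      fun x hx => ?_
    by_contra h
    exact hx (by simpa using (hs h).2)
  · exact fun x hx => hf.sup ⟨(tsupport_mul_subset_right (f := fun x => ζ (Real.log ‖x‖))) hx, hK0 (hts hx)⟩

lemma Eu_cut (hf : HF C f) (hz : ContDiff ℝ ∞ ζ) :
    Eu (fun x => ζ (Real.log ‖x‖) * f x) = fun x => deriv ζ (Real.log ‖x‖) * f x := by
  ext x
  by_cases h0 : x = 0
  · subst h0; simp [Dv, hf.z]
  have hp : 0 < ‖x‖ := by simpa using h0
  have h1 : HasDerivAt (fun r => ζ (Real.log r)) (deriv ζ (Real.log ‖x‖) * ‖x‖⁻¹) ‖x‖ :=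
    HasDerivAt.comp ‖x‖ ((hz.differentiable (by simp)) _).hasDerivAt (Real.hasDerivAt_log hp.ne')
  have h2 : DifferentiableAt ℝ (fun x : 𝔼 n => ζ (Real.log ‖x‖)) x :=
    (h1.comp_hasFDerivAt (f := fun x : 𝔼 n => ‖x‖) x (da_norm h0).hasFDerivAt).differentiableAt
  rw [Dv_mul h2 (hf.da h0), Eu_rad (h := fun r => ζ (Real.log r)) h0 h1, hf.eu]
  field_simp; ring

lemma Lr_cut (hf : HF C f) (hz : ContDiff ℝ ∞ ζ) (i j : Fin n) :
    Lr i j (fun x => ζ (Real.log ‖x‖) * f x) = fun x => ζ (Real.log ‖x‖) * Lr i j f x := by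
  ext x
  by_cases h0 : x = 0
  · subst h0; simp [Dv]
  have hp : 0 < ‖x‖ := by simpa using h0
  have h1 : HasDerivAt (fun r => ζ (Real.log r)) (deriv ζ (Real.log ‖x‖) * ‖x‖⁻¹) ‖x‖ :=
    HasDerivAt.comp ‖x‖ ((hz.differentiable (by simp)) _).hasDerivAt (Real.hasDerivAt_log hp.ne')
  have h2 : DifferentiableAt ℝ (fun x : 𝔼 n => ζ (Real.log ‖x‖)) x :=
    (h1.comp_hasFDerivAt (f := fun x : 𝔼 n => ‖x‖) x (da_norm h0).hasFDerivAt).differentiableAt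
  rw [Dv_mul h2 (hf.da h0), Lr_rad (h := fun r => ζ (Real.log r)) i j h0 h1.differentiableAt]
  ring

lemma Gs_cut (hf : HF C f) (hz : ContDiff ℝ ∞ ζ) :
    Gs (fun x => ζ (Real.log ‖x‖) * f x) = fun x => ζ (Real.log ‖x‖) ^ 2 * Gs f x := by
  ext x
  simp only [Gs, Lr_cut hf hz, mul_pow, ← Finset.mul_sum]; ring

lemma Ds_cut (hf : HF C f) (hz : ContDiff ℝ ∞ ζ) :
    Ds (fun x => ζ (Real.log ‖x‖) * f x) = fun x => ζ (Real.log ‖x‖) * Ds f x := by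
  ext x
  simp only [Ds, Lr_cut hf hz, Lr_cut hf.dv hz, ← Finset.mul_sum]; ring

lemma muD_nonneg_set {Ω : Set (𝔼 n)} {α q : ℝ} (hq : ∃ u, DirichletAdm Ω u ∧ (∃ x ∈ Ω, u x ≠ 0) ∧
    q = (∫ x in Ω, ‖x‖ ^ α * (lap u x) ^ 2) / (∫ x in Ω, ‖x‖ ^ (α - 4) * (u x) ^ 2)) : 0 ≤ q := by
  obtain ⟨u, -, -, rfl⟩ := hq
  exact div_nonneg (integral_nonneg fun x => by positivity) (integral_nonneg fun x => by positivity)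

lemma lap_eq_zero {u : (𝔼 n) → ℝ} {x : 𝔼 n} (h0 : x ∉ tsupport u) : lap u x = 0 := by
  rw [lap_eq]
  have h1 : x ∉ tsupport (fderiv ℝ u) := fun h => h0 (tsupport_fderiv_subset ℝ h)
  have h2 : x ∉ tsupport (fderiv ℝ (fderiv ℝ u)) := fun h => h1 (tsupport_fderiv_subset ℝ h)
  simp [image_eq_zero_of_notMem_tsupport h2]

lemma muD_le {u : (𝔼 n) → ℝ} (hu : TF C u) (α : ℝ) :
    muD C α * ∫ x, ‖x‖ ^ (α - 4) * (u x) ^ 2 ≤ ∫ x, ‖x‖ ^ α * (lap u x) ^ 2 := by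
  have hN : 0 ≤ ∫ x, ‖x‖ ^ α * (lap u x) ^ 2 := integral_nonneg fun x => by positivity
  have hD : 0 ≤ ∫ x, ‖x‖ ^ (α - 4) * (u x) ^ 2 := integral_nonneg fun x => by positivity
  rcases hD.eq_or_lt with h | h
  · rw [← h]; simpa using hN
  rw [← le_div_iff₀ h]
  refine csInf_le ⟨0, fun q hq => muD_nonneg_set hq⟩ ⟨u, ⟨hu.cd2, hu.2.1, hu.2.2⟩, ?_, ?_⟩
  · by_contra hcon
    push Not at hcon
    have : ∀ x, u x = 0 := fun x => by
      by_cases hx : x ∈ C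
      · exact hcon x hx
      · exact hu.eq_zero hx
    simp [this] at h
  · rw [setIntegral_eq_integral_of_forall_compl_eq_zero, setIntegral_eq_integral_of_forall_compl_eq_zero]
    · intro x hx; simp [hu.eq_zero hx]
    · intro x hx; simp [lap_eq_zero fun h => hx (hu.2.2 h)]

lemma muD_le_In (hC : IsCone C) {w : (𝔼 n) → ℝ} (hw : TF C w) (α : ℝ) :
    muD C α * In (fun x => w x ^ 2) ≤
      In (fun x => (Eu (Eu w) x) ^ 2) + In (fun x => (Ds w x - gam n α * w x) ^ 2)
      + 2 * In (Gs (Eu w)) + 2 * gbar n α * In (fun x => (Eu w x) ^ 2) := by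
  have hw0 := hw.mono hC.ne
  rw [← rellich_id hw0]
  have h := muD_le (hw.lmul hC.op ((cd_norm_rpow (- bet n α)).mono hC.ne)) α
  simp only [ef_lap hw0, ef_wt hw0] at h
  exact h

lemma muD_sph (hn : 2 ≤ n) (hC : IsCone C) (hf : HF C f) (α : ℝ) :
    0 ≤ Js (fun x => (Ds f x - gam n α * f x) ^ 2 - muD C α * f x ^ 2) := by
  rw [Js_sub (hf.ds.sub (hf.cmul _)).sq (hf.sq.cmul _), Js_cmul]
  set A := Js (fun x => (Ds f x - gam n α * f x) ^ 2)
  set B := Js (fun x => f x ^ 2)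
  obtain ⟨η, hcd, hcs, hη⟩ : ∃ η : ℝ → ℝ, ContDiff ℝ ∞ η ∧ HasCompactSupport η ∧ η 0 = 1 := by
    obtain ⟨b⟩ : Nonempty (ContDiffBump (0:ℝ)) := inferInstance
    exact ⟨b, b.contDiff, b.hasCompactSupport, b.one_of_mem_closedBall (by simp [b.rIn_pos.le])⟩
  set I0 := ∫ s, η s ^ 2
  set I1 := ∫ s, deriv η s ^ 2
  set I2 := ∫ s, deriv (deriv η) s ^ 2
  have hI0 : 0 < I0 := by
    have hc2 : Continuous (fun s => η s ^ 2) := hcd.continuous.pow 2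
    refine hc2.integral_pos_of_hasCompactSupport_nonneg_nonzero (x := 0) ?_ (fun s => sq_nonneg _) ?_
    · exact hcs.comp_left (g := fun t : ℝ => t ^ 2) (by simp)
    · simp [hη]
  -- key inequality
  have key : ∀ T : ℝ, 0 < T → muD C α * (I0 * B) ≤ I0 * A +
      (T⁻¹ ^ 4 * I2 * B + 2 * (T⁻¹ ^ 2 * I1 * Js (Gs f)) + 2 * gbar n α * (T⁻¹ ^ 2 * I1 * B)) := by
    intro T hT
    set ζ : ℝ → ℝ := fun s => η (s / T) with hζ
    have hzc : ContDiff ℝ ∞ ζ := hcd.comp (contDiff_id.div_const T)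
    have hzs : HasCompactSupport ζ := by
      have := hcs.comp_homeomorph (Homeomorph.mulRight₀ T⁻¹ (inv_ne_zero hT.ne'))
      exact this
    have hd1 : deriv ζ = fun s => T⁻¹ * deriv η (s / T) := by
      ext s
      have : HasDerivAt ζ (deriv η (s / T) * (1 / T)) s :=
        HasDerivAt.comp s ((hcd.differentiable (by simp)) _).hasDerivAt ((hasDerivAt_id s).div_const T)
      rw [this.deriv]; ring
    have hcd1 : ContDiff ℝ ∞ (deriv η) := ((contDiff_succ_iff_deriv (n := ∞)).1 (by simpa using hcd)).2.2
    have hd2 : deriv (deriv ζ) = fun s => T⁻¹ * (T⁻¹ * deriv (deriv η) (s / T)) := by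
      ext s
      rw [hd1]
      have : HasDerivAt (fun s => T⁻¹ * deriv η (s / T)) (T⁻¹ * (deriv (deriv η) (s / T) * (1 / T))) s :=
        (HasDerivAt.comp s ((hcd1.differentiable (by simp)) _).hasDerivAt
          ((hasDerivAt_id s).div_const T)).const_mul _
      rw [this.deriv]; ring
    have hzc1 : ContDiff ℝ ∞ (deriv ζ) := by
      rw [hd1]; exact contDiff_const.mul (hcd1.comp (contDiff_id.div_const T))
    have hw := hf.cut hzc hzs
    have h := muD_le_In hC hw α
    rw [Eu_cut hf hzc, Eu_cut hf hzc1, Ds_cut hf hzc, Gs_cut hf hzc1] at h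
    have e1 : ∀ θ : ℝ → ℝ, In (fun x : 𝔼 n => (θ (Real.log ‖x‖) * f x) ^ 2) = (∫ s, θ s ^ 2) * B := by
      intro θ
      rw [← In_hom hn hf.sq.hom (fun s => θ s ^ 2)]
      congr; ext x; ring
    have e2 : In (fun x : 𝔼 n => (ζ (Real.log ‖x‖) * Ds f x - gam n α * (ζ (Real.log ‖x‖) * f x)) ^ 2)
        = (∫ s, ζ s ^ 2) * A := by
      rw [← In_hom hn (hf.ds.sub (hf.cmul _)).sq.hom (fun s => ζ s ^ 2)]
      congr; ext x; ring
    have e3 : In (fun x : 𝔼 n => deriv ζ (Real.log ‖x‖) ^ 2 * Gs f x) = (∫ s, deriv ζ s ^ 2) * Js (Gs f) :=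
      In_hom hn hf.gs.hom (fun s => deriv ζ s ^ 2)
    rw [e1, e1, e1, e2, e3] at h
    have i0 : ∫ s, ζ s ^ 2 = T * I0 := by
      have := Measure.integral_comp_div (fun s => η s ^ 2) T
      rw [abs_of_pos hT] at this; exact this
    have i1 : ∫ s, deriv ζ s ^ 2 = T * (T⁻¹ ^ 2 * I1) := by
      have := Measure.integral_comp_div (fun s => deriv η s ^ 2) T
      rw [abs_of_pos hT, smul_eq_mul] at this
      rw [hd1]; simp only [mul_pow]; rw [integral_const_mul, this]; ring
    have i2 : ∫ s, deriv (deriv ζ) s ^ 2 = T * (T⁻¹ ^ 4 * I2) := by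
      have := Measure.integral_comp_div (fun s => deriv (deriv η) s ^ 2) T
      rw [abs_of_pos hT, smul_eq_mul] at this
      rw [hd2]; simp only [mul_pow]; rw [integral_const_mul, integral_const_mul, this]; ring
    rw [i0, i1, i2] at h
    refine le_of_mul_le_mul_left (?_ : T * _ ≤ T * _) hT
    linarith
  have hlim : Tendsto (fun T : ℝ => I0 * A +
      (T⁻¹ ^ 4 * I2 * B + 2 * (T⁻¹ ^ 2 * I1 * Js (Gs f)) + 2 * gbar n α * (T⁻¹ ^ 2 * I1 * B)))
      atTop (𝓝 (I0 * A + (0 ^ 4 * I2 * B + 2 * (0 ^ 2 * I1 * Js (Gs f)) +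
        2 * gbar n α * (0 ^ 2 * I1 * B)))) := by
    have h0 : Tendsto (fun T : ℝ => T⁻¹) atTop (𝓝 0) := tendsto_inv_atTop_zero
    have hcont : Continuous (fun y : ℝ => I0 * A + (y ^ 4 * I2 * B + 2 * (y ^ 2 * I1 * Js (Gs f)) +
        2 * gbar n α * (y ^ 2 * I1 * B))) := by fun_prop
    exact (hcont.tendsto 0).comp h0
  have := ge_of_tendsto hlim ((eventually_gt_atTop 0).mono fun T hT => key T hT)
  have h2 : I0 * (muD C α * B) ≤ I0 * A := by
    norm_num at this; linarith
  linarith [le_of_mul_le_mul_left h2 hI0]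

lemma muD_In (hn : 2 ≤ n) (hC : IsCone C) {v : (𝔼 n) → ℝ} (hv : TF C v) (α : ℝ) :
    muD C α * In (fun x => v x ^ 2) ≤ In (fun x => (Ds v x - gam n α * v x) ^ 2) := by
  have h := slice_Ds hn hC (fun f hf => muD_sph hn hC hf α) hv
  rw [In_sub ((hv.ds.sub (hv.cmul _)).sq.mono hC.ne) ((hv.sq.cmul _).mono hC.ne), In_cmul] at h
  linarith

end HFs

section approx
open ContinuousLinearMap

/-- The inequality for smooth functions. -/
lemma main_smooth (hn : 2 ≤ n) {C : Set (𝔼 n)} (hC : IsCone C) (α : ℝ) {lam : ℝ} (hl : 0 ≤ lam)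
    (hP : ∀ v, TF C v → lam * In (fun x => v x ^ 2) ≤ In (Gs v)) {u : (𝔼 n) → ℝ}
    (hu : TF (C ∩ W1 n) u) :
    ((gbar n α + lam) / 2) * (∫ x, ‖x‖ ^ (α - 4) * ((Real.log ‖x‖) ^ 2)⁻¹ * (u x) ^ 2) +
      (9 / 16) * (∫ x, ‖x‖ ^ (α - 4) * ((Real.log ‖x‖) ^ 4)⁻¹ * (u x) ^ 2) ≤
      (∫ x, ‖x‖ ^ α * (lap u x) ^ 2) - muD C α * (∫ x, ‖x‖ ^ (α - 4) * (u x) ^ 2) := by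
  set w : (𝔼 n) → ℝ := fun x => ‖x‖ ^ (bet n α) * u x with hw
  have hO : IsOpen (C ∩ W1 n) := hC.op.inter W1_open
  have hwT : TF (C ∩ W1 n) w :=
    hu.lmul hO ((cd_norm_rpow _).mono (inter_subset_left.trans hC.ne))
  have hwC := hwT.mono inter_subset_left
  have hw0 := hwC.mono hC.ne
  have hww := hwT.mono inter_subset_right
  have hu0 := (hu.mono inter_subset_left).mono hC.ne
  have hueq : u = fun x => ‖x‖ ^ (- bet n α) * w x := by
    ext x
    by_cases hx : x = 0
    · subst hx; simp [hu0.eq_zero (x := 0) (by simp), hw]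
    have hp : 0 < ‖x‖ := by simpa using hx
    rw [hw]; simp only; rw [← mul_assoc, ← Real.rpow_add hp]; simp
  have e1 : ∫ x, ‖x‖ ^ α * (lap u x) ^ 2 = In (fun x => (Eu (Eu w) x - (α - 2) * Eu w x + Ds w x - gam n α * w x) ^ 2) := by
    rw [hueq]; simp only [ef_lap hw0]; rfl
  have e2 : ∫ x, ‖x‖ ^ (α - 4) * (u x) ^ 2 = In (fun x => w x ^ 2) := by
    rw [hueq]; simp only [ef_wt hw0]; rfl
  have e3 : ∀ m : ℕ, ∫ x, ‖x‖ ^ (α - 4) * ((Real.log ‖x‖) ^ m)⁻¹ * (u x) ^ 2 =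
      In (fun x => ((Real.log ‖x‖) ^ m)⁻¹ * w x ^ 2) := by
    intro m
    unfold In
    congr; ext x
    have := ef_wt hw0 α x
    rw [hueq]; simp only at this ⊢
    linear_combination ((Real.log ‖x‖) ^ m)⁻¹ * this
  rw [e1, e2, e3, e3, rellich_id hw0]
  have h1 := core_hardy hww
  have h2 := muD_In hn hC hwC α
  have h3 := hP _ (hwC.dv (A := ContinuousLinearMap.id ℝ _))
  have hg : 0 ≤ gbar n α + lam := by unfold gbar; positivity
  have h4 := mul_le_mul_of_nonneg_left h1.1 hg
  have h5 := h1.2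
  have h3' : lam * In (fun x => Eu w x ^ 2) ≤ In (Gs (Eu w)) := h3
  nlinarith

variable {F : Type} [NormedAddCommGroup F] [NormedSpace ℝ F] [CompleteSpace F]

/-- Mollification. -/
def mol (φ : ContDiffBump (0 : 𝔼 n)) (g : (𝔼 n) → F) : (𝔼 n) → F :=
  MeasureTheory.convolution (ContDiffBump.normed φ volume) g (lsmul ℝ ℝ) volume

lemma mol_fderiv (φ : ContDiffBump (0 : 𝔼 n)) {g : (𝔼 n) → F} (hg : ContDiff ℝ 1 g)
    (hc : HasCompactSupport g) :
    fderiv ℝ (mol φ g) = mol φ (fderiv ℝ g) := by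
  ext1 x
  have h := hc.hasFDerivAt_convolution_right (lsmul ℝ ℝ) (μ := volume)
    (f := φ.normed volume) (φ.integrable_normed.locallyIntegrable) hg x
  unfold mol
  rw [h.fderiv]
  rfl

lemma mol_bound (φ : ContDiffBump (0 : 𝔼 n)) {g : (𝔼 n) → F} (hg : Continuous g) {M : ℝ}
    (hM : ∀ x, ‖g x‖ ≤ M) (x : 𝔼 n) : ‖(mol φ g) x‖ ≤ 3 * M := by
  have h := φ.dist_normed_convolution_le (μ := volume) (x₀ := x) (g := g) (ε := 2 * M)
    hg.aestronglyMeasurable fun y _ => by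
      rw [dist_eq_norm]; linarith [norm_sub_le (g y) (g x), hM x, hM y]
  rw [dist_eq_norm] at h
  change ‖mol φ g x - g x‖ ≤ 2 * M at h
  have := norm_le_norm_add_norm_sub' ((mol φ g) x) (g x)
  linarith [hM x]

lemma lim_int {a : (𝔼 n) → ℝ} {K : Set (𝔼 n)} (hK : IsCompact K) (ha : ContinuousOn a K)
    {g : ℕ → (𝔼 n) → ℝ} {g' : (𝔼 n) → ℝ} (hg : ∀ k, Continuous (g k)) {M : ℝ}
    (hM : ∀ k x, |g k x| ≤ M) (hz : ∀ k, ∀ x ∉ K, g k x = 0)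
    (hlim : ∀ x, Tendsto (fun k => g k x) atTop (𝓝 (g' x))) :
    Tendsto (fun k => ∫ x, a x * g k x ^ 2) atTop (𝓝 (∫ x, a x * g' x ^ 2)) := by
  have hi : IntegrableOn a K := ha.integrableOn_compact hK
  have e : ∀ k, (fun x => a x * g k x ^ 2) = fun x => (K.indicator a x) * g k x ^ 2 := by
    intro k; ext x
    by_cases hx : x ∈ K
    · simp [hx]
    · simp [hx, hz k x hx]
  refine tendsto_integral_of_dominated_convergence (fun x => |K.indicator a x| * M ^ 2) ?_ ?_ ?_ ?_
  · intro k
    rw [e]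
    exact (hi.integrable_indicator hK.measurableSet).aestronglyMeasurable.mul
      ((hg k).pow 2).aestronglyMeasurable
  · exact ((hi.integrable_indicator hK.measurableSet).abs).mul_const _
  · intro k
    refine ae_of_all _ fun x => ?_
    have := congrFun (e k) x
    rw [this, Real.norm_eq_abs, abs_mul]
    gcongr
    rw [abs_of_nonneg (sq_nonneg _), ← sq_abs]
    have := abs_nonneg (g k x)
    have := hM k x
    gcongr
  · exact ae_of_all _ fun x => ((hlim x).pow 2).const_mul _

lemma mol_cd (φ : ContDiffBump (0 : 𝔼 n)) {g : (𝔼 n) → ℝ} (hg : Continuous g) : ContDiff ℝ ∞ (mol φ g) :=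
  φ.hasCompactSupport_normed.contDiff_convolution_left _ φ.contDiff_normed hg.locallyIntegrable

lemma mol_tendsto {φ : ℕ → ContDiffBump (0 : 𝔼 n)} (hφ : Tendsto (fun k => (φ k).rOut) atTop (𝓝 0))
    {g : (𝔼 n) → F} (hg : Continuous g) (x : 𝔼 n) : Tendsto (fun k => mol (φ k) g x) atTop (𝓝 (g x)) :=
  ContDiffBump.convolution_tendsto_right_of_continuous hφ hg x

lemma mol_tsupport (φ : ContDiffBump (0 : 𝔼 n)) {u : (𝔼 n) → ℝ} {δ : ℝ} (h : φ.rOut ≤ δ) :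
    tsupport (mol φ u) ⊆ cthickening δ (tsupport u) := by
  refine closure_minimal ?_ isClosed_cthickening
  refine (support_convolution_subset _).trans ?_
  rw [ContDiffBump.support_normed_eq]
  rintro x ⟨y, hy, z, hz, rfl⟩
  refine mem_cthickening_of_dist_le _ z _ _ (subset_tsupport _ hz) ?_
  simp at hy ⊢
  exact hy.le.trans h

lemma exists_bumps {δ : ℝ} (hδ : 0 < δ) : ∃ φ : ℕ → ContDiffBump (0 : 𝔼 n),
    Tendsto (fun k => (φ k).rOut) atTop (𝓝 0) ∧ ∀ k, (φ k).rOut ≤ δ := by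
  refine ⟨fun k =>
    ⟨δ / (2 * (k + 2)), δ / (k + 2), by positivity, by
      apply div_lt_div_of_pos_left hδ (by positivity); nlinarith [(k.cast_nonneg : (0:ℝ) ≤ k)]⟩, ?_, ?_⟩
  · have : Tendsto (fun k : ℕ => (k : ℝ) + 2) atTop atTop :=
      tendsto_natCast_atTop_atTop.atTop_add tendsto_const_nhds
    exact this.const_div_atTop δ
  · intro k
    change δ / ((k:ℝ) + 2) ≤ δ
    apply div_le_self hδ.le; linarith [(k.cast_nonneg : (0:ℝ) ≤ k)]

lemma mol_lap (φ : ContDiffBump (0 : 𝔼 n)) {u : (𝔼 n) → ℝ} (hcd : ContDiff ℝ 2 u)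
    (hcs : HasCompactSupport u) (x : 𝔼 n) :
    lap (mol φ u) x = ∑ i, (mol φ (fderiv ℝ (fderiv ℝ u)) x) (eb i) (eb i) := by
  have hcd1 : ContDiff ℝ 1 (fderiv ℝ u) := hcd.fderiv_right (by norm_num)
  have hcs1 : HasCompactSupport (fderiv ℝ u) := hcs.fderiv ℝ
  rw [lap_eq, mol_fderiv _ (hcd.of_le (by norm_num)) hcs, mol_fderiv _ hcd1 hcs1]

lemma mol_lap_bound {u : (𝔼 n) → ℝ} (hcd : ContDiff ℝ 2 u)
    (hcs : HasCompactSupport u) : ∃ M, ∀ (φ : ContDiffBump (0 : 𝔼 n)) x, |lap (mol φ u) x| ≤ M := by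
  have hcd1 : ContDiff ℝ 1 (fderiv ℝ u) := hcd.fderiv_right (by norm_num)
  have hc2 : Continuous (fderiv ℝ (fderiv ℝ u)) := hcd1.continuous_fderiv (by simp)
  have hcs1 : HasCompactSupport (fderiv ℝ u) := hcs.fderiv ℝ
  have hcs2 : HasCompactSupport (fderiv ℝ (fderiv ℝ u)) := hcs1.fderiv ℝ
  have hex : ∃ M2, ∀ x, ‖fderiv ℝ (fderiv ℝ u) x‖ ≤ M2 := by
    have hn : Continuous (fun x => ‖fderiv ℝ (fderiv ℝ u) x‖) := (continuous_norm (E := (𝔼 n) →L[ℝ] (𝔼 n) →L[ℝ] ℝ)).comp hc2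
    have hs : HasCompactSupport (fun x => ‖fderiv ℝ (fderiv ℝ u) x‖) :=
      hcs2.comp_left (g := fun L : (𝔼 n) →L[ℝ] (𝔼 n) →L[ℝ] ℝ => ‖L‖) (ContinuousLinearMap.opNorm_zero (𝕜 := ℝ))
    obtain ⟨M, hM⟩ := hs.exists_bound_of_continuous hn
    exact ⟨M, fun x => (le_abs_self _).trans (hM x)⟩
  obtain ⟨M2, hM2⟩ := hex
  have hn1 : ∀ i : Fin n, ‖(eb i : 𝔼 n)‖ = 1 := fun i => by simp [eb]
  refine ⟨∑ i : Fin n, 3 * M2, fun φ x => ?_⟩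
  rw [mol_lap φ hcd hcs]
  refine (Finset.abs_sum_le_sum_abs _ _).trans (Finset.sum_le_sum fun i _ => ?_)
  have h2 := (mol φ (fderiv ℝ (fderiv ℝ u)) x).le_opNorm₂ (eb i) (eb i)
  have h3 := mol_bound (F := (𝔼 n) →L[ℝ] (𝔼 n) →L[ℝ] ℝ) (g := fderiv ℝ (fderiv ℝ u)) φ hc2 hM2 x
  rw [hn1, mul_one, mul_one, Real.norm_eq_abs] at h2
  exact h2.trans h3

lemma mol_lap_tendsto {φ : ℕ → ContDiffBump (0 : 𝔼 n)} (hφ : Tendsto (fun k => (φ k).rOut) atTop (𝓝 0))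
    {u : (𝔼 n) → ℝ} (hcd : ContDiff ℝ 2 u) (hcs : HasCompactSupport u) (x : 𝔼 n) :
    Tendsto (fun k => lap (mol (φ k) u) x) atTop (𝓝 (lap u x)) := by
  have hcd1 : ContDiff ℝ 1 (fderiv ℝ u) := hcd.fderiv_right (by norm_num)
  have hc2 : Continuous (fderiv ℝ (fderiv ℝ u)) := hcd1.continuous_fderiv (by simp)
  have h := mol_tendsto (F := (𝔼 n) →L[ℝ] (𝔼 n) →L[ℝ] ℝ) (g := fderiv ℝ (fderiv ℝ u)) hφ hc2 x
  simp only [mol_lap _ hcd hcs]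
  rw [lap_eq]
  refine tendsto_finsetSum _ fun i _ => ?_
  have hc : Continuous (fun L : (𝔼 n) →L[ℝ] (𝔼 n) →L[ℝ] ℝ => L (eb i) (eb i)) := by fun_prop
  exact (hc.tendsto _).comp h

lemma approx_C2 {Ω : Set (𝔼 n)} (hO : IsOpen Ω) {u : (𝔼 n) → ℝ} (hu : DirichletAdm Ω u) :
    ∃ (K : Set (𝔼 n)) (v : ℕ → (𝔼 n) → ℝ) (M : ℝ), IsCompact K ∧ K ⊆ Ω ∧ (∀ k, TF Ω (v k)) ∧
      (∀ k, tsupport (v k) ⊆ K) ∧ (∀ k x, |v k x| ≤ M) ∧ (∀ k x, |lap (v k) x| ≤ M) ∧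
      (∀ x, Tendsto (fun k => v k x) atTop (𝓝 (u x))) ∧
      (∀ x, Tendsto (fun k => lap (v k) x) atTop (𝓝 (lap u x))) := by
  obtain ⟨hcd, hcs, hsup⟩ := hu
  obtain ⟨δ, hδ, hδK⟩ := hcs.isCompact.exists_cthickening_subset_open hO hsup
  obtain ⟨φ, hφ, hφδ⟩ := exists_bumps (n := n) hδ
  have hKc : IsCompact (cthickening δ (tsupport u)) := hcs.isCompact.cthickening
  have hts : ∀ k, tsupport (mol (φ k) u) ⊆ cthickening δ (tsupport u) :=
    fun k => mol_tsupport (φ k) (hφδ k)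
  obtain ⟨M0, hM0⟩ := hcs.exists_bound_of_continuous hcd.continuous
  obtain ⟨M2, hM2⟩ := mol_lap_bound hcd hcs
  have hlim := mol_lap_tendsto hφ hcd hcs
  have hT : ∀ k, TF Ω (mol (φ k) u) := fun k => ⟨mol_cd _ hcd.continuous,
    HasCompactSupport.intro hKc fun x hx => image_eq_zero_of_notMem_tsupport fun h => hx (hts k h),
    (hts k).trans hδK⟩
  exact ⟨_, fun k => mol (φ k) u, max (3 * M0) M2, hKc, hδK, hT, hts,
    fun k x => (mol_bound (φ k) hcd.continuous hM0 x).trans (le_max_left _ _),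
    fun k x => (hM2 _ x).trans (le_max_right _ _),
    fun x => mol_tendsto hφ hcd.continuous x, hlim⟩

lemma main_C2 (hn : 2 ≤ n) {C : Set (𝔼 n)} (hC : IsCone C) (α : ℝ) {lam : ℝ} (hl : 0 ≤ lam)
    (hP : ∀ v, TF C v → lam * In (fun x => v x ^ 2) ≤ In (Gs v)) {u : (𝔼 n) → ℝ}
    (hu : DirichletAdm (C ∩ W1 n) u) :
    ((gbar n α + lam) / 2) * (∫ x, ‖x‖ ^ (α - 4) * ((Real.log ‖x‖) ^ 2)⁻¹ * (u x) ^ 2) +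
      (9 / 16) * (∫ x, ‖x‖ ^ (α - 4) * ((Real.log ‖x‖) ^ 4)⁻¹ * (u x) ^ 2) ≤
      (∫ x, ‖x‖ ^ α * (lap u x) ^ 2) - muD C α * (∫ x, ‖x‖ ^ (α - 4) * (u x) ^ 2) := by
  obtain ⟨K, v, M, hK, hKΩ, hv, hts, hb1, hb2, hl1, hl2⟩ := approx_C2 (hC.op.inter W1_open) hu
  have hKW : K ⊆ W1 n := hKΩ.trans inter_subset_right
  have hr : ∀ p : ℝ, ContinuousOn (fun x : 𝔼 n => ‖x‖ ^ p) K := fun p =>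
    (cd_norm_rpow p).continuousOn.mono (hKW.trans W1_sub)
  have hlg : ∀ m : ℕ, ContinuousOn (fun x : 𝔼 n => ((Real.log ‖x‖) ^ m)⁻¹) K := fun m =>
    (cd_slog m).continuousOn.mono hKW
  have hz : ∀ k, ∀ x ∉ K, v k x = 0 := fun k x hx =>
    image_eq_zero_of_notMem_tsupport fun h => hx (hts k h)
  have hc : ∀ k, Continuous (v k) := fun k => (hv k).1.continuous
  have hlc : ∀ k, Continuous (lap (v k)) := fun k => by
    have : Continuous (fderiv ℝ (fderiv ℝ (v k))) :=
      ((hv k).cd2.fderiv_right (m := 1) (by norm_num)).continuous_fderiv (by simp)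
    have h2 : lap (v k) = fun x => ∑ i, fderiv ℝ (fderiv ℝ (v k)) x (eb i) (eb i) := by
      ext x; exact lap_eq
    rw [h2]; fun_prop
  have t1 := lim_int hK ((hr (α - 4)).mul (hlg 2)) hc hb1 hz hl1
  have t2 := lim_int hK ((hr (α - 4)).mul (hlg 4)) hc hb1 hz hl1
  have t3 := lim_int hK (hr α) hlc hb2 (fun k x hx => lap_eq_zero fun h => hx (hts k h)) hl2
  have t4 := lim_int hK (hr (α - 4)) hc hb1 hz hl1
  exact le_of_tendsto_of_tendsto' ((t1.const_mul _).add (t2.const_mul _))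
    (t3.sub (t4.const_mul _)) fun k => main_smooth hn hC α hl hP (hv k)

end approx

section rellichcpt

lemma weak_cpt {H : Type} [NormedAddCommGroup H] [InnerProductSpace ℝ H] [CompleteSpace H]
    [TopologicalSpace.SeparableSpace H] (g : ℕ → H) (B : ℝ) (hB : ∀ k, ‖g k‖ ≤ B) :
    ∃ τ : ℕ → ℕ, StrictMono τ ∧ ∀ h : H, ∃ l : ℝ, Tendsto (fun k => inner ℝ (g (τ k)) h) atTop (𝓝 l) := by
  have hc := WeakDual.isSeqCompact_closedBall ℝ H (0 : StrongDual ℝ H) B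
  have hx : ∀ k, (StrongDual.toWeakDual (InnerProductSpace.toDual ℝ H (g k))) ∈
      (WeakDual.toStrongDual ⁻¹' Metric.closedBall (0 : StrongDual ℝ H) B) := by
    intro k
    simp only [mem_preimage, mem_closedBall, dist_zero_right]
    change ‖InnerProductSpace.toDual ℝ H (g k)‖ ≤ B
    simpa using hB k
  obtain ⟨a, -, τ, hτ, ht⟩ := hc hx
  refine ⟨τ, hτ, fun h => ⟨a h, ?_⟩⟩
  exact (WeakDual.eval_continuous h).continuousAt.tendsto.comp ht

lemma sq_int_le {X : Type} [MeasurableSpace X] {μ : Measure X} {p h : X → ℝ} (hp : ∀ x, 0 ≤ p x)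
    (i0 : Integrable p μ) (h1 : ∫ x, p x ∂μ = 1) (i1 : Integrable (fun x => p x * h x) μ)
    (i2 : Integrable (fun x => p x * h x ^ 2) μ) :
    (∫ x, p x * h x ∂μ) ^ 2 ≤ ∫ x, p x * h x ^ 2 ∂μ := by
  set m := ∫ x, p x * h x ∂μ with hm
  have h0 : 0 ≤ ∫ x, p x * (h x - m) ^ 2 ∂μ :=
    integral_nonneg fun x => mul_nonneg (hp x) (sq_nonneg _)
  have e : (fun x => p x * (h x - m) ^ 2) =
      fun x => (p x * h x ^ 2 - (2 * m) * (p x * h x)) + m ^ 2 * p x := by ext x; ring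
  rw [e, integral_add (by exact i2.sub (i1.const_mul _)) (i0.const_mul _), integral_sub i2 (i1.const_mul _),
    integral_const_mul, integral_const_mul, h1, ← hm] at h0
  nlinarith

lemma transl_pt {g : (𝔼 n) → ℝ} (hg : ContDiff ℝ 1 g) (x y : 𝔼 n) :
    (g (x - y) - g x) ^ 2 ≤ ∫ t in (0:ℝ)..1, (‖y‖ ^ 2 * ‖fderiv ℝ g (x - t • y)‖ ^ 2) := by
  have hd : ∀ t : ℝ, HasDerivAt (fun t : ℝ => g (x - t • y)) (fderiv ℝ g (x - t • y) (-y)) t := by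
    intro t
    have h1 : HasDerivAt (fun t : ℝ => x - t • y) (-y) t := by
      simpa using ((hasDerivAt_id t).smul_const y).const_sub x
    exact ((hg.differentiable (by simp)) _).hasFDerivAt.comp_hasDerivAt t h1
  have hcf : Continuous (fderiv ℝ g) := hg.continuous_fderiv (by simp)
  have hc : Continuous (fun t : ℝ => fderiv ℝ g (x - t • y) (-y)) := by fun_prop
  have hn : Continuous (fun t : ℝ => ‖fderiv ℝ g (x - t • y)‖) := by fun_prop
  have e : g (x - y) - g x = ∫ t in (0:ℝ)..1, fderiv ℝ g (x - t • y) (-y) := by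
    rw [intervalIntegral.integral_eq_sub_of_hasDerivAt (fun t _ => hd t) (hc.intervalIntegrable _ _)]
    simp
  have h2 : (g (x - y) - g x) ^ 2 ≤ ∫ t in (0:ℝ)..1, (fderiv ℝ g (x - t • y) (-y)) ^ 2 := by
    rw [e]
    rw [intervalIntegral.integral_of_le zero_le_one, intervalIntegral.integral_of_le zero_le_one]
    have hi : ∀ f : ℝ → ℝ, Continuous f → Integrable f (volume.restrict (Ioc 0 1)) := fun f hf =>
      (hf.integrableOn_Icc (a := 0) (b := 1)).mono_set Ioc_subset_Icc_self
    have := sq_int_le (μ := volume.restrict (Ioc (0:ℝ) 1)) (p := fun _ => 1)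
      (h := fun t : ℝ => fderiv ℝ g (x - t • y) (-y)) (fun _ => zero_le_one) (by simp) (by simp)
      (hi _ (by fun_prop)) (hi _ (by fun_prop))
    simpa using this
  refine h2.trans (intervalIntegral.integral_mono_on zero_le_one ((hc.pow 2).intervalIntegrable _ _)
    ((continuous_const.mul (hn.pow 2)).intervalIntegrable _ _) fun t _ => ?_)
  have := (fderiv ℝ g (x - t • y)).le_opNorm (-y)
  rw [norm_neg, Real.norm_eq_abs] at this
  rw [← sq_abs, ← mul_pow, mul_comm]
  gcongr

lemma transl {g : (𝔼 n) → ℝ} (hg : ContDiff ℝ 1 g) (y : 𝔼 n) :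
    ∫⁻ x, ENNReal.ofReal ((g (x - y) - g x) ^ 2) ≤
      ENNReal.ofReal (‖y‖ ^ 2) * ∫⁻ x, ENNReal.ofReal (‖fderiv ℝ g x‖ ^ 2) := by
  have hcf : Continuous (fderiv ℝ g) := hg.continuous_fderiv (by simp)
  have hn : Continuous (fun x => ‖fderiv ℝ g x‖) := by fun_prop
  have h1 : ∀ x, ENNReal.ofReal ((g (x - y) - g x) ^ 2) ≤
      ∫⁻ t in Ioc (0:ℝ) 1, ENNReal.ofReal (‖y‖ ^ 2) * ENNReal.ofReal (‖fderiv ℝ g (x - t • y)‖ ^ 2) := by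
    intro x
    refine (ENNReal.ofReal_le_ofReal (transl_pt hg x y)).trans ?_
    have hc : Continuous (fun t : ℝ => ‖y‖ ^ 2 * ‖fderiv ℝ g (x - t • y)‖ ^ 2) := by fun_prop
    rw [intervalIntegral.integral_of_le zero_le_one, ofReal_integral_eq_lintegral_ofReal
      ((hc.integrableOn_Icc (a := 0) (b := 1)).mono_set Ioc_subset_Icc_self)
      (ae_of_all _ fun t => by positivity)]
    refine lintegral_mono fun t => ?_
    rw [ENNReal.ofReal_mul (by positivity)]
  refine (lintegral_mono h1).trans ?_
  rw [lintegral_lintegral_swap]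
  · have : ∀ t : ℝ, ∫⁻ x : 𝔼 n, ENNReal.ofReal (‖y‖ ^ 2) * ENNReal.ofReal (‖fderiv ℝ g (x - t • y)‖ ^ 2)
        = ENNReal.ofReal (‖y‖ ^ 2) * ∫⁻ x, ENNReal.ofReal (‖fderiv ℝ g x‖ ^ 2) := by
      intro t
      rw [lintegral_const_mul' _ _ ENNReal.ofReal_ne_top]
      rw [lintegral_sub_right_eq_self (fun x => ENNReal.ofReal (‖fderiv ℝ g x‖ ^ 2))]
    simp only [this]; rw [lintegral_const]; simp
  · have : Continuous (fun z : (𝔼 n) × ℝ => ENNReal.ofReal (‖y‖ ^ 2) * ENNReal.ofReal (‖fderiv ℝ g (z.1 - z.2 • y)‖ ^ 2)) := by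
      refine ENNReal.continuous_const_mul ENNReal.ofReal_ne_top |>.comp ?_
      refine ENNReal.continuous_ofReal.comp ?_
      fun_prop
    exact this.measurable.aemeasurable

lemma mol_err (φ : ContDiffBump (0 : 𝔼 n)) {g : (𝔼 n) → ℝ} (hg : ContDiff ℝ 1 g) :
    ∫⁻ x, ENNReal.ofReal ((mol φ g x - g x) ^ 2) ≤
      ENNReal.ofReal (φ.rOut ^ 2) * ∫⁻ x, ENNReal.ofReal (‖fderiv ℝ g x‖ ^ 2) := by
  set p := φ.normed (volume : Measure (𝔼 n)) with hp
  have hp0 : ∀ y, 0 ≤ p y := fun y => φ.nonneg_normed y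
  have hpc : Continuous p := φ.continuous_normed
  have hps : HasCompactSupport p := φ.hasCompactSupport_normed
  have hpi : Integrable p := hpc.integrable_of_hasCompactSupport hps
  have hp1 : ∫ y, p y = 1 := φ.integral_normed
  have hgc := hg.continuous
  have hi : ∀ f : (𝔼 n) → ℝ, Continuous f → Integrable (fun y => p y * f y) := fun f hf =>
    (hpc.mul hf).integrable_of_hasCompactSupport hps.mul_right
  have h1 : ∀ x, ENNReal.ofReal ((mol φ g x - g x) ^ 2) ≤
      ∫⁻ y, ENNReal.ofReal (p y) * ENNReal.ofReal ((g (x - y) - g x) ^ 2) := by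
    intro x
    have e : mol φ g x - g x = ∫ y, p y * (g (x - y) - g x) := by
      have : mol φ g x = ∫ y, p y * g (x - y) := rfl
      rw [this]
      simp only [mul_sub]
      rw [integral_sub (hi _ (by fun_prop)) (hpi.mul_const _), integral_mul_const, hp1, one_mul]
    rw [e]
    refine (ENNReal.ofReal_le_ofReal (sq_int_le hp0 hpi hp1 (hi _ (by fun_prop))
      (hi (fun y => (g (x - y) - g x) ^ 2) (by fun_prop)))).trans ?_
    rw [ofReal_integral_eq_lintegral_ofReal (hi (fun y => (g (x - y) - g x) ^ 2) (by fun_prop))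
      (ae_of_all _ fun t => mul_nonneg (hp0 _) (sq_nonneg _))]
    refine lintegral_mono fun t => ?_
    rw [ENNReal.ofReal_mul (hp0 _)]
  refine (lintegral_mono h1).trans ?_
  rw [lintegral_lintegral_swap]
  · have h2 : ∀ y, ∫⁻ x, ENNReal.ofReal (p y) * ENNReal.ofReal ((g (x - y) - g x) ^ 2) ≤
        ENNReal.ofReal (p y) * (ENNReal.ofReal (φ.rOut ^ 2) * ∫⁻ x, ENNReal.ofReal (‖fderiv ℝ g x‖ ^ 2)) := by
      intro y
      rw [lintegral_const_mul' _ _ ENNReal.ofReal_ne_top]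
      by_cases hy : y ∈ ball (0 : 𝔼 n) φ.rOut
      · refine mul_le_mul_right ?_ _
        refine (transl hg y).trans (mul_le_mul_left ?_ _)
        apply ENNReal.ofReal_le_ofReal
        have : ‖y‖ < φ.rOut := by simpa using hy
        gcongr
      · have : p y = 0 := by
          rw [← Function.notMem_support, hp, φ.support_normed_eq]; exact hy
        simp [this]
    refine (lintegral_mono h2).trans ?_
    rw [lintegral_mul_const _ (by fun_prop), ← ofReal_integral_eq_lintegral_ofReal hpi (ae_of_all _ hp0), hp1]
    simp
  · have : Measurable (fun z : (𝔼 n) × (𝔼 n) => ENNReal.ofReal (p z.2) * ENNReal.ofReal ((g (z.1 - z.2) - g z.1) ^ 2)) := by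
      have h3 : Continuous (fun z : (𝔼 n) × (𝔼 n) => (g (z.1 - z.2) - g z.1) ^ 2) := by fun_prop
      have h4 : Continuous (fun z : (𝔼 n) × (𝔼 n) => p z.2) := by fun_prop
      exact h4.measurable.ennreal_ofReal.mul h3.measurable.ennreal_ofReal
    exact this.aemeasurable

lemma nrm2 {f : (𝔼 n) → ℝ} (hf : MemLp f 2 volume) : ‖hf.toLp f‖ ^ 2 = ∫ x, f x ^ 2 := by
  rw [← real_inner_self_eq_norm_sq, L2.inner_def]
  refine integral_congr_ae ?_
  filter_upwards [hf.coeFn_toLp] with x hx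
  rw [hx]; simp [sq]

lemma inn2 {f g : (𝔼 n) → ℝ} (hf : MemLp f 2 volume) (hg : MemLp g 2 volume) :
    inner ℝ (hf.toLp f) (hg.toLp g) = ∫ x, f x * g x := by
  rw [L2.inner_def]
  refine integral_congr_ae ?_
  filter_upwards [hf.coeFn_toLp, hg.coeFn_toLp] with x hx hy
  rw [hx, hy]; simp [mul_comm]

lemma memLp2 {f : (𝔼 n) → ℝ} (hf : Continuous f) (hs : HasCompactSupport f) : MemLp f 2 volume :=
  hf.memLp_of_hasCompactSupport hs

lemma mol_cauchy (φ : ContDiffBump (0 : 𝔼 n)) {R B : ℝ} (hB : 0 ≤ B) (g : ℕ → (𝔼 n) → ℝ)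
    (hg : ∀ k, Continuous (g k)) (hz : ∀ k x, R < ‖x‖ → g k x = 0)
    (hm : ∀ k, MemLp (g k) 2 volume) (hm' : ∀ k, MemLp (mol φ (g k)) 2 volume)
    (hb : ∀ k, ‖(hm k).toLp (g k)‖ ≤ B)
    (hw : ∀ h : Lp ℝ 2 (volume : Measure (𝔼 n)), ∃ l : ℝ,
      Tendsto (fun k => inner ℝ ((hm k).toLp (g k)) h) atTop (𝓝 l)) :
    CauchySeq (fun k => (hm' k).toLp (mol φ (g k))) := by
  set p := φ.normed (volume : Measure (𝔼 n)) with hp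
  have hpc : Continuous p := φ.continuous_normed
  have hps : HasCompactSupport p := φ.hasCompactSupport_normed
  have hpx : ∀ x, MemLp (fun z => p (x - z)) 2 volume := fun x =>
    memLp2 (by fun_prop) (hps.comp_homeomorph (Homeomorph.subLeft x))
  have eT : ∀ k x, mol φ (g k) x = inner ℝ ((hm k).toLp (g k)) ((hpx x).toLp _) := by
    intro k x
    rw [inn2]
    have : mol φ (g k) x = ∫ y, p y * g k (x - y) := rfl
    rw [this, ← integral_sub_left_eq_self _ volume x]
    congr; ext y; simp [mul_comm]
  have hP : ∀ x, ‖(hpx x).toLp _‖ = √(∫ z, p z ^ 2) := by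
    intro x
    rw [← Real.sqrt_sq (norm_nonneg _), nrm2]
    rw [integral_sub_left_eq_self (fun z => p z ^ 2) volume x]
  set P := √(∫ z, p z ^ 2) with hPdef
  have hP0 : 0 ≤ P := Real.sqrt_nonneg _
  have hTb : ∀ k x, |mol φ (g k) x| ≤ B * P := by
    intro k x
    rw [eT]
    refine (abs_real_inner_le_norm _ _).trans ?_
    rw [hP]
    exact mul_le_mul_of_nonneg_right (hb k) hP0
  have hTz : ∀ k x, x ∉ closedBall (0 : 𝔼 n) (R + φ.rOut) → mol φ (g k) x = 0 := by
    intro k x hx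
    have hx' : R + φ.rOut < ‖x‖ := by simpa using hx
    have : mol φ (g k) x = ∫ y, p y * g k (x - y) := rfl
    rw [this]
    refine integral_eq_zero_of_ae (ae_of_all _ fun y => ?_)
    by_cases hy : y ∈ ball (0 : 𝔼 n) φ.rOut
    · have hy' : ‖y‖ < φ.rOut := by simpa using hy
      have h4 : R < ‖x - y‖ := by linarith [norm_sub_norm_le x y]
      simp [hz k _ h4]
    · have : p y = 0 := by
        rw [← Function.notMem_support, hp, φ.support_normed_eq]; exact hy
      simp [this]
  choose l hl using fun x => hw ((hpx x).toLp _)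
  have hl' : ∀ x, Tendsto (fun k => mol φ (g k) x) atTop (𝓝 (l x)) := by
    intro x; simp only [eT]; exact hl x
  have hlb : ∀ x, |l x| ≤ B * P := fun x =>
    le_of_tendsto (hl' x).abs (Eventually.of_forall fun k => hTb k x)
  have hlz : ∀ x, x ∉ closedBall (0 : 𝔼 n) (R + φ.rOut) → l x = 0 := fun x hx =>
    tendsto_nhds_unique (hl' x) (by simp [hTz _ x hx])
  have hlm : AEStronglyMeasurable l volume :=
    aestronglyMeasurable_of_tendsto_ae atTop (fun k => (hm' k).1) (ae_of_all _ hl')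
  have hind : Integrable ((closedBall (0 : 𝔼 n) (R + φ.rOut)).indicator fun _ => (2 * (B * P)) ^ 2) := by
    refine (integrable_indicator_iff measurableSet_closedBall).2 ?_
    exact integrableOn_const (by exact measure_closedBall_lt_top.ne) enorm_ne_top
  have hBP : 0 ≤ B * P := by positivity
  have hlL : MemLp l 2 volume := by
    rw [memLp_two_iff_integrable_sq hlm]
    refine hind.mono' (hlm.pow 2) (ae_of_all _ fun x => ?_)
    by_cases hx : x ∈ closedBall (0 : 𝔼 n) (R + φ.rOut)
    · rw [indicator_of_mem hx, Real.norm_eq_abs, abs_pow]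
      have := hlb x
      gcongr; linarith
    · rw [indicator_of_notMem hx, hlz x hx]; simp
  have hlim : Tendsto (fun k => ∫ x, (mol φ (g k) x - l x) ^ 2) atTop (𝓝 (∫ _x : 𝔼 n, (0 : ℝ))) := by
    refine tendsto_integral_of_dominated_convergence _ (fun k => ?_) hind (fun k => ae_of_all _ fun x => ?_)
      (ae_of_all _ fun x => ?_)
    · exact (((hm' k).1).sub hlm).pow 2
    · by_cases hx : x ∈ closedBall (0 : 𝔼 n) (R + φ.rOut)
      · rw [indicator_of_mem hx, Real.norm_eq_abs, abs_pow]
        have h3 := abs_sub (mol φ (g k) x) (l x)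
        have := hlb x
        have := hTb k x
        gcongr; linarith
      · rw [indicator_of_notMem hx, hlz x hx, hTz k x hx]; simp
    · have := (((hl' x).sub_const (l x)).pow 2)
      simpa using this
  rw [integral_zero] at hlim
  have hconv : Tendsto (fun k => (hm' k).toLp (mol φ (g k))) atTop (𝓝 (hlL.toLp l)) := by
    rw [tendsto_iff_norm_sub_tendsto_zero]
    have e : ∀ k, ‖(hm' k).toLp (mol φ (g k)) - hlL.toLp l‖ = √(∫ x, (mol φ (g k) x - l x) ^ 2) := by
      intro k
      rw [← MemLp.toLp_sub, ← Real.sqrt_sq (norm_nonneg _), nrm2]; rfl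
    simp only [e]
    simpa using hlim.sqrt
  exact hconv.cauchySeq

lemma rellich_cpt {R B : ℝ} (g : ℕ → (𝔼 n) → ℝ) (hg : ∀ k, ContDiff ℝ 1 (g k))
    (hz : ∀ k x, R < ‖x‖ → g k x = 0) (h0 : ∀ k, ∫ x, g k x ^ 2 ≤ B)
    (h1 : ∀ k, ∫ x, ‖fderiv ℝ (g k) x‖ ^ 2 ≤ B) :
    ∃ τ : ℕ → ℕ, StrictMono τ ∧ ∃ G : (𝔼 n) → ℝ, MemLp G 2 volume ∧
      Tendsto (fun k => ∫ x, (g (τ k) x - G x) ^ 2) atTop (𝓝 0) ∧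
      ∀ᵐ x, Tendsto (fun k => g (τ k) x) atTop (𝓝 (G x)) := by
  have hB : 0 ≤ B := (integral_nonneg fun x => sq_nonneg _).trans (h0 0)
  have hcs : ∀ k, HasCompactSupport (g k) := fun k =>
    HasCompactSupport.intro (isCompact_closedBall (0 : 𝔼 n) R) fun x hx => hz k x (by simpa using hx)
  have hm : ∀ k, MemLp (g k) 2 volume := fun k => memLp2 (hg k).continuous (hcs k)
  have hb : ∀ k, ‖(hm k).toLp (g k)‖ ≤ √B := fun k => by
    rw [← Real.sqrt_sq (norm_nonneg _), nrm2]; exact Real.sqrt_le_sqrt (h0 k)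
  have : Fact ((1 : ENNReal) ≤ 2) := ⟨by norm_num⟩
  have : Fact ((2 : ENNReal) ≠ ⊤) := ⟨by norm_num⟩
  obtain ⟨τ, hτ, hw⟩ := weak_cpt (fun k => (hm k).toLp (g k)) (√B) hb
  have hmm : ∀ (φ : ContDiffBump (0 : 𝔼 n)) k, MemLp (mol φ (g k)) 2 volume := fun φ k => by
    have hc : Continuous (mol φ (g k)) := (mol_cd φ (hg k).continuous).continuous
    refine memLp2 hc ?_
    exact φ.hasCompactSupport_normed.convolution _ (hcs k)
  have herr : ∀ (φ : ContDiffBump (0 : 𝔼 n)) k,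
      ‖(hmm φ k).toLp (mol φ (g k)) - (hm k).toLp (g k)‖ ≤ φ.rOut * √B := by
    intro φ k
    have e := mol_err φ (hg k)
    have hD : Integrable (fun x => ‖fderiv ℝ (g k) x‖ ^ 2) := by
      have hc : Continuous (fderiv ℝ (g k)) := (hg k).continuous_fderiv (by simp)
      have hc2 : Continuous (fun x => ‖fderiv ℝ (g k) x‖ ^ 2) := by fun_prop
      refine hc2.integrable_of_hasCompactSupport ?_
      exact ((hcs k).fderiv ℝ).comp_left (g := fun L => ‖L‖ ^ 2) (by simp)
    change ∫⁻ x, ENNReal.ofReal ((mol φ (g k) - g k) x ^ 2) ≤ _ at e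
    rw [← ofReal_integral_eq_lintegral_ofReal hD (ae_of_all _ fun x => by positivity),
      ← ofReal_integral_eq_lintegral_ofReal (((hmm φ k).sub (hm k)).integrable_sq)
        (ae_of_all _ fun x => sq_nonneg _), ← ENNReal.ofReal_mul (by positivity)] at e
    rw [ENNReal.ofReal_le_ofReal_iff (mul_nonneg (sq_nonneg _) (integral_nonneg fun x => by positivity))] at e
    have e2 : ‖(hmm φ k).toLp (mol φ (g k)) - (hm k).toLp (g k)‖ ^ 2 = ∫ x, (mol φ (g k) - g k) x ^ 2 := by
      rw [← MemLp.toLp_sub, nrm2]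
    refine le_trans (le_abs_self _) (abs_le_of_sq_le_sq ?_ ?_)
    · rw [e2, mul_pow, Real.sq_sqrt hB]
      exact e.trans (mul_le_mul_of_nonneg_left (h1 k) (sq_nonneg _))
    · have := φ.rOut_pos
      positivity
  have hcau : CauchySeq (fun k => (hm (τ k)).toLp (g (τ k))) := by
    rw [Metric.cauchySeq_iff']
    intro ε hε
    obtain ⟨δ, hδ, hδB⟩ : ∃ δ > 0, δ * √B < ε / 3 := by
      refine ⟨ε / 3 / (√B + 1), by positivity, ?_⟩
      have : 0 ≤ √B := Real.sqrt_nonneg _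
      rw [div_mul_eq_mul_div, div_lt_iff₀ (by positivity)]
      nlinarith
    let φ : ContDiffBump (0 : 𝔼 n) := ⟨δ / 2, δ, by positivity, by linarith⟩
    have hc := mol_cauchy φ (Real.sqrt_nonneg B) (fun k => g (τ k)) (fun k => (hg _).continuous)
      (fun k => hz _) (fun k => hm _) (fun k => hmm φ _) (fun k => hb _) hw
    rw [Metric.cauchySeq_iff'] at hc
    obtain ⟨N, hN⟩ := hc (ε / 3) (by positivity)
    refine ⟨N, fun k hk => ?_⟩
    have a1 := hN k hk
    have a2 := herr φ (τ k)
    have a3 := herr φ (τ N)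
    have hr : φ.rOut = δ := rfl
    rw [hr] at a2 a3
    rw [← dist_eq_norm] at a2 a3
    have t1 := dist_triangle_left ((hm (τ k)).toLp (g (τ k))) ((hm (τ N)).toLp (g (τ N))) ((hmm φ (τ k)).toLp (mol φ (g (τ k))))
    have t2 := dist_triangle ((hmm φ (τ k)).toLp (mol φ (g (τ k)))) ((hmm φ (τ N)).toLp (mol φ (g (τ N)))) ((hm (τ N)).toLp (g (τ N)))
    linarith
  obtain ⟨G, hG⟩ := cauchySeq_tendsto_of_complete hcau
  obtain ⟨s, hs, hae⟩ := (tendstoInMeasure_of_tendsto_Lp hG).exists_seq_tendsto_ae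
  refine ⟨τ ∘ s, hτ.comp hs, G, Lp.memLp G, ?_, ?_⟩
  · have h2 := (tendsto_iff_norm_sub_tendsto_zero.1 (hG.comp hs.tendsto_atTop)).pow 2
    simp only [ne_eq, OfNat.ofNat_ne_zero, not_false_eq_true, zero_pow] at h2
    refine h2.congr fun k => ?_
    have : G = (Lp.memLp G).toLp G := (Lp.toLp_coeFn G _).symm
    simp only [Function.comp]
    conv_lhs => rw [this]
    rw [← MemLp.toLp_sub, nrm2]; rfl
  · have hall : ∀ᵐ x, ∀ k, (hm (τ (s k))).toLp (g (τ (s k))) x = g (τ (s k)) x :=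
      ae_all_iff.2 fun k => (hm _).coeFn_toLp
    filter_upwards [hae, hall] with x hx hx2
    refine hx.congr fun k => ?_
    exact hx2 k

end rellichcpt

section P8
variable {C : Set (𝔼 n)} {f : (𝔼 n) → ℝ}

lemma norm_clm_sq (L : (𝔼 n) →L[ℝ] ℝ) : ‖L‖ ^ 2 = ∑ i, (L (eb i)) ^ 2 := by
  set g := (InnerProductSpace.toDual ℝ (𝔼 n)).symm L with hg
  have h1 : ‖L‖ = ‖g‖ := by rw [hg, LinearIsometryEquiv.norm_map]
  have h2 : ∀ i, L (eb i) = g i := by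
    intro i
    have := InnerProductSpace.toDual_symm_apply (𝕜 := ℝ) (y := L) (x := eb i)
    rw [← this, ← hg]
    simp [eb, EuclideanSpace.inner_single_right]
  rw [h1, EuclideanSpace.norm_sq_eq]
  simp [h2]

lemma clm_sum (L : (𝔼 n) →L[ℝ] ℝ) (x : 𝔼 n) : L x = ∑ i, x i * L (eb i) := by
  have h : L x = L (∑ i, x i • eb i) := by rw [eb_sum]
  rw [h, map_sum]; simp

/-- Lagrange identity -/
lemma grad_id (f : (𝔼 n) → ℝ) (x : 𝔼 n) :
    ‖x‖ ^ 2 * ‖fderiv ℝ f x‖ ^ 2 = (Eu f x) ^ 2 + Gs f x := by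
  rw [norm_clm_sq, EuclideanSpace.norm_sq_eq]
  have h1 : Eu f x = ∑ i, x i * fderiv ℝ f x (eb i) := by
    simp only [Dv]; exact clm_sum _ _
  rw [h1]
  simp only [Gs, Dv, rot_apply, map_sub, map_smul, smul_eq_mul, Real.norm_eq_abs, sq_abs]
  set g := fun i => fderiv ℝ f x (eb i) with hg
  have e : ∀ i j, (x i * fderiv ℝ f x (eb j) - x j * fderiv ℝ f x (eb i)) ^ 2 =
      x i ^ 2 * g j ^ 2 + x j ^ 2 * g i ^ 2 - 2 * ((x i * g i) * (x j * g j)) := by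
    intro i j; simp only [hg]; ring
  simp only [e, Finset.sum_sub_distrib, Finset.sum_add_distrib, ← Finset.mul_sum, ← Finset.sum_mul]
  ring

/-- log cut-off -/
def zt (T : ℝ) (hT : 0 < T) : ContDiffBump (0 : ℝ) := ⟨T, T + 1, hT, by linarith⟩

lemma zt_cd {T : ℝ} (hT : 0 < T) : ContDiff ℝ ∞ (zt T hT) := (zt T hT).contDiff
lemma zt_cs {T : ℝ} (hT : 0 < T) : HasCompactSupport (zt T hT) := (zt T hT).hasCompactSupport
lemma zt_one {T : ℝ} (hT : 0 < T) {s : ℝ} (hs : |s| ≤ T) : zt T hT s = 1 :=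
  (zt T hT).one_of_mem_closedBall (by simpa [zt] using hs)
lemma zt_zero {T : ℝ} (hT : 0 < T) {s : ℝ} (hs : T + 1 ≤ |s|) : zt T hT s = 0 :=
  (zt T hT).zero_of_le_dist (by simpa [zt] using hs)

lemma ann_bound (p T : ℝ) {x : 𝔼 n} (hx : x ≠ 0) (h : |Real.log ‖x‖| ≤ T) :
    1 ≤ Real.exp (|p| * T) * ‖x‖ ^ p := by
  have hp : 0 < ‖x‖ := by simpa using hx
  rw [Real.rpow_def_of_pos hp, ← Real.exp_add]
  apply Real.one_le_exp
  have h1 : |Real.log ‖x‖ * p| ≤ T * |p| := by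
    rw [abs_mul]; exact mul_le_mul_of_nonneg_right h (abs_nonneg _)
  have := neg_abs_le (Real.log ‖x‖ * p)
  linarith

lemma int_le_In (p : ℝ) {F : (𝔼 n) → ℝ} {T : ℝ} (hF : ∀ x, 0 ≤ F x) (h0 : F 0 = 0)
    (hT : ∀ x, T < |Real.log ‖x‖| → F x = 0) (hi : Integrable (fun x => ‖x‖ ^ p * F x)) :
    ∫ x, F x ≤ Real.exp (|p| * T) * ∫ x, ‖x‖ ^ p * F x := by
  rw [← integral_const_mul]
  refine integral_mono_of_nonneg (ae_of_all _ hF) (hi.const_mul _) (ae_of_all _ fun x => ?_)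
  by_cases hx : x = 0
  · subst hx; simp [h0]
  by_cases h : |Real.log ‖x‖| ≤ T
  · have := mul_le_mul_of_nonneg_right (ann_bound p T hx h) (hF x)
    simp only; linarith
  · simp [hT x (not_le.1 h)]

lemma cut_bounds (hn : 2 ≤ n) (hC : IsCone C) {T A : ℝ} (hT : 0 < T) :
    ∃ B, ∀ f, HF C f → Js (fun x => f x ^ 2) = 1 → Js (Gs f) ≤ A →
      (∫ x, (zt T hT (Real.log ‖x‖) * f x) ^ 2 ≤ B ∧
       ∫ x, ‖fderiv ℝ (fun x => zt T hT (Real.log ‖x‖) * f x) x‖ ^ 2 ≤ B) := by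
  set ζ : ℝ → ℝ := fun s => zt T hT s with hζ
  set M1 := Real.exp (|-(n:ℝ)| * (T + 1))
  set M2 := Real.exp (|-(n:ℝ) + 2| * (T + 1))
  set I0 := ∫ s, ζ s ^ 2
  set I1 := ∫ s, (deriv ζ s) ^ 2
  refine ⟨max (M1 * I0) (M2 * (I1 + I0 * A)), fun f hf h1 hA => ?_⟩
  have hI0 : 0 ≤ I0 := integral_nonneg fun _ => sq_nonneg _
  have hg : TF C (fun x => ζ (Real.log ‖x‖) * f x) := hf.cut (zt_cd hT) (zt_cs hT)
  have hg0 := hg.mono hC.ne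
  have hdv : TF {0}ᶜ (Eu (fun x => ζ (Real.log ‖x‖) * f x)) := hg0.dv
  have hz : ∀ x : 𝔼 n, T + 1 < |Real.log ‖x‖| → x ∉ tsupport (fun x => ζ (Real.log ‖x‖) * f x) ∨ x = 0 := by
    intro x hx
    by_cases h0 : x = 0
    · right; exact h0
    left
    rw [notMem_tsupport_iff_eventuallyEq]
    have hc : ContinuousAt (fun x : 𝔼 n => |Real.log ‖x‖|) x :=
      ((Real.continuousAt_log (by simpa using h0)).comp continuous_norm.continuousAt).abs
    filter_upwards [hc.eventually (lt_mem_nhds hx)] with y hy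
    simp [hζ, zt_zero hT hy.le]
  constructor
  · refine le_trans ?_ (le_max_left _ _)
    refine (int_le_In (-(n:ℝ)) (T := T + 1) (fun x => sq_nonneg _) ?_ ?_ (hg0.sq.wt _).int).trans ?_
    · simp [hf.z]
    · intro x hx; simp [hζ, zt_zero hT hx.le]
    · have := In_hom hn (f := fun x => f x ^ 2) (fun t ht x => by simp [hf.hom t ht]) (fun s => ζ s ^ 2)
      rw [h1, mul_one] at this
      simp only [mul_pow]
      simp only [In] at this
      rw [this]
  · refine le_trans ?_ (le_max_right _ _)
    have key : ∀ x : 𝔼 n, ‖x‖ ^ (-(n:ℝ) + 2) * ‖fderiv ℝ (fun x => ζ (Real.log ‖x‖) * f x) x‖ ^ 2 =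
       ‖x‖ ^ (-(n:ℝ)) * ((Eu (fun x => ζ (Real.log ‖x‖) * f x) x) ^ 2 + Gs (fun x => ζ (Real.log ‖x‖) * f x) x) := by
      intro x
      by_cases hx : x = 0
      · have h0 : (0 : 𝔼 n) ∉ tsupport (fun x => ζ (Real.log ‖x‖) * f x) := fun h => hg0.2.2 h rfl
        have h1 : fderiv ℝ (fun x => ζ (Real.log ‖x‖) * f x) 0 = 0 :=
          image_eq_zero_of_notMem_tsupport fun h => h0 (tsupport_fderiv_subset ℝ h)
        subst hx
        simp [h1, Gs, Dv]
      · rw [← grad_id, Real.rpow_add (by simpa using hx)]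
        norm_cast; ring
    have hEu : TF {0}ᶜ (fun x => (Eu (fun x => ζ (Real.log ‖x‖) * f x) x) ^ 2 + Gs (fun x => ζ (Real.log ‖x‖) * f x) x) :=
      hdv.sq.add hg0.gs
    refine (int_le_In (-(n:ℝ)+2) (T := T + 1) (fun x => sq_nonneg _) ?_ ?_ ?_).trans ?_
    · have h0 : (0 : 𝔼 n) ∉ tsupport (fun x => ζ (Real.log ‖x‖) * f x) := fun h => hg0.2.2 h rfl
      have h1 : fderiv ℝ (fun x => ζ (Real.log ‖x‖) * f x) 0 = 0 :=
          image_eq_zero_of_notMem_tsupport fun h => h0 (tsupport_fderiv_subset ℝ h)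
      rw [h1]; simp
    · intro x hx
      have hx' : x ∉ tsupport (fun x => ζ (Real.log ‖x‖) * f x) := by
        rcases hz x hx with h | h
        · exact h
        · intro h'; exact hg0.2.2 h' h
      have h1 : fderiv ℝ (fun x => ζ (Real.log ‖x‖) * f x) x = 0 :=
          image_eq_zero_of_notMem_tsupport fun h => hx' (tsupport_fderiv_subset ℝ h)
      rw [h1]; simp
    · exact (hEu.wt (-(n:ℝ))).int.congr (ae_of_all _ fun x => (key x).symm)
    · refine mul_le_mul_of_nonneg_left ?_ (Real.exp_pos _).le
      have e := In_add hdv.sq hg0.gs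
      have e1 := In_hom hn (f := fun x => f x ^ 2) (fun t ht x => by simp [hf.hom t ht]) (fun s => deriv ζ s ^ 2)
      have e2 := In_hom hn (f := Gs f) (hf.gs.hom) (fun s => ζ s ^ 2)
      have e3 : ∫ x, ‖x‖ ^ (-(n:ℝ) + 2) * ‖fderiv ℝ (fun x => ζ (Real.log ‖x‖) * f x) x‖ ^ 2 = I1 + I0 * Js (Gs f) := by
        simp only [key]
        refine e.trans ?_
        rw [Eu_cut hf (zt_cd hT), Gs_cut hf (zt_cd hT)]
        simp only [mul_pow]
        rw [e1, e2, h1, mul_one]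
      rw [e3]
      exact add_le_add le_rfl (mul_le_mul_of_nonneg_left hA hI0)

lemma exists_min (hn : 2 ≤ n) (hC : IsCone C) (hne : C.Nonempty) :
    ∃ lam : ℝ, 0 ≤ lam ∧ (∀ v, TF C v → lam * In (fun x => v x ^ 2) ≤ In (Gs v)) ∧
      ∃ f : ℕ → (𝔼 n) → ℝ, (∀ k, HF C (f k)) ∧ (∀ k, Js (fun x => f k x ^ 2) = 1) ∧
        (∀ k, Js (Gs (f k)) ≤ lam + 1) ∧ Tendsto (fun k => Js (Gs (f k))) atTop (𝓝 lam) := by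
  set A : Set ℝ := {q | ∃ f, HF C f ∧ Js (fun x => f x ^ 2) = 1 ∧ q = Js (Gs f)} with hA
  have hA0 : ∀ q ∈ A, 0 ≤ q := by
    rintro q ⟨f, hf, h1, rfl⟩; exact Js_nonneg fun x => Gs_nonneg f x
  have hbdd : BddBelow A := ⟨0, hA0⟩
  have hscale : ∀ f, HF C f → 0 < Js (fun x => f x ^ 2) →
      Js (Gs f) / Js (fun x => f x ^ 2) ∈ A := by
    intro f hf hpos
    set c := (Real.sqrt (Js (fun x => f x ^ 2)))⁻¹ with hc
    have hc2 : c ^ 2 = (Js (fun x => f x ^ 2))⁻¹ := by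
      rw [hc, inv_pow, Real.sq_sqrt hpos.le]
    refine ⟨fun x => c * f x, hf.cmul c, ?_, ?_⟩
    · simp only [mul_pow]; rw [Js_cmul, hc2, inv_mul_cancel₀ hpos.ne']
    · have : Js (Gs (fun x => c * f x)) = Js (fun x => c ^ 2 * Gs f x) := by
        refine Js_congr fun x hx => ?_
        have hx0 : x ≠ 0 := by rintro rfl; simp at hx
        simp only [Gs]
        have : ∀ i j, Lr i j (fun x => c * f x) x = c * Lr i j f x := fun i j =>
          Dv_const_mul c (hf.da hx0)
        simp only [this, mul_pow, ← Finset.mul_sum]; ring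
      rw [this, Js_cmul, hc2]; field_simp
  have hAne : A.Nonempty := by
    by_contra hE
    have hE' : ∀ f, HF C f → Js (fun x => f x ^ 2) = 0 := by
      intro f hf
      by_contra h
      have hpos : 0 < Js (fun x => f x ^ 2) := lt_of_le_of_ne (Js_nonneg fun x => sq_nonneg _) (Ne.symm h)
      exact hE ⟨_, hscale f hf hpos⟩
    obtain ⟨x, hx⟩ := hne
    obtain ⟨v, h1, h2, h3, h4, h5⟩ := exists_contDiff_tsupport_subset (n := ⊤) (hC.op.mem_nhds hx)
    have hv : TF C v := ⟨h3, h2, h1⟩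
    have hlam : ∀ lam : ℝ, 0 ≤ In (fun x => Gs v x - lam * v x ^ 2) := by
      intro lam
      refine slice_Gs hn hC (fun f hf => ?_) hv
      rw [Js_sub hf.gs (hf.sq.cmul lam), Js_cmul, hE' f hf]
      simpa using Js_nonneg fun x => Gs_nonneg f x
    have hv0 := hv.mono hC.ne
    have hpos : 0 < In (fun x => v x ^ 2) := by
      simp only [In]
      have hc := (hv0.sq.wt (-(n:ℝ))).1.continuous
      have hx0 : x ≠ 0 := hC.ne hx
      refine hc.integral_pos_of_hasCompactSupport_nonneg_nonzero (hv0.sq.wt _).2.1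
        (fun y => mul_nonneg (Real.rpow_nonneg (norm_nonneg _) _) (sq_nonneg _)) (x := x) ?_
      have : 0 < ‖x‖ := by simpa using hx0
      rw [h5]; positivity
    have := hlam ((In (Gs v) + 1) / In (fun x => v x ^ 2))
    rw [In_sub hv0.gs (hv0.sq.cmul _), In_cmul, div_mul_cancel₀ _ hpos.ne'] at this
    linarith
  set lam := sInf A with hl
  have hlam0 : 0 ≤ lam := le_csInf hAne hA0
  refine ⟨lam, hlam0, ?_, ?_⟩
  · intro v hv
    have hv0 := hv.mono hC.ne
    have := slice_Gs hn hC (lam := lam) (fun f hf => ?_) hv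
    · rw [In_sub hv0.gs (hv0.sq.cmul _), In_cmul] at this; linarith
    · rw [Js_sub hf.gs (hf.sq.cmul lam), Js_cmul]
      rcases (Js_nonneg fun x => sq_nonneg (f x)).eq_or_lt with h | h
      · rw [← h]; simpa using Js_nonneg fun x => Gs_nonneg f x
      · have := csInf_le hbdd (hscale f hf h)
        rw [← hl, le_div_iff₀ h] at this; linarith
  · have : ∀ k : ℕ, ∃ f, HF C f ∧ Js (fun x => f x ^ 2) = 1 ∧ Js (Gs f) < lam + 1 / ((k:ℝ) + 1) := by
      intro k
      obtain ⟨q, ⟨f, hf, h1, rfl⟩, h2⟩ := exists_lt_of_csInf_lt hAne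
        (show sInf A < lam + 1 / ((k:ℝ) + 1) by rw [← hl]; have : 0 < 1 / ((k:ℝ) + 1) := by positivity
                                                linarith)
      exact ⟨f, hf, h1, h2⟩
    choose f hf h1 h2 using this
    refine ⟨f, hf, h1, fun k => (h2 k).le.trans ?_, ?_⟩
    · have : 1 / ((k:ℝ) + 1) ≤ 1 := by rw [div_le_one (by positivity)]; linarith [(Nat.cast_nonneg k : (0:ℝ) ≤ k)]
      linarith
    · have ht : Tendsto (fun k : ℕ => lam + 1 / ((k:ℝ) + 1)) atTop (𝓝 lam) := by
        simpa using tendsto_const_nhds.add (tendsto_one_div_add_atTop_nhds_zero_nat (𝕜 := ℝ))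
      exact tendsto_of_tendsto_of_tendsto_of_le_of_le tendsto_const_nhds ht
        (fun k => csInf_le hbdd ⟨f k, hf k, h1 k, rfl⟩) fun k => (h2 k).le
end P8

section P9
variable {C : Set (𝔼 n)}

open scoped Pointwise in
lemma null_of_dil {N : Set (𝔼 n)} (h0 : (0 : 𝔼 n) ∉ N) (hd : ∀ t : ℝ, 0 < t → ∀ x ∈ N, t • x ∈ N)
    (h : volume (N ∩ {x | |Real.log ‖x‖| ≤ 1}) = 0) : volume N = 0 := by
  set A := N ∩ {x : 𝔼 n | |Real.log ‖x‖| ≤ 1} with hA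
  have hsub : N ⊆ ⋃ j : ℤ, ((2:ℝ) ^ j) • A := by
    intro x hx
    have hx0 : x ≠ 0 := fun h => h0 (h ▸ hx)
    have hp : 0 < ‖x‖ := by simpa using hx0
    obtain ⟨j, hj1, hj2⟩ := exists_mem_Ico_zpow (y := (2:ℝ)) hp (by norm_num)
    have h2 : (0:ℝ) < 2 ^ j := by positivity
    refine mem_iUnion.2 ⟨j, ?_⟩
    rw [mem_smul_set_iff_inv_smul_mem₀ h2.ne']
    refine ⟨hd _ (by positivity) _ hx, ?_⟩
    have hnorm : ‖((2:ℝ) ^ j)⁻¹ • x‖ = ‖x‖ / 2 ^ j := by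
      rw [norm_smul, Real.norm_of_nonneg (by positivity)]; field_simp
    rw [mem_ofPred_eq, hnorm]
    have e1 : 1 ≤ ‖x‖ / 2 ^ j := by rw [le_div_iff₀ h2]; linarith
    have e2 : ‖x‖ / 2 ^ j ≤ 2 := by
      rw [div_le_iff₀ h2]; rw [zpow_add₀ (by norm_num)] at hj2
      have : (2:ℝ) ^ j * 2 ^ (1:ℤ) = 2 * 2 ^ j := by rw [zpow_one]; ring
      linarith
    rw [abs_of_nonneg (Real.log_nonneg e1)]
    have := Real.log_le_sub_one_of_pos (lt_of_lt_of_le one_pos e1)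
    linarith
  refine measure_mono_null hsub (measure_iUnion_null fun j => ?_)
  rw [Measure.addHaar_smul, h, mul_zero]

lemma exists_limit (hn : 2 ≤ n) (hC : IsCone C) {A : ℝ} (f : ℕ → (𝔼 n) → ℝ) (hf : ∀ k, HF C (f k))
    (h1 : ∀ k, Js (fun x => f k x ^ 2) = 1) (hA : ∀ k, Js (Gs (f k)) ≤ A) :
    ∃ φ : (𝔼 n) → ℝ, (∀ t : ℝ, 0 < t → ∀ x, φ (t • x) = φ x) ∧ (∀ x ∉ C, φ x = 0) ∧
      ¬ (φ =ᵐ[volume] 0) ∧ ∃ σ : ℕ → ℕ, StrictMono σ ∧ ∀ T, ∀ hT : 0 < T,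
      ∃ τ : ℕ → ℕ, StrictMono τ ∧ MemLp (fun x => zt T hT (Real.log ‖x‖) * φ x) 2 volume ∧
      Tendsto (fun k => ∫ x, (zt T hT (Real.log ‖x‖) * f (σ (τ k)) x -
        zt T hT (Real.log ‖x‖) * φ x) ^ 2) atTop (𝓝 0) := by
  have cpt : ∀ T, ∀ hT : 0 < T, ∀ σ : ℕ → ℕ, ∃ τ : ℕ → ℕ, StrictMono τ ∧ ∃ G : (𝔼 n) → ℝ, MemLp G 2 volume ∧
      Tendsto (fun k => ∫ x, (zt T hT (Real.log ‖x‖) * f (σ (τ k)) x - G x) ^ 2) atTop (𝓝 0) ∧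
      ∀ᵐ x, Tendsto (fun k => zt T hT (Real.log ‖x‖) * f (σ (τ k)) x) atTop (𝓝 (G x)) := by
    intro T hT σ
    obtain ⟨B, hB⟩ := cut_bounds (C := C) hn hC (A := A) hT
    refine rellich_cpt (R := Real.exp (T + 1)) (B := B) (fun k x => zt T hT (Real.log ‖x‖) * f (σ k) x)
      (fun k => ((hf (σ k)).cut (zt_cd hT) (zt_cs hT)).cd (m := 1)) ?_
      (fun k => (hB _ (hf _) (h1 _) (hA _)).1) (fun k => (hB _ (hf _) (h1 _) (hA _)).2)
    intro k x hx
    have hp : 0 < ‖x‖ := (Real.exp_pos _).trans hx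
    have : T + 1 < Real.log ‖x‖ := by rwa [Real.lt_log_iff_exp_lt hp]
    rw [zt_zero hT (this.le.trans (le_abs_self _)), zero_mul]
  obtain ⟨σ, hσ, G, hG, hG1, hG2⟩ := cpt 1 one_pos id
  simp only [id] at hG1 hG2
  have hconv : ∀ᵐ x, ∃ l, Tendsto (fun k => f (σ k) x) atTop (𝓝 l) := by
    rw [ae_iff]
    refine null_of_dil ?_ ?_ ?_
    · simp only [mem_ofPred_eq, not_not]
      exact ⟨0, by simp [(hf _).z]⟩
    · rintro t ht x hx ⟨l, hl⟩
      refine hx ⟨l, ?_⟩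
      simpa only [(hf _).hom t ht] using hl
    · refine measure_mono_null ?_ (ae_iff.1 hG2)
      rintro x ⟨hx1, hx2⟩ hx3
      refine hx1 ⟨G x, ?_⟩
      simpa only [zt_one one_pos hx2, one_mul] using hx3
  set φ : (𝔼 n) → ℝ := fun x => limUnder atTop (fun k => f (σ k) x) with hφ
  have hlim : ∀ᵐ x, Tendsto (fun k => f (σ k) x) atTop (𝓝 (φ x)) := by
    filter_upwards [hconv] with x hx
    exact tendsto_nhds_limUnder hx
  have hall : ∀ T, ∀ hT : 0 < T,
      ∃ τ : ℕ → ℕ, StrictMono τ ∧ MemLp (fun x => zt T hT (Real.log ‖x‖) * φ x) 2 volume ∧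
      Tendsto (fun k => ∫ x, (zt T hT (Real.log ‖x‖) * f (σ (τ k)) x -
        zt T hT (Real.log ‖x‖) * φ x) ^ 2) atTop (𝓝 0) := by
    intro T hT
    obtain ⟨τ, hτ, G', g1, g2, g3⟩ := cpt T hT σ
    have hae : G' =ᵐ[volume] fun x => zt T hT (Real.log ‖x‖) * φ x := by
      filter_upwards [g3, hlim] with x hx1 hx2
      exact tendsto_nhds_unique hx1 ((hx2.comp hτ.tendsto_atTop).const_mul _)
    refine ⟨τ, hτ, g1.ae_eq hae, g2.congr fun k => integral_congr_ae ?_⟩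
    filter_upwards [hae] with x hx
    rw [hx]
  refine ⟨φ, ?_, ?_, ?_, σ, hσ, hall⟩
  · intro t ht x
    simp only [hφ, (hf _).hom t ht]
  · intro x hx
    simp only [hφ, (hf _).eq_zero hx]
    exact tendsto_const_nhds.limUnder_eq
  · intro h0
    obtain ⟨τ, hτ, -, hl⟩ := hall 1 one_pos
    set I := ∫ s, (zt 1 one_pos s) ^ 2 with hI
    have hIpos : 0 < I := by
      refine Continuous.integral_pos_of_hasCompactSupport_nonneg_nonzero (x := 0)
        (((zt_cd one_pos).continuous).pow 2) ?_ (fun y => sq_nonneg _) ?_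
      · exact (zt_cs one_pos).comp_left (g := fun s : ℝ => s ^ 2) (by simp)
      · simp only [zt_one one_pos (show |(0:ℝ)| ≤ 1 by simp)]; norm_num
    have hlow : ∀ k, I ≤ Real.exp (|(n:ℝ)| * (1 + 1)) * ∫ x, (zt 1 one_pos (Real.log ‖x‖) * f (σ (τ k)) x -
        zt 1 one_pos (Real.log ‖x‖) * φ x) ^ 2 := by
      intro k
      set g : (𝔼 n) → ℝ := f (σ (τ k)) with hgdef
      have hg : HF C g := hf _
      have hcut := (hg.cut (zt_cd one_pos) (zt_cs one_pos)).mono hC.ne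
      have e1 : ∫ x, (zt 1 one_pos (Real.log ‖x‖) * g x -
        zt 1 one_pos (Real.log ‖x‖) * φ x) ^ 2 = ∫ x, (zt 1 one_pos (Real.log ‖x‖) * g x) ^ 2 := by
        refine integral_congr_ae ?_
        filter_upwards [h0] with x hx
        simp [hx]
      have e2 := In_hom hn (f := fun x => g x ^ 2) (fun t ht x => by simp [hg.hom t ht])
        (fun s => (zt 1 one_pos s) ^ 2)
      rw [hgdef, h1, mul_one, ← hI, ← hgdef] at e2
      rw [e1, ← e2]
      simp only [In, ← mul_pow]
      have e3 : ∀ x : 𝔼 n, ‖x‖ ^ (n:ℝ) * (‖x‖ ^ (-(n:ℝ)) * (zt 1 one_pos (Real.log ‖x‖) * g x) ^ 2)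
          = (zt 1 one_pos (Real.log ‖x‖) * g x) ^ 2 := by
        intro x
        by_cases hx : x = 0
        · subst hx; simp [hg.z]
        · have hp : 0 < ‖x‖ := by simpa using hx
          rw [← mul_assoc, ← Real.rpow_add hp]; simp
      have := int_le_In (n:ℝ) (T := 1 + 1) (F := fun x : 𝔼 n => ‖x‖ ^ (-(n:ℝ)) * (zt 1 one_pos (Real.log ‖x‖) * g x) ^ 2)
        (fun x => mul_nonneg (Real.rpow_nonneg (norm_nonneg _) _) (sq_nonneg _)) (by simp [hg.z])
        (fun x hx => by simp [zt_zero one_pos hx.le])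
        (by simp only [e3]; exact hcut.sq.int)
      simpa only [e3] using this
    have := ge_of_tendsto' (hl.const_mul (Real.exp (|(n:ℝ)| * (1 + 1)))) hlow
    linarith
end P9

section P10
variable {C : Set (𝔼 n)} {f u v θ : (𝔼 n) → ℝ}

/-- polarized spherical gradient form -/
def Gb (f g : (𝔼 n) → ℝ) (x : 𝔼 n) : ℝ := (1 / 2) * ∑ i, ∑ j, Lr i j f x * Lr i j g x

lemma Lr_zero (i j : Fin n) (f : (𝔼 n) → ℝ) : Lr i j f 0 = 0 := by simp [Dv]

lemma TF.gb (hu : TF C u) (hv : TF C v) : TF C (Gb u v) :=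
  (TF.sum fun _ _ => TF.sum fun _ _ => hu.dv.gmul hv.dv.1).cmul _

lemma cd_gb (hf : HF C f) (hθ : TF {0}ᶜ θ) : TF {0}ᶜ (Gb f θ) :=
  (TF.sum fun _ _ => TF.sum fun _ _ => hθ.dv.lmul open0 hf.dv.cd).cmul _

lemma exists_T {K : Set (𝔼 n)} (hK : IsCompact K) (h0 : K ⊆ {0}ᶜ) :
    ∃ T : ℝ, 0 < T ∧ ∀ x ∈ K, |Real.log ‖x‖| ≤ T := by
  obtain ⟨T, hT⟩ := hK.exists_bound_of_continuousOn (cd_log.continuousOn.mono h0)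
  exact ⟨max T 1, lt_of_lt_of_le one_pos (le_max_right _ _), fun x hx => (hT x hx).trans (le_max_left _ _)⟩

lemma Q_expand (hu : TF {0}ᶜ u) (hv : TF {0}ᶜ v) (lam t : ℝ) :
    In (Gs (fun x => u x - t * v x)) - lam * In (fun x => (u x - t * v x) ^ 2) =
    (In (Gs u) - lam * In (fun x => u x ^ 2)) - 2 * t * (In (Gb u v) - lam * In (fun x => u x * v x))
     + t ^ 2 * (In (Gs v) - lam * In (fun x => v x ^ 2)) := by
  have e1 : Gs (fun x => u x - t * v x) = fun x => (Gs u x - (2 * t) * Gb u v x) + t ^ 2 * Gs v x := by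
    ext x
    have : ∀ i j, Lr i j (fun x => u x - t * v x) x = Lr i j u x - t * Lr i j v x := by
      intro i j
      rw [Dv_sub hu.da (hv.cmul t).da, Dv_const_mul t hv.da]
    simp only [Gs, Gb, this]
    have e : ∀ i j, (Lr i j u x - t * Lr i j v x) ^ 2 =
      Lr i j u x ^ 2 - 2 * t * (Lr i j u x * Lr i j v x) + t ^ 2 * Lr i j v x ^ 2 := by intros; ring
    simp only [e, Finset.sum_add_distrib, Finset.sum_sub_distrib, ← Finset.mul_sum]
    ring
  have e2 : (fun x => (u x - t * v x) ^ 2) = fun x => (u x ^ 2 - (2 * t) * (u x * v x)) + t ^ 2 * v x ^ 2 := by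
    ext x; ring
  rw [e1, e2, In_add (hu.gs.sub ((hu.gb hv).cmul _)) (hv.gs.cmul _), In_sub hu.gs ((hu.gb hv).cmul _),
    In_add (hu.sq.sub ((hu.gmul hv.1).cmul _)) (hv.sq.cmul _), In_sub hu.sq ((hu.gmul hv.1).cmul _)]
  simp only [In_cmul]
  ring

lemma ibp_H {H : ℝ → ℝ} (hH : ContDiff ℝ ∞ H) (hf : HF C f) (hθ : TF {0}ᶜ θ) :
    In (fun x => H (f x) * Ds θ x) = - In (fun x => deriv H (f x) * Gb f θ x) := by
  have hHf : ContDiffOn ℝ ∞ (fun x => H (f x)) {0}ᶜ := hH.comp_contDiffOn hf.cd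
  have hhf : ContDiffOn ℝ ∞ (fun x => deriv H (f x)) {0}ᶜ := (contDiff_infty_iff_deriv.1 hH).2.comp_contDiffOn hf.cd
  have hdH : Differentiable ℝ H := hH.differentiable (by simp)
  have key : ∀ i j, In (fun x => H (f x) * Lr i j (Lr i j θ) x + deriv H (f x) * (Lr i j f x * Lr i j θ x)) = 0 := by
    intro i j
    have h1 : TF {0}ᶜ (fun x => H (f x) * Lr i j θ x) := hθ.dv.lmul open0 hHf
    rw [← In_Lr h1 i j]
    congr 1; ext x
    by_cases hx : x = 0
    · subst hx; simp [Lr_zero]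
    · rw [Dv_mul (f := fun x => H (f x)) ((hdH _).comp x (hf.da hx)) hθ.dv.da, Dv_comp (hdH _).hasDerivAt (hf.da hx)]
      ring
  have hT : ∀ i j, TF {0}ᶜ (fun x => H (f x) * Lr i j (Lr i j θ) x + deriv H (f x) * (Lr i j f x * Lr i j θ x)) := by
    intro i j
    exact (hθ.dv.dv.lmul open0 hHf).add ((hθ.dv.lmul open0 hf.dv.cd).lmul open0 hhf)
  have h2 : In (fun x => H (f x) * Ds θ x + deriv H (f x) * Gb f θ x) = 0 := by
    have : (fun x => H (f x) * Ds θ x + deriv H (f x) * Gb f θ x) = fun x => (1/2) * ∑ i, ∑ j,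
      (H (f x) * Lr i j (Lr i j θ) x + deriv H (f x) * (Lr i j f x * Lr i j θ x)) := by
      ext x
      simp only [Ds, Gb, Finset.sum_add_distrib, ← Finset.mul_sum]; ring
    rw [this, In_cmul, In_sum fun i _ => TF.sum fun j _ => hT i j]
    simp only [In_sum fun j (_ : j ∈ Finset.univ) => hT _ j, key]; simp
  rw [In_add (hθ.ds.lmul open0 hHf) ((cd_gb hf hθ).lmul open0 hhf)] at h2
  linarith

lemma ibp_E {H : ℝ → ℝ} (hH : ContDiff ℝ ∞ H) (hf : HF C f) (hθ : TF {0}ᶜ θ) :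
    In (fun x => H (f x) * Eu θ x) = 0 := by
  have hHf : ContDiffOn ℝ ∞ (fun x => H (f x)) {0}ᶜ := hH.comp_contDiffOn hf.cd
  have hdH : Differentiable ℝ H := hH.differentiable (by simp)
  have h1 : TF {0}ᶜ (fun x => H (f x) * θ x) := hθ.lmul open0 hHf
  rw [← In_Eu h1]
  congr 1; ext x
  by_cases hx : x = 0
  · subst hx; simp [Dv]
  · rw [Dv_mul (f := fun x => H (f x)) ((hdH _).comp x (hf.da hx)) hθ.da, Dv_comp (hdH _).hasDerivAt (hf.da hx), hf.eu]
    ring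

lemma In_mono' {f g : (𝔼 n) → ℝ} (hf : TF {0}ᶜ f) (hg : TF {0}ᶜ g) (h : ∀ x, f x ≤ g x) : In f ≤ In g := by
  have := In_nonneg (f := fun x => g x - f x) fun x => sub_nonneg.2 (h x)
  rw [In_sub hg hf] at this; linarith

lemma weak1 (hC : IsCone C) {lam : ℝ} (hl : 0 ≤ lam)
    (hP : ∀ v, TF C v → lam * In (fun x => v x ^ 2) ≤ In (Gs v))
    {H : ℝ → ℝ} (hH : ContDiff ℝ ∞ H) (hconv : ∀ s, 0 ≤ deriv (deriv H) s) (hsH : ∀ s, s * deriv H s ≤ H s)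
    (hθ : TF {0}ᶜ θ) (hθ0 : ∀ x, 0 ≤ θ x) (hf : HF C f) (hv : TF C (fun x => deriv H (f x) * θ x))
    {T : ℝ} (hT : 0 < T) (hTθ : ∀ x ∈ tsupport θ, |Real.log ‖x‖| ≤ T) {t : ℝ} (ht : 0 < t) :
    -((In (Gs (fun x => zt T hT (Real.log ‖x‖) * f x)) - lam * In (fun x => (zt T hT (Real.log ‖x‖) * f x) ^ 2))
      + t ^ 2 * (In (Gs (fun x => deriv H (f x) * θ x)))) / (2 * t)
      ≤ In (fun x => H (f x) * (lam * θ x + Ds θ x)) := by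
  set u := fun x => zt T hT (Real.log ‖x‖) * f x with hu
  set v := fun x => deriv H (f x) * θ x with hvdef
  have hu1 : TF C u := hf.cut (zt_cd hT) (zt_cs hT)
  have hu0 := hu1.mono hC.ne
  have hv0 := hv.mono hC.ne
  have hHf : ContDiffOn ℝ ∞ (fun x => H (f x)) {0}ᶜ := hH.comp_contDiffOn hf.cd
  have hh : ContDiff ℝ ∞ (deriv H) := (contDiff_infty_iff_deriv.1 hH).2
  have hhf : ContDiffOn ℝ ∞ (fun x => deriv H (f x)) {0}ᶜ := hh.comp_contDiffOn hf.cd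
  have hh1f : ContDiffOn ℝ ∞ (fun x => deriv (deriv H) (f x)) {0}ᶜ :=
    (contDiff_infty_iff_deriv.1 hh).2.comp_contDiffOn hf.cd
  have hdh : Differentiable ℝ (deriv H) := hh.differentiable (by simp)
  have hz : ∀ x, x ∉ tsupport θ → θ x = 0 ∧ ∀ i j, Lr i j θ x = 0 := by
    intro x hx
    refine ⟨image_eq_zero_of_notMem_tsupport hx, fun i j => ?_⟩
    have : fderiv ℝ θ x = 0 := image_eq_zero_of_notMem_tsupport fun h => hx (tsupport_fderiv_subset ℝ h)
    simp [Dv, this]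
  have t1 : TF {0}ᶜ (fun x => H (f x) * θ x) := hθ.lmul open0 hHf
  have t3 : TF {0}ᶜ (fun x => deriv H (f x) * Gb f θ x) := (cd_gb hf hθ).lmul open0 hhf
  have t4 : TF {0}ᶜ (fun x => deriv (deriv H) (f x) * (Gs f x * θ x)) :=
    (hθ.lmul open0 hf.gs.cd).lmul open0 hh1f
  have t5 : TF {0}ᶜ (fun x => f x * (deriv H (f x) * θ x)) := (hθ.lmul open0 hhf).lmul open0 hf.cd
  have eGb : Gb u v = fun x => deriv (deriv H) (f x) * (Gs f x * θ x) + deriv H (f x) * Gb f θ x := by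
    ext x
    by_cases hx : x = 0
    · subst hx; simp [Gb, Gs, Lr_zero]
    have hLv : ∀ i j, Lr i j v x = deriv H (f x) * Lr i j θ x + θ x * (deriv (deriv H) (f x) * Lr i j f x) := by
      intro i j
      rw [hvdef, Dv_mul (f := fun x => deriv H (f x)) ((hdh _).comp x (hf.da hx)) hθ.da, Dv_comp (hdh _).hasDerivAt (hf.da hx)]
    have hLu : ∀ i j, Lr i j u x = zt T hT (Real.log ‖x‖) * Lr i j f x := by
      intro i j; rw [hu, Lr_cut hf (zt_cd hT)]
    by_cases hxθ : x ∈ tsupport θ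
    · simp only [Gb, Gs, hLv, hLu, zt_one hT (hTθ x hxθ), one_mul]
      have e : ∀ i j, Lr i j f x * (deriv H (f x) * Lr i j θ x + θ x * (deriv (deriv H) (f x) * Lr i j f x)) =
        deriv H (f x) * (Lr i j f x * Lr i j θ x) + (θ x * deriv (deriv H) (f x)) * Lr i j f x ^ 2 := by
        intros; ring
      simp only [e, Finset.sum_add_distrib, ← Finset.mul_sum]
      ring
    · obtain ⟨a, b⟩ := hz x hxθ
      simp [Gb, hLv, a, b]
  have euv : (fun x => u x * v x) = fun x => f x * (deriv H (f x) * θ x) := by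
    ext x
    by_cases hxθ : x ∈ tsupport θ
    · simp only [hu, hvdef, zt_one hT (hTθ x hxθ)]; ring
    · simp [hvdef, (hz x hxθ).1]
  have hQ := hP _ (hu1.sub (hv.cmul t))
  have hex := Q_expand hu0 hv0 lam t
  rw [eGb, euv, In_add t4 t3] at hex
  have e0 : In (fun x => H (f x) * (lam * θ x + Ds θ x)) = lam * In (fun x => H (f x) * θ x) -
      In (fun x => deriv H (f x) * Gb f θ x) := by
    have : (fun x => H (f x) * (lam * θ x + Ds θ x)) = fun x => lam * (H (f x) * θ x) + H (f x) * Ds θ x := by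
      ext x; ring
    rw [this, In_add (t1.cmul _) (hθ.ds.lmul open0 hHf), In_cmul, ibp_H hH hf hθ]; ring
  have hn1 : 0 ≤ In (fun x => deriv (deriv H) (f x) * (Gs f x * θ x)) :=
    In_nonneg fun x => mul_nonneg (hconv _) (mul_nonneg (Gs_nonneg _ _) (hθ0 x))
  have hn2 : In (fun x => f x * (deriv H (f x) * θ x)) ≤ In (fun x => H (f x) * θ x) := by
    refine In_mono' t5 t1 fun x => ?_
    have := mul_le_mul_of_nonneg_right (hsH (f x)) (hθ0 x)
    linarith
  have hn3 : 0 ≤ lam * In (fun x => v x ^ 2) := mul_nonneg hl (In_nonneg fun x => sq_nonneg _)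
  have hn4 := mul_le_mul_of_nonneg_left hn2 hl
  rw [e0, div_le_iff₀ (by positivity)]
  set a := In (fun x => deriv H (f x) * Gb f θ x)
  set b := In (fun x => deriv (deriv H) (f x) * (Gs f x * θ x))
  set c := In (fun x => f x * (deriv H (f x) * θ x))
  set d := In (fun x => H (f x) * θ x)
  have h5 : 0 ≤ t ^ 2 * (lam * In (fun x => v x ^ 2)) := by positivity
  have h6 : 0 ≤ t * b := by positivity
  have h7 : 0 ≤ t * (lam * d - lam * c) := mul_nonneg ht.le (by linarith)
  nlinarith [hQ, hex, h5, h6, h7]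

lemma weak2 (hn : 2 ≤ n) (hC : IsCone C) {lam : ℝ} (hl : 0 ≤ lam)
    (hP : ∀ v, TF C v → lam * In (fun x => v x ^ 2) ≤ In (Gs v))
    {H : ℝ → ℝ} (hH : ContDiff ℝ ∞ H) (hconv : ∀ s, 0 ≤ deriv (deriv H) s) (hsH : ∀ s, s * deriv H s ≤ H s)
    {B : ℝ} (hB0 : ∀ s, |deriv H s| ≤ 1) (hB1 : ∀ s, |deriv (deriv H) s| ≤ B)
    (hθ : TF {0}ᶜ θ) (hθ0 : ∀ x, 0 ≤ θ x) 
    {T : ℝ} (hT : 0 < T) (hTθ : ∀ x ∈ tsupport θ, |Real.log ‖x‖| ≤ T) (A : ℝ) :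
    ∃ I K : ℝ, ∀ f, HF C f → Js (fun x => f x ^ 2) = 1 → Js (Gs f) ≤ A → 
      TF C (fun x => deriv H (f x) * θ x) → ∀ t, 0 < t →
    -(I * (Js (Gs f) - lam) + t ^ 2 * K) / (2 * t) ≤ In (fun x => H (f x) * (lam * θ x + Ds θ x)) := by
  obtain ⟨M, hM⟩ := hθ.2.1.exists_bound_of_continuous hθ.1.continuous
  set I := ∫ s, (zt T hT s) ^ 2 with hI
  have hI0 : 0 ≤ I := integral_nonneg fun _ => sq_nonneg _
  refine ⟨I, 2 * B ^ 2 * M ^ 2 * (I * A) + 2 * In (Gs θ), fun f hf h1 hA hv t ht => ?_⟩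
  refine le_trans ?_ (weak1 hC hl hP hH hconv hsH hθ hθ0 hf hv hT hTθ ht)
  have hu1 : TF C (fun x => zt T hT (Real.log ‖x‖) * f x) := hf.cut (zt_cd hT) (zt_cs hT)
  have hu0 := hu1.mono hC.ne
  have hv0 := hv.mono hC.ne
  have hh : ContDiff ℝ ∞ (deriv H) := (contDiff_infty_iff_deriv.1 hH).2
  have hdh : Differentiable ℝ (deriv H) := hh.differentiable (by simp)
  have e1 : In (Gs (fun x => zt T hT (Real.log ‖x‖) * f x)) = I * Js (Gs f) := by
    rw [Gs_cut hf (zt_cd hT)]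
    exact In_hom hn hf.gs.hom (fun s => (zt T hT s) ^ 2)
  have e2 : In (fun x => (zt T hT (Real.log ‖x‖) * f x) ^ 2) = I := by
    simp only [mul_pow]
    rw [In_hom hn (f := fun x => f x ^ 2) (fun t ht x => by simp [hf.hom t ht])
        (fun s => (zt T hT s) ^ 2), h1, mul_one]
  have e3 : In (Gs (fun x => deriv H (f x) * θ x)) ≤ 2 * B ^ 2 * M ^ 2 * (I * A) + 2 * In (Gs θ) := by
    have hB : 0 ≤ B := (abs_nonneg _).trans (hB1 0)
    have hM0 : 0 ≤ M := (norm_nonneg _).trans (hM 0)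
    have : In (Gs (fun x => deriv H (f x) * θ x)) ≤
        In (fun x => 2 * B ^ 2 * M ^ 2 * Gs (fun x => zt T hT (Real.log ‖x‖) * f x) x + 2 * Gs θ x) := by
      refine In_mono' hv0.gs ((hu0.gs.cmul _).add (hθ.gs.cmul _)) fun x => ?_
      by_cases hx : x = 0
      · subst hx; simp [Gs, Lr_zero]
      have hLv : ∀ i j, Lr i j (fun x => deriv H (f x) * θ x) x =
          deriv H (f x) * Lr i j θ x + θ x * (deriv (deriv H) (f x) * Lr i j f x) := by
        intro i j
        rw [Dv_mul (f := fun x => deriv H (f x)) ((hdh _).comp x (hf.da hx)) hθ.da, Dv_comp (hdh _).hasDerivAt (hf.da hx)]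
      have hLu : ∀ i j, Lr i j (fun x => zt T hT (Real.log ‖x‖) * f x) x = zt T hT (Real.log ‖x‖) * Lr i j f x := by
        intro i j; rw [Lr_cut hf (zt_cd hT)]
      have hs : ∀ i j, (Lr i j (fun x => deriv H (f x) * θ x) x) ^ 2 ≤
          2 * B ^ 2 * M ^ 2 * (Lr i j (fun x => zt T hT (Real.log ‖x‖) * f x) x) ^ 2 + 2 * (Lr i j θ x) ^ 2 := by
        intro i j
        rw [hLv, hLu]
        by_cases hxθ : x ∈ tsupport θ
        · rw [zt_one hT (hTθ x hxθ), one_mul]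
          have a1 : (deriv H (f x)) ^ 2 ≤ 1 := by
            have := hB0 (f x); rw [← sq_abs]; nlinarith [abs_nonneg (deriv H (f x))]
          have a2 : (deriv (deriv H) (f x)) ^ 2 ≤ B ^ 2 := by
            rw [← sq_abs]; exact pow_le_pow_left₀ (abs_nonneg _) (hB1 _) 2
          have a3 : θ x ^ 2 ≤ M ^ 2 := by
            have := hM x; rw [Real.norm_eq_abs] at this
            rw [← sq_abs]; exact pow_le_pow_left₀ (abs_nonneg _) this 2
          have a4 : θ x ^ 2 * (deriv (deriv H) (f x)) ^ 2 ≤ M ^ 2 * B ^ 2 :=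
            mul_le_mul a3 a2 (sq_nonneg _) (sq_nonneg _)
          have a5 := mul_le_mul_of_nonneg_right a4 (sq_nonneg (Lr i j f x))
          have a6 := mul_le_mul_of_nonneg_right a1 (sq_nonneg (Lr i j θ x))
          have a7 := sq_nonneg (deriv H (f x) * Lr i j θ x - θ x * (deriv (deriv H) (f x) * Lr i j f x))
          nlinarith [a5, a6, a7]
        · have z1 : θ x = 0 := image_eq_zero_of_notMem_tsupport hxθ
          have z2 : fderiv ℝ θ x = 0 := image_eq_zero_of_notMem_tsupport fun h => hxθ (tsupport_fderiv_subset ℝ h)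
          have z3 : Lr i j θ x = 0 := by simp [Dv, z2]
          rw [z1, z3]
          have : 0 ≤ 2 * B ^ 2 * M ^ 2 * (zt T hT (Real.log ‖x‖) * Lr i j f x) ^ 2 := by positivity
          simpa using this
      simp only [Gs]
      have := Finset.sum_le_sum fun i (_ : i ∈ Finset.univ) => Finset.sum_le_sum fun j (_ : j ∈ Finset.univ) => hs i j
      simp only [Finset.sum_add_distrib, ← Finset.mul_sum] at this
      linarith
    refine this.trans ?_
    rw [In_add (hu0.gs.cmul _) (hθ.gs.cmul _), In_cmul, In_cmul, e1]
    have : 2 * B ^ 2 * M ^ 2 * (I * Js (Gs f)) ≤ 2 * B ^ 2 * M ^ 2 * (I * A) := by gcongr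
    linarith
  rw [e1, e2]
  refine div_le_div_of_nonneg_right ?_ (by positivity)
  have := mul_le_mul_of_nonneg_left e3 (sq_nonneg t)
  linarith
end P10

section P11
variable {C : Set (𝔼 n)} {φ θ ψ : (𝔼 n) → ℝ}

lemma int_WH {W G : (𝔼 n) → ℝ} (hW : Continuous W) (hWc : HasCompactSupport W) (hG : MemLp G 2 volume)
    {H : ℝ → ℝ} (hHc : Continuous H) (hH : ∀ a b, |H a - H b| ≤ |a - b|) :
    Integrable (fun x => W x * H (G x)) := by
  have hWm := memLp2 hW hWc
  have i1 : Integrable (fun x => W x * G x) := hWm.integrable_mul hG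
  have i2 : Integrable W := hW.integrable_of_hasCompactSupport hWc
  refine ((i1.norm).add ((i2.norm).mul_const |H 0|)).mono'
    (hW.aestronglyMeasurable.mul (hHc.comp_aestronglyMeasurable hG.1)) (ae_of_all _ fun x => ?_)
  simp only [Pi.add_apply, norm_mul, Real.norm_eq_abs]
  have h1 : |H (G x)| ≤ |G x| + |H 0| := by
    have := hH (G x) 0
    have h2 := abs_add_le (H (G x) - H 0) (H 0)
    simp only [sub_add_cancel, sub_zero] at h2 this
    linarith
  have := mul_le_mul_of_nonneg_left h1 (abs_nonneg (W x))
  linarith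

lemma conv_WH {W G : (𝔼 n) → ℝ} {g : ℕ → (𝔼 n) → ℝ} (hW : Continuous W) (hWc : HasCompactSupport W)
    (hG : MemLp G 2 volume) (hg : ∀ k, MemLp (g k) 2 volume)
    {H : ℝ → ℝ} (hHc : Continuous H) (hH : ∀ a b, |H a - H b| ≤ |a - b|)
    (hl : Tendsto (fun k => ∫ x, (g k x - G x) ^ 2) atTop (𝓝 0)) :
    Tendsto (fun k => ∫ x, W x * H (g k x)) atTop (𝓝 (∫ x, W x * H (G x))) := by
  have hWm := memLp2 hW hWc
  have bound : ∀ k, ∀ s : ℝ, 0 < s → |(∫ x, W x * H (g k x)) - ∫ x, W x * H (G x)| ≤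
      s / 2 * (∫ x, W x ^ 2) + (2 * s)⁻¹ * ∫ x, (g k x - G x) ^ 2 := by
    intro k s hs
    have i2 : Integrable (fun x => (g k x - G x) ^ 2) := ((hg k).sub hG).integrable_sq
    rw [← integral_sub (int_WH hW hWc (hg k) hHc hH) (int_WH hW hWc hG hHc hH), ← integral_const_mul,
      ← integral_const_mul, ← integral_add (hWm.integrable_sq.const_mul _)
        (i2.const_mul _), ← Real.norm_eq_abs]
    refine norm_integral_le_of_norm_le ((hWm.integrable_sq.const_mul _).add
        (i2.const_mul _)) (ae_of_all _ fun x => ?_)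
    rw [← mul_sub, norm_mul, Real.norm_eq_abs, Real.norm_eq_abs]
    have h1 := mul_le_mul_of_nonneg_left (hH (g k x) (G x)) (abs_nonneg (W x))
    refine h1.trans ?_
    rw [← sq_abs (W x), ← sq_abs (g k x - G x)]
    set a := |W x|
    set b := |g k x - G x|
    have : s / 2 * a ^ 2 + (2 * s)⁻¹ * b ^ 2 - a * b = (2 * s)⁻¹ * (s * a - b) ^ 2 := by field_simp; ring
    have h2 : 0 ≤ (2 * s)⁻¹ * (s * a - b) ^ 2 := by positivity
    linarith
  rw [Metric.tendsto_atTop]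
  intro ε hε
  have hI : 0 ≤ ∫ x, W x ^ 2 := integral_nonneg fun _ => sq_nonneg _
  set s := ε / ((∫ x, W x ^ 2) + 1) with hs
  have hs0 : 0 < s := by positivity
  have h1 : s / 2 * (∫ x, W x ^ 2) ≤ ε / 2 := by
    have : s * ((∫ x, W x ^ 2) + 1) = ε := by rw [hs]; field_simp
    nlinarith
  have h2 := (hl.const_mul (2 * s)⁻¹).eventually (gt_mem_nhds (show (2 * s)⁻¹ * 0 < ε / 2 by simp; positivity))
  obtain ⟨N, hN⟩ := eventually_atTop.1 h2
  refine ⟨N, fun k hk => ?_⟩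
  rw [Real.dist_eq]
  have := bound k s hs0
  have := hN k hk
  linarith

/-- The data of a limit of a minimizing sequence. -/
structure Lim (C : Set (𝔼 n)) (lam : ℝ) (φ : (𝔼 n) → ℝ) : Prop where
  nn : 0 ≤ lam
  poi : ∀ v, TF C v → lam * In (fun x => v x ^ 2) ≤ In (Gs v)
  hom : ∀ t : ℝ, 0 < t → ∀ x, φ (t • x) = φ x
  off : ∀ x ∉ C, φ x = 0
  ne : ¬ (φ =ᵐ[volume] 0)
  mem : ∀ T, ∀ hT : 0 < T, MemLp (fun x => zt T hT (Real.log ‖x‖) * φ x) 2 volume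
  apx : ∀ T, ∀ hT : 0 < T, ∃ f : ℕ → (𝔼 n) → ℝ, (∀ k, HF C (f k)) ∧ (∀ k, Js (fun x => f k x ^ 2) = 1) ∧
    (∀ k, Js (Gs (f k)) ≤ lam + 1) ∧ Tendsto (fun k => Js (Gs (f k))) atTop (𝓝 lam) ∧
    Tendsto (fun k => ∫ x, (zt T hT (Real.log ‖x‖) * f k x - zt T hT (Real.log ‖x‖) * φ x) ^ 2) atTop (𝓝 0)

lemma exists_Lim (hn : 2 ≤ n) (hC : IsCone C) (hne : C.Nonempty) : ∃ lam φ, Lim C lam φ := by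
  obtain ⟨lam, hl, hP, f, hf, h1, hA, ht⟩ := exists_min hn hC hne
  obtain ⟨φ, p1, p2, p3, σ, hσ, p4⟩ := exists_limit hn hC f hf h1 hA
  refine ⟨lam, φ, hl, hP, p1, p2, p3, ?_, ?_⟩
  · intro T hT
    obtain ⟨τ, -, h, -⟩ := p4 T hT
    exact h
  · intro T hT
    obtain ⟨τ, hτ, -, h⟩ := p4 T hT
    exact ⟨fun k => f (σ (τ k)), fun k => hf _, fun k => h1 _, fun k => hA _,
      ht.comp (hσ.comp hτ).tendsto_atTop, h⟩

lemma weak3 (hn : 2 ≤ n) (hC : IsCone C) {lam : ℝ} (hL : Lim C lam φ)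
    {H : ℝ → ℝ} (hH : ContDiff ℝ ∞ H) (hconv : ∀ s, 0 ≤ deriv (deriv H) s) (hsH : ∀ s, s * deriv H s ≤ H s)
    {B : ℝ} (hB0 : ∀ s, |deriv H s| ≤ 1) (hB1 : ∀ s, |deriv (deriv H) s| ≤ B)
    (hθ : TF {0}ᶜ θ) (hθ0 : ∀ x, 0 ≤ θ x) (hv : ∀ f, HF C f → TF C (fun x => deriv H (f x) * θ x)) (c : ℝ) :
    0 ≤ ∫ x, (‖x‖ ^ (-(n:ℝ)) * (Eu (Eu θ) x + c * Eu θ x + (lam * θ x + Ds θ x))) * H (φ x) := by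
  obtain ⟨T, hT, hTθ⟩ := exists_T hθ.2.1 hθ.2.2
  obtain ⟨f, hf, h1, hA, ht, hl2⟩ := hL.apx T hT
  obtain ⟨I, K, hIK⟩ := weak2 hn hC hL.nn hL.poi hH hconv hsH hB0 hB1 hθ hθ0 hT hTθ (lam + 1)
  have hLip : ∀ a b, |H a - H b| ≤ |a - b| := by
    intro a b
    have := Convex.norm_image_sub_le_of_norm_deriv_le (f := H) (C := 1) (s := univ) (x := b) (y := a)
      (fun x _ => (hH.differentiable (by simp)) x) (fun x _ => hB0 x) convex_univ trivial trivial
    simpa using this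
  set Ψ : (𝔼 n) → ℝ := fun x => Eu (Eu θ) x + c * Eu θ x + (lam * θ x + Ds θ x) with hΨ
  have hΨT : TF {0}ᶜ Ψ := (hθ.dv.dv.add (hθ.dv.cmul c)).add ((hθ.cmul lam).add hθ.ds)
  have hEu : ∀ x, x ∉ tsupport θ → Ψ x = 0 := by
    intro x hx
    have s1 : ∀ A : (𝔼 n) →L[ℝ] (𝔼 n), ∀ g : (𝔼 n) → ℝ, x ∉ tsupport g → x ∉ tsupport (Dv A g) := by
      intro A g hg h
      refine hg (tsupport_fderiv_subset ℝ (f := g) (closure_mono ?_ h))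
      intro y hy hy'
      exact hy (by simp [Dv, hy'])
    have s2 : ∀ g : (𝔼 n) → ℝ, x ∉ tsupport g → g x = 0 := fun g hg => image_eq_zero_of_notMem_tsupport hg
    have d1 : ∀ i j, Lr i j (Lr i j θ) x = 0 := fun i j => s2 _ (s1 _ _ (s1 _ _ hx))
    simp [hΨ, Ds, d1, s2 _ hx, s2 _ (s1 _ _ (s1 _ _ hx)), s2 _ (s1 _ _ hx)]
  have hW := hΨT.wt (-(n:ℝ))
  have hcut : ∀ g : (𝔼 n) → ℝ, (fun x => (‖x‖ ^ (-(n:ℝ)) * Ψ x) * H (zt T hT (Real.log ‖x‖) * g x)) =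
      fun x => (‖x‖ ^ (-(n:ℝ)) * Ψ x) * H (g x) := by
    intro g; ext x
    by_cases hx : x ∈ tsupport θ
    · rw [zt_one hT (hTθ x hx), one_mul]
    · simp [hEu x hx]
  have hconvg := conv_WH hW.1.continuous hW.2.1 (hL.mem T hT)
    (fun k => memLp2 (((hf k).cut (zt_cd hT) (zt_cs hT)).1.continuous) ((hf k).cut (zt_cd hT) (zt_cs hT)).2.1)
    hH.continuous hLip hl2
  simp only [hcut] at hconvg
  have hIntg : ∀ k, ∫ x, (‖x‖ ^ (-(n:ℝ)) * Ψ x) * H (f k x) = In (fun x => H (f k x) * (lam * θ x + Ds θ x)) := by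
    intro k
    have hHf : ContDiffOn ℝ ∞ (fun x => H (f k x)) {0}ᶜ := hH.comp_contDiffOn (hf k).cd
    have e1 : ∫ x, (‖x‖ ^ (-(n:ℝ)) * Ψ x) * H (f k x) = In (fun x => (H (f k x) * Eu (Eu θ) x + c * (H (f k x) * Eu θ x)) +
      H (f k x) * (lam * θ x + Ds θ x)) := by
      unfold In; congr; ext x; simp only [hΨ]; ring
    rw [e1, In_add ((hθ.dv.dv.lmul open0 hHf).add ((hθ.dv.lmul open0 hHf).cmul c))
      (((hθ.cmul lam).add hθ.ds).lmul open0 hHf), In_add (hθ.dv.dv.lmul open0 hHf)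
      ((hθ.dv.lmul open0 hHf).cmul c), In_cmul, ibp_E hH (hf k) hθ, ibp_E hH (hf k) hθ.dv]
    ring
  have hfin : ∀ t : ℝ, 0 < t → -(t * K) / 2 ≤ ∫ x, (‖x‖ ^ (-(n:ℝ)) * Ψ x) * H (φ x) := by
    intro t ht0
    have l1 : Tendsto (fun k => -(I * (Js (Gs (f k)) - lam) + t ^ 2 * K) / (2 * t)) atTop
        (𝓝 (-(I * (lam - lam) + t ^ 2 * K) / (2 * t))) :=
      ((((ht.sub_const lam).const_mul I).add_const _).neg).div_const _
    have l2 := le_of_tendsto_of_tendsto' l1 hconvg fun k => by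
      rw [hIntg]
      exact hIK (f k) (hf k) (h1 k) (hA k) (hv _ (hf k)) t ht0
    refine le_trans (le_of_eq ?_) l2
    field_simp; ring
  have l3 : Tendsto (fun t : ℝ => -(t * K) / 2) (𝓝[>] 0) (𝓝 0) := by
    have : Tendsto (fun t : ℝ => -(t * K) / 2) (𝓝 0) (𝓝 (-(0 * K) / 2)) := by
      apply Continuous.tendsto; fun_prop
    simp only [zero_mul, neg_zero, zero_div] at this
    exact this.mono_left nhdsWithin_le_nhds
  exact le_of_tendsto l3 (eventually_mem_nhdsWithin.mono fun t ht => hfin t ht)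

/-- the harmonic weight exponent computation -/
lemma psi_theta (hψ : TF {0}ᶜ ψ) {lam a : ℝ} (ha : a * (a + n - 2) = lam) (x : 𝔼 n) :
    (‖x‖ ^ (-(n:ℝ)) * (Eu (Eu (fun x => ‖x‖ ^ (n + a - 2 : ℝ) * ψ x)) x
      + (-(n:ℝ) - 2 * a + 2) * Eu (fun x => ‖x‖ ^ (n + a - 2 : ℝ) * ψ x) x
      + (lam * (‖x‖ ^ (n + a - 2 : ℝ) * ψ x) + Ds (fun x => ‖x‖ ^ (n + a - 2 : ℝ) * ψ x) x))) =
      ‖x‖ ^ a * lap ψ x := by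
  by_cases hx : x = 0
  · subst hx
    simp [Dv, Ds, hψ.eq_zero (x := 0) (by simp), lap_zero hψ]
  have hp : 0 < ‖x‖ := by simpa using hx
  set b : ℝ := n + a - 2 with hb
  have e1 := Eu_wt subset_rfl hψ b
  have hE : TF {0}ᶜ (fun x => Eu ψ x + b * ψ x) := hψ.dv.add (hψ.cmul b)
  have e2 := Eu_wt subset_rfl hE b
  have e3 : Eu (fun x => Eu ψ x + b * ψ x) x = Eu (Eu ψ) x + b * Eu ψ x := by
    rw [Dv_add hψ.dv.da (hψ.cmul b).da, Dv_const_mul b hψ.da]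
  rw [Ds_wt hψ, e1, e2]
  simp only [e3]
  have e4 := lap_polar (f := ψ) (x := x) hψ.cd2.contDiffAt
  have e5 : Ds ψ x = ‖x‖ ^ 2 * lap ψ x - Eu (Eu ψ) x - ((n : ℝ) - 2) * Eu ψ x := by rw [e4]; ring
  rw [e5, ← ha]
  have e6 : ‖x‖ ^ (-(n:ℝ)) * ‖x‖ ^ b * ‖x‖ ^ 2 = ‖x‖ ^ a := by
    rw [← Real.rpow_add hp, ← Real.rpow_natCast, ← Real.rpow_add hp]; congr 1; rw [hb]; push_cast; ring
  rw [← e6, hb]; ring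

lemma weak4 (hn : 2 ≤ n) (hC : IsCone C) {lam a : ℝ} (hL : Lim C lam φ) (ha : a * (a + n - 2) = lam)
    {H : ℝ → ℝ} (hH : ContDiff ℝ ∞ H) (hconv : ∀ s, 0 ≤ deriv (deriv H) s) (hsH : ∀ s, s * deriv H s ≤ H s)
    {B : ℝ} (hB0 : ∀ s, |deriv H s| ≤ 1) (hB1 : ∀ s, |deriv (deriv H) s| ≤ B)
    (hψ : TF {0}ᶜ ψ) (hψ0 : ∀ x, 0 ≤ ψ x) (hv : deriv H 0 = 0 ∨ TF C ψ) :
    0 ≤ ∫ x, (‖x‖ ^ a * lap ψ x) * H (φ x) := by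
  have h := weak3 hn hC hL hH hconv hsH hB0 hB1 (hψ.wt (n + a - 2))
    (fun x => mul_nonneg (Real.rpow_nonneg (norm_nonneg _) _) (hψ0 x)) ?_ (-(n:ℝ) - 2 * a + 2)
  · simpa only [psi_theta hψ ha] using h
  · intro f hf
    have hh : ContDiff ℝ ∞ (deriv H) := (contDiff_infty_iff_deriv.1 hH).2
    have hhf : ContDiffOn ℝ ∞ (fun x => deriv H (f x)) {0}ᶜ := hh.comp_contDiffOn hf.cd
    rcases hv with h0 | hψC
    · have h1 := (hψ.wt (n + a - 2)).lmul open0 hhf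
      refine ⟨h1.1, h1.2.1, fun x hx => ?_⟩
      have hx0 : x ∈ ({0}ᶜ : Set (𝔼 n)) := h1.2.2 hx
      refine hf.sup ⟨?_, hx0⟩
      refine closure_mono ?_ hx
      intro y hy hy'
      refine hy ?_
      simp [hy', h0]
    · exact ((hψC.lmul hC.op ((cd_norm_rpow _).mono hC.ne))).lmul hC.op (hhf.mono hC.ne)

lemma phi_int {lam : ℝ} (hL : Lim C lam φ) {W : (𝔼 n) → ℝ} (hW : Continuous W) (hWc : HasCompactSupport W)
    (h0 : tsupport W ⊆ {0}ᶜ) : Integrable (fun x => W x * φ x) := by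
  obtain ⟨T, hT, hTW⟩ := exists_T hWc h0
  have := int_WH hW hWc (hL.mem T hT) (H := id) continuous_id (fun a b => le_rfl)
  refine this.congr (ae_of_all _ fun x => ?_)
  by_cases hx : x ∈ tsupport W
  · simp [zt_one hT (hTW x hx)]
  · simp [image_eq_zero_of_notMem_tsupport hx]

lemma TF.lp (hψ : TF C ψ) : TF C (lap ψ) := by
  have e : lap ψ = fun x => ∑ i, fderiv ℝ (fderiv ℝ ψ) x (eb i) (eb i) := by ext x; exact lap_eq
  refine hψ.of_tsupp ?_ ?_
  · rw [e]
    have h1 : ContDiff ℝ ∞ (fderiv ℝ ψ) := hψ.1.fderiv_right (by simp)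
    have h2 : ContDiff ℝ ∞ (fderiv ℝ (fderiv ℝ ψ)) := h1.fderiv_right (by simp)
    exact ContDiff.sum fun i _ => (h2.clm_apply contDiff_const).clm_apply contDiff_const
  · refine closure_minimal ?_ (isClosed_tsupport _)
    intro x hx
    by_contra h
    exact hx (lap_eq_zero h)

lemma weak_harm (hn : 2 ≤ n) (hC : IsCone C) {lam a : ℝ} (hL : Lim C lam φ) (ha : a * (a + n - 2) = lam)
    (hψ : TF C ψ) (hψ0 : ∀ x, 0 ≤ ψ x) : ∫ x, (‖x‖ ^ a * lap ψ x) * φ x = 0 := by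
  have d1 : deriv (fun s : ℝ => s) = fun _ => 1 := by ext; simp
  have d2 : deriv (fun s : ℝ => -s) = fun _ => -1 := by ext; simp
  have h1 := weak4 hn hC hL ha (H := fun s => s) (B := 0) contDiff_id (by simp [d1]) (by simp [d1])
    (by simp [d1]) (by simp [d1]) (hψ.mono hC.ne) hψ0 (Or.inr hψ)
  have h2 := weak4 hn hC hL ha (H := fun s => -s) (B := 0) contDiff_neg (by simp [d2]) (by simp [d2])
    (by simp [d2]) (by simp [d2]) (hψ.mono hC.ne) hψ0 (Or.inr hψ)
  simp only [mul_neg, integral_neg] at h2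
  linarith

lemma weak_sub (hn : 2 ≤ n) (hC : IsCone C) {lam a : ℝ} (hL : Lim C lam φ) (ha : a * (a + n - 2) = lam)
    (hψ : TF {0}ᶜ ψ) (hψ0 : ∀ x, 0 ≤ ψ x) : 0 ≤ ∫ x, (‖x‖ ^ a * lap ψ x) * |φ x| := by
  have hW : TF {0}ᶜ (fun x => ‖x‖ ^ a * lap ψ x) := hψ.lp.wt a
  obtain ⟨T, hT, hTW⟩ := exists_T hW.2.1 hW.2.2
  have hcut : ∀ H : ℝ → ℝ, (fun x => (‖x‖ ^ a * lap ψ x) * H (zt T hT (Real.log ‖x‖) * φ x)) =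
      fun x => (‖x‖ ^ a * lap ψ x) * H (φ x) := by
    intro H; ext x
    by_cases hx : x ∈ tsupport (fun x => ‖x‖ ^ a * lap ψ x)
    · rw [zt_one hT (hTW x hx), one_mul]
    · have := image_eq_zero_of_notMem_tsupport hx
      simp only [this, zero_mul]
  have hLip : ∀ a b : ℝ, abs (abs a - abs b) ≤ abs (a - b) := fun a b => abs_abs_sub_abs_le_abs_sub a b
  have iabs := int_WH hW.1.continuous hW.2.1 (hL.mem T hT) (H := fun s => |s|) continuous_abs hLip
  rw [hcut] at iabs
  have main : ∀ δ : ℝ, 0 < δ → - (δ * ∫ x, |‖x‖ ^ a * lap ψ x|) ≤ ∫ x, (‖x‖ ^ a * lap ψ x) * |φ x| := by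
    intro δ hδ
    set H : ℝ → ℝ := fun s => Real.sqrt (s ^ 2 + δ ^ 2) with hH
    have hpos : ∀ s : ℝ, 0 < s ^ 2 + δ ^ 2 := fun s => by positivity
    have hHp : ∀ s, 0 < H s := fun s => Real.sqrt_pos.2 (hpos s)
    have hH2 : ∀ s, H s ^ 2 = s ^ 2 + δ ^ 2 := fun s => Real.sq_sqrt (hpos s).le
    have hcd : ContDiff ℝ ∞ H := ContDiff.sqrt (by fun_prop) fun s => (hpos s).ne'
    have hd1 : ∀ s, HasDerivAt H (s / H s) s := by
      intro s
      have : HasDerivAt (fun s : ℝ => s ^ 2 + δ ^ 2) (2 * s) s := by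
        simpa using (hasDerivAt_pow 2 s).add_const (δ ^ 2)
      have h2 := this.sqrt (hpos s).ne'
      convert h2 using 1
      rw [mul_div_mul_left _ _ (by norm_num : (2:ℝ) ≠ 0)]
    have hd1' : deriv H = fun s => s / H s := by ext s; exact (hd1 s).deriv
    have hd2 : ∀ s, HasDerivAt (deriv H) (δ ^ 2 / H s ^ 3) s := by
      intro s
      rw [hd1']
      have := (hasDerivAt_id s).div (hd1 s) (hHp s).ne'
      have this : HasDerivAt (fun s => s / H s) ((1 * H s - s * (s / H s)) / H s ^ 2) s := this
      convert this using 1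
      have h0 := (hHp s).ne'
      field_simp
      rw [hH2]; ring
    have hd2' : deriv (deriv H) = fun s => δ ^ 2 / H s ^ 3 := by ext s; exact (hd2 s).deriv
    have hHδ : ∀ s, δ ≤ H s := fun s => Real.le_sqrt_of_sq_le (by nlinarith [sq_nonneg s])
    have hHs : ∀ s, |s| ≤ H s := fun s => Real.le_sqrt_of_sq_le (by rw [sq_abs]; nlinarith [sq_nonneg δ])
    have hHle : ∀ s, H s ≤ |s| + δ := fun s => by
      rw [hH, Real.sqrt_le_left (by positivity)]
      rw [← sq_abs s]; nlinarith [abs_nonneg s]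
    have hB0 : ∀ s, |deriv H s| ≤ 1 := fun s => by
        rw [hd1', abs_div, abs_of_pos (hHp s), div_le_one (hHp s)]; exact hHs s
    have key := weak4 hn hC hL ha (H := H) (B := δ ^ 2 / δ ^ 3) hcd
      (fun s => by rw [hd2']; have := hHp s; positivity)
      (fun s => by
        rw [hd1']
        have h3 : s * (s / H s) = s ^ 2 / H s := by ring
        rw [h3, div_le_iff₀ (hHp s), ← sq, hH2]; nlinarith [sq_nonneg δ])
      hB0
      (fun s => by
        rw [hd2']
        have h3 := hHp s
        rw [abs_of_nonneg (by positivity)]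
        have := hHδ s
        exact div_le_div_of_nonneg_left (by positivity) (by positivity) (pow_le_pow_left₀ hδ.le this 3)) hψ hψ0 (Or.inl (by rw [hd1']; simp))
    have hLip : ∀ a b, |H a - H b| ≤ |a - b| := by
      intro a b
      have := Convex.norm_image_sub_le_of_norm_deriv_le (f := H) (C := 1) (s := univ) (x := b) (y := a)
        (fun x _ => (hd1 x).differentiableAt) (fun x _ => hB0 x) convex_univ trivial trivial
      simpa using this
    have iH := int_WH hW.1.continuous hW.2.1 (hL.mem T hT) (H := H) hcd.continuous hLip
    rw [hcut] at iH
    have h4 : ∫ x, (‖x‖ ^ a * lap ψ x) * H (φ x) ≤ ∫ x, ((‖x‖ ^ a * lap ψ x) * |φ x| + δ * |‖x‖ ^ a * lap ψ x|) := by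
      refine integral_mono iH (iabs.add (hW.int.abs.const_mul δ)) fun x => ?_
      simp only
      set w := ‖x‖ ^ a * lap ψ x
      have h5 : w * (H (φ x) - |φ x|) ≤ |w| * δ := by
        refine (le_abs_self _).trans ?_
        rw [abs_mul]
        refine mul_le_mul_of_nonneg_left ?_ (abs_nonneg _)
        rw [abs_of_nonneg (by linarith [hHs (φ x)])]
        linarith [hHle (φ x)]
      linarith
    rw [integral_add iabs (hW.int.abs.const_mul δ), integral_const_mul] at h4
    linarith
  have l3 : Tendsto (fun t : ℝ => -(t * ∫ x, |‖x‖ ^ a * lap ψ x|)) (𝓝[>] 0) (𝓝 0) := by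
    have : Tendsto (fun t : ℝ => -(t * ∫ x, |‖x‖ ^ a * lap ψ x|)) (𝓝 0) (𝓝 (-(0 * ∫ x, |‖x‖ ^ a * lap ψ x|))) := by
      apply Continuous.tendsto; fun_prop
    simp only [zero_mul, neg_zero] at this
    exact this.mono_left nhdsWithin_le_nhds
  exact le_of_tendsto l3 (eventually_mem_nhdsWithin.mono fun t ht => main t ht)
end P11

section P12
variable {U : (𝔼 n) → ℝ} {C : Set (𝔼 n)}

/-- Weak harmonicity data. -/
structure WH (C : Set (𝔼 n)) (a : ℝ) (U : (𝔼 n) → ℝ) : Prop where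
  int : ∀ W : (𝔼 n) → ℝ, Continuous W → HasCompactSupport W → tsupport W ⊆ {0}ᶜ → Integrable (fun x => W x * U x)
  harm : ∀ ψ, TF C ψ → (∀ x, 0 ≤ ψ x) → ∫ x, lap ψ x * U x = 0
  sub : ∀ ψ, TF {0}ᶜ ψ → (∀ x, 0 ≤ ψ x) → 0 ≤ ∫ x, lap ψ x * |U x|
  hom : ∀ t : ℝ, 0 < t → ∀ x, U (t • x) = t ^ a * U x
  off : ∀ x ∉ C, U x = 0
  ne : ¬ (U =ᵐ[volume] 0)

lemma Lim.WH (hn : 2 ≤ n) (hC : IsCone C) {lam a : ℝ} {φ : (𝔼 n) → ℝ} (hL : Lim C lam φ) (ha : a * (a + n - 2) = lam) :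
    WH C a (fun x => ‖x‖ ^ a * φ x) where
  int W hW hWc h0 := by
    have hc : Continuous (fun x => W x * ‖x‖ ^ a) := by
      refine continuous_iff_continuousAt.2 fun x => ?_
      by_cases hx : x ∈ tsupport W
      · exact hW.continuousAt.mul (continuous_norm.continuousAt.rpow_const (Or.inl (by simpa using h0 hx)))
      · refine (continuousAt_const (y := (0:ℝ))).congr ?_
        filter_upwards [notMem_tsupport_iff_eventuallyEq.1 hx] with y hy
        simp [hy]
    have := phi_int hL hc (hWc.mul_right) ((tsupport_mul_subset_left).trans h0)
    refine this.congr (ae_of_all _ fun x => ?_)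
    simp only; ring
  harm ψ hψ h0 := by
    rw [← weak_harm hn hC hL ha hψ h0]
    congr; ext x; ring
  sub ψ hψ h0 := by
    refine (weak_sub hn hC hL ha hψ h0).trans (le_of_eq ?_)
    congr; ext x
    rw [abs_mul, abs_of_nonneg (Real.rpow_nonneg (norm_nonneg _) _)]; ring
  hom t ht x := by
    rw [hL.hom t ht, norm_smul, Real.norm_of_nonneg ht.le, Real.mul_rpow ht.le (norm_nonneg _)]; ring
  off x hx := by simp [hL.off x hx]
  ne h := by
    refine hL.ne ?_
    have : Nontrivial (𝔼 n) := by
      have : Nonempty (Fin n) := ⟨⟨0, by omega⟩⟩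
      infer_instance
    have h0 : ∀ᵐ x : 𝔼 n, x ≠ 0 := by simp [ae_iff]
    filter_upwards [h, h0] with x hx hx0
    have : 0 < ‖x‖ ^ a := Real.rpow_pos_of_pos (by simpa using hx0) _
    simpa [this.ne'] using hx

/-- radial potential -/
def Pk (y : 𝔼 n) : ℝ := expNegInvGlue (1 - ‖y‖ ^ 2)
/-- radial kernel -/
def rk (y : 𝔼 n) : ℝ := 2 * deriv expNegInvGlue (1 - ‖y‖ ^ 2)

lemma glue_cd : ContDiff ℝ ∞ expNegInvGlue := expNegInvGlue.contDiff

lemma Pk_cd : ContDiff ℝ ∞ (Pk (n := n)) := glue_cd.comp (contDiff_const.sub (contDiff_norm_sq ℝ))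

lemma rk_cd : ContDiff ℝ ∞ (rk (n := n)) :=
  contDiff_const.mul ((contDiff_infty_iff_deriv.1 glue_cd).2.comp (contDiff_const.sub (contDiff_norm_sq ℝ)))

lemma Pk_nonneg (y : 𝔼 n) : 0 ≤ Pk y := expNegInvGlue.nonneg _
lemma rk_nonneg (y : 𝔼 n) : 0 ≤ rk y := mul_nonneg (by norm_num) (expNegInvGlue.monotone.deriv_nonneg)

lemma Pk_zero {y : 𝔼 n} (h : 1 ≤ ‖y‖) : Pk y = 0 := expNegInvGlue.zero_of_nonpos (by nlinarith)

lemma glue_d0 {s : ℝ} (hs : s ≤ 0) : deriv expNegInvGlue s = 0 := by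
  have h1 : ∀ s ∈ Iio (0:ℝ), deriv expNegInvGlue s = 0 := by
    intro s hs
    have : expNegInvGlue =ᶠ[𝓝 s] fun _ => 0 := by
      filter_upwards [Iio_mem_nhds hs] with y hy using expNegInvGlue.zero_of_nonpos (le_of_lt hy)
    rw [this.deriv_eq]; simp
  have hc : Continuous (deriv expNegInvGlue) := (contDiff_infty_iff_deriv.1 glue_cd).2.continuous
  have : s ∈ closure (Iio (0:ℝ)) := by rw [closure_Iio]; exact hs
  exact (isClosed_eq hc continuous_const).closure_subset_iff.2 h1 this

lemma rk_zero {y : 𝔼 n} (h : 1 ≤ ‖y‖) : rk y = 0 := by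
  unfold rk; rw [glue_d0 (by nlinarith)]; simp

lemma Pk_fderiv (y v : 𝔼 n) : fderiv ℝ Pk y v = - rk y * ⟪y, v⟫ := by
  have h1 : HasFDerivAt (fun y : 𝔼 n => 1 - ‖y‖ ^ 2) (-(2 • (innerSL ℝ y))) y :=
    (hasStrictFDerivAt_norm_sq y).hasFDerivAt.const_sub 1
  have h2 : HasDerivAt expNegInvGlue (deriv expNegInvGlue (1 - ‖y‖ ^ 2)) (1 - ‖y‖ ^ 2) :=
    (glue_cd.differentiable (by simp) _).hasDerivAt
  have h3 := h2.comp_hasFDerivAt y h1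
  have : fderiv ℝ Pk y = _ := h3.fderiv
  rw [this]; simp [rk]; ring

lemma Pk_lap (y : 𝔼 n) : lap Pk y = - (n * rk y + fderiv ℝ rk y y) := by
  rw [lap_eq]
  have h1 : ContDiff ℝ ∞ (fderiv ℝ (Pk (n := n))) := Pk_cd.fderiv_right (by simp)
  have h2 : ∀ v : 𝔼 n, fderiv ℝ (fderiv ℝ Pk) y v v = fderiv ℝ (fun y => - rk y * ⟪y, v⟫) y v := by
    intro v
    have : (fun y => - rk y * ⟪y, v⟫) = fun y => fderiv ℝ Pk y v := by ext y; rw [Pk_fderiv]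
    rw [this, fderiv_clm_apply (h1.differentiable (by simp) y) (differentiableAt_const v)]
    simp
  have h3 : ∀ i : Fin n, fderiv ℝ (fderiv ℝ Pk) y (eb i) (eb i) = - rk y - fderiv ℝ rk y (y i • eb i) := by
    intro i
    rw [h2]
    have d1 : HasFDerivAt (fun y : 𝔼 n => - rk y) (- fderiv ℝ rk y) y :=
      (rk_cd.differentiable (by simp) y).hasFDerivAt.neg
    have d2 : HasFDerivAt (fun y : 𝔼 n => ⟪y, eb i⟫) ((innerSL ℝ (eb i) : (𝔼 n) →L[ℝ] ℝ)) y := by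
      have := (innerSL ℝ (eb i) : (𝔼 n) →L[ℝ] ℝ).hasFDerivAt (x := y)
      refine this.congr_of_eventuallyEq (Eventually.of_forall fun z => ?_)
      simp [real_inner_comm]
    have d3 : HasFDerivAt (fun y : 𝔼 n => - rk y * ⟪y, eb i⟫) _ y := d1.mul d2
    rw [d3.fderiv]
    have hin : ⟪y, EuclideanSpace.single i (1:ℝ)⟫ = y i := by
      rw [EuclideanSpace.inner_single_right]; simp
    simp [eb, hin]; ring
  rw [Finset.sum_congr rfl fun i _ => h3 i, Finset.sum_sub_distrib, ← map_sum, eb_sum]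
  simp; ring

lemma ball_tsupp {f : (𝔼 n) → ℝ} (hf : ∀ y, 1 ≤ ‖y‖ → f y = 0) {t : ℝ} (ht : 0 < t) (x : 𝔼 n) :
    tsupport (fun z => f (t • (z - x))) ⊆ closedBall x t⁻¹ := by
  refine closure_minimal ?_ isClosed_closedBall
  intro z hz
  by_contra h
  refine hz (hf _ ?_)
  rw [mem_closedBall, dist_eq_norm, not_le, inv_lt_iff_one_lt_mul₀ ht] at h
  rw [norm_smul, Real.norm_of_nonneg ht.le, mul_comm]; exact h.le

lemma TF_ker {f : (𝔼 n) → ℝ} (hcd : ContDiff ℝ ∞ f) (hf : ∀ y, 1 ≤ ‖y‖ → f y = 0) {t : ℝ} (ht : 0 < t) {x : 𝔼 n}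
    {W : Set (𝔼 n)} (hW : closedBall x t⁻¹ ⊆ W) : TF W (fun z => f (t • (z - x))) := by
  have h := ball_tsupp hf ht x
  exact ⟨hcd.comp (by fun_prop),
    HasCompactSupport.of_support_subset_isCompact (isCompact_closedBall x t⁻¹) ((subset_tsupport _).trans h), h.trans hW⟩

lemma lap_scale {f : (𝔼 n) → ℝ} (hcd : ContDiff ℝ ∞ f) (t : ℝ) (x z : 𝔼 n) :
    lap (fun z => f (t • (z - x))) z = t ^ 2 * lap f (t • (z - x)) := by
  have h1 : ContDiff ℝ ∞ (fderiv ℝ f) := hcd.fderiv_right (by simp)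
  have ha : ∀ z, HasFDerivAt (fun z : 𝔼 n => t • (z - x)) (t • ContinuousLinearMap.id ℝ (𝔼 n)) z := fun z =>
    ((hasFDerivAt_id z).sub_const x).const_smul t
  have e1 : fderiv ℝ (fun z => f (t • (z - x))) = fun z => t • fderiv ℝ f (t • (z - x)) := by
    ext z v
    have := ((hcd.differentiable (by simp) (t • (z - x))).hasFDerivAt.comp z (ha z)).fderiv
    change fderiv ℝ (f ∘ fun z => t • (z - x)) z v = _
    rw [this]; simp
  rw [lap_eq, lap_eq, e1, Finset.mul_sum]
  refine Finset.sum_congr rfl fun i _ => ?_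
  have := (((h1.differentiable (by simp) (t • (z - x))).hasFDerivAt.comp z (ha z)).const_smul t).fderiv
  change fderiv ℝ (t • ((fderiv ℝ f) ∘ fun z => t • (z - x))) z (eb i) (eb i) = _
  rw [this]; simp; ring

lemma cs_ball {f : (𝔼 n) → ℝ} (hf : ∀ y, 1 ≤ ‖y‖ → f y = 0) : HasCompactSupport f := by
  refine HasCompactSupport.of_support_subset_isCompact (isCompact_closedBall 0 1) ?_
  intro z hz
  by_contra h
  refine hz (hf _ ?_)
  rw [mem_closedBall_zero_iff, not_le] at h
  exact h.le

lemma bdd_ball {f : (𝔼 n) → ℝ} (hc : Continuous f) (hf : ∀ y, 1 ≤ ‖y‖ → f y = 0) : ∃ M, 0 ≤ M ∧ ∀ y, |f y| ≤ M := by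
  obtain ⟨M, hM⟩ := hc.bounded_above_of_compact_support (cs_ball hf)
  exact ⟨M, (norm_nonneg _).trans (hM 0), hM⟩

lemma Pk_TF : TF univ (Pk (n := n)) := ⟨Pk_cd, cs_ball fun _ => Pk_zero, subset_univ _⟩

lemma lapPk_cd : ContDiff ℝ ∞ (lap (Pk (n := n))) := Pk_TF.lp.1

lemma lapPk_zero {y : 𝔼 n} (h : 1 ≤ ‖y‖) : lap Pk y = 0 := by
  have hcl : ∀ z : 𝔼 n, 1 < ‖z‖ → lap Pk z = 0 := fun z hz => lap_eq_zero fun h => by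
    have := closure_minimal (s := Function.support (Pk (n := n))) (t := closedBall 0 1) (fun w hw => by
      by_contra h'
      rw [mem_closedBall_zero_iff, not_le] at h'
      exact hw (Pk_zero h'.le)) isClosed_closedBall h
    rw [mem_closedBall_zero_iff] at this; linarith
  rcases h.lt_or_eq with h | h
  · exact hcl y h
  · have : Tendsto (fun s : ℝ => lap Pk (s • y)) (𝓝[>] 1) (𝓝 (lap Pk ((1:ℝ) • y))) :=
      ((lapPk_cd.continuous.comp (continuous_id.smul continuous_const)).tendsto (1:ℝ)).mono_left nhdsWithin_le_nhds
    rw [one_smul] at this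
    refine tendsto_nhds_unique this (tendsto_const_nhds.congr' ?_)
    filter_upwards [self_mem_nhdsWithin] with s hs
    rw [hcl]
    rw [norm_smul, ← h, mul_one]
    exact lt_of_lt_of_le hs (le_abs_self _)

/-- averages -/
def Av (U : (𝔼 n) → ℝ) (t : ℝ) (x : 𝔼 n) : ℝ := ∫ z, (t ^ n * rk (t • (z - x))) * U z

/-- local integrability away from 0 -/
def LI (U : (𝔼 n) → ℝ) : Prop :=
  ∀ W : (𝔼 n) → ℝ, Continuous W → HasCompactSupport W → tsupport W ⊆ {0}ᶜ → Integrable (fun x => W x * U x)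

lemma ball_off {x : 𝔼 n} {r : ℝ} (h : r < ‖x‖) : closedBall x r ⊆ {0}ᶜ := by
  intro z hz h0
  rw [mem_singleton_iff] at h0
  subst h0
  rw [mem_closedBall, dist_zero_left] at hz
  linarith

lemma LI.dom (hU : LI U) {x : 𝔼 n} {r : ℝ} (hr : 0 < r) (h : r < ‖x‖) :
    ∃ b : (𝔼 n) → ℝ, Integrable (fun z => b z * |U z|) ∧ (∀ z, 0 ≤ b z) ∧ ∀ z, ‖z - x‖ ≤ r → b z = 1 := by
  let b : ContDiffBump x := ⟨r, (r + ‖x‖) / 2, hr, by linarith⟩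
  have h1 := (hU b b.continuous b.hasCompactSupport (by
    rw [b.tsupport_eq]; exact ball_off (by change (r + ‖x‖) / 2 < ‖x‖; linarith))).norm
  refine ⟨b, h1.congr (ae_of_all _ fun z => ?_), fun z => b.nonneg, fun z hz => b.one_of_mem_closedBall ?_⟩
  · simp [abs_of_nonneg b.nonneg]
  · rw [mem_closedBall, dist_eq_norm]; exact hz

lemma Av_deriv (hn : 1 ≤ n) (hU : LI U) {x : 𝔼 n} {t : ℝ} (ht0 : 0 < t) (ht : t⁻¹ < ‖x‖) :
    HasDerivAt (fun t => Av U t x) (-(t ^ (n - 1) / t ^ 2) * ∫ z, lap (fun z => Pk (t • (z - x))) z * U z) t := by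
  have hx : 0 < ‖x‖ := (inv_pos.2 ht0).trans ht
  have ht' : ‖x‖⁻¹ < t := by rw [inv_lt_comm₀ hx ht0]; exact ht
  obtain ⟨t0, h1, h2⟩ := exists_between ht'
  have ht00 : 0 < t0 := (inv_pos.2 hx).trans h1
  have h1' : t0⁻¹ < ‖x‖ := by rw [inv_lt_comm₀ ht00 hx]; exact h1
  obtain ⟨b, hb1, hb0, hb2⟩ := hU.dom (inv_pos.2 ht00) h1'
  obtain ⟨M, hM0, hM⟩ := bdd_ball (lapPk_cd (n := n)).continuous fun _ => lapPk_zero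
  have hker : ∀ s, t0 < s → Integrable (fun z => (s ^ n * rk (s • (z - x))) * U z) := by
    intro s hs
    have hT := TF_ker (W := {0}ᶜ) rk_cd (fun _ => rk_zero) (ht00.trans hs)
      (ball_off (x := x) (((inv_lt_inv₀ (ht00.trans hs) ht00).2 hs).trans h1'))
    exact hU _ (hT.cmul (s ^ n)).1.continuous (hT.cmul (s ^ n)).2.1 (hT.cmul (s ^ n)).2.2
  have hder : ∀ z : 𝔼 n, ∀ s, HasDerivAt (fun s : ℝ => (s ^ n * rk (s • (z - x))) * U z)
      ((-s ^ (n - 1) * lap Pk (s • (z - x))) * U z) s := by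
    intro z s
    refine HasDerivAt.mul_const ?_ _
    have d1 : HasDerivAt (fun s : ℝ => s • (z - x)) (z - x) s := by
      simpa using (hasDerivAt_id s).smul_const (z - x)
    have d2 := (rk_cd.differentiable (by simp) (s • (z - x))).hasFDerivAt.comp_hasDerivAt s d1
    have d3 := (hasDerivAt_pow n s).mul d2
    have d4 : HasDerivAt (fun s : ℝ => s ^ n * rk (s • (z - x))) (n * s ^ (n - 1) * rk (s • (z - x)) +
      s ^ n * fderiv ℝ rk (s • (z - x)) (z - x)) s := d3
    have e : -s ^ (n - 1) * lap Pk (s • (z - x)) = n * s ^ (n - 1) * rk (s • (z - x)) +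
      s ^ n * fderiv ℝ rk (s • (z - x)) (z - x) := by
     rw [Pk_lap, map_smul]
     have hp : s ^ n = s ^ (n - 1) * s := by rw [← pow_succ]; congr 1; omega
     rw [hp, smul_eq_mul]; ring
    rw [e]; exact d4
  have key := hasDerivAt_integral_of_dominated_loc_of_deriv_le (μ := volume)
    (F := fun s z => (s ^ n * rk (s • (z - x))) * U z)
    (F' := fun s z => (-s ^ (n - 1) * lap Pk (s • (z - x))) * U z) (x₀ := t) (s := Ioo t0 (t + 1))
    (bound := fun z => ((t + 1) ^ (n - 1) * M) * (b z * |U z|)) (Ioo_mem_nhds h2 (by linarith)) ?_ (hker t h2) ?_ ?_ ?_ ?_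
  · have e : (-(t ^ (n - 1) / t ^ 2) * ∫ z, lap (fun z => Pk (t • (z - x))) z * U z) =
        ∫ z, (-t ^ (n - 1) * lap Pk (t • (z - x))) * U z := by
      rw [← integral_const_mul]
      congr; ext z
      rw [lap_scale Pk_cd]; field_simp
    rw [e]; exact key.2
  · filter_upwards [Ioi_mem_nhds h2] with s hs using (hker s hs).1
  · have hT := (TF_ker (W := {0}ᶜ) Pk_cd (fun _ => Pk_zero) ht0 (ball_off (x := x) ht)).lp
    have := (hU _ hT.1.continuous hT.2.1 hT.2.2).const_mul (-(t ^ (n - 1) / t ^ 2))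
    refine this.1.congr (ae_of_all _ fun z => ?_)
    simp only
    rw [lap_scale Pk_cd]; field_simp
  · refine ae_of_all _ fun z s hs => ?_
    have hs0 : 0 < s := ht00.trans hs.1
    by_cases hz : ‖z - x‖ ≤ t0⁻¹
    · rw [hb2 z hz, norm_mul, norm_mul, norm_neg, one_mul, norm_pow, Real.norm_eq_abs, Real.norm_eq_abs, Real.norm_eq_abs,
        abs_of_pos hs0]
      have := hM (s • (z - x))
      have h5 := hs.2.le
      gcongr
    · have : 1 ≤ ‖s • (z - x)‖ := by
        rw [norm_smul, Real.norm_of_nonneg hs0.le]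
        rw [not_le, inv_lt_iff_one_lt_mul₀ ht00] at hz
        nlinarith [hs.1, norm_nonneg (z - x)]
      rw [lapPk_zero this]
      simp only [mul_zero, zero_mul, norm_zero]
      exact mul_nonneg (by positivity) (mul_nonneg (hb0 z) (abs_nonneg _))
  · exact hb1.const_mul _
  · exact ae_of_all _ fun z s _ => hder z s

end P12

section P13
variable {U : (𝔼 n) → ℝ} {C : Set (𝔼 n)} {a : ℝ}

lemma LI.abs (hU : LI U) : LI (fun x => |U x|) := by
  have h : ∀ W : (𝔼 n) → ℝ, Continuous W → HasCompactSupport W → tsupport W ⊆ {0}ᶜ →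
      Integrable (fun x => |W x| * |U x|) := fun W h1 h2 h3 => by
    refine (hU W h1 h2 h3).norm.congr (ae_of_all _ fun x => ?_)
    simp
  intro W h1 h2 h3
  have hs : ∀ g : ℝ → ℝ, g 0 = 0 → Function.support (fun x => g (W x)) ⊆ Function.support W := by
    intro g hg x hx hx'
    exact hx (by simp [hx', hg])
  have hp := h (fun x => max (W x) 0) (by fun_prop) (h2.mono (hs (fun s => max s 0) (by simp)))
    ((closure_mono (hs (fun s => max s 0) (by simp))).trans h3)
  have hm := h (fun x => max (-W x) 0) (by fun_prop) (h2.mono (hs (fun s => max (-s) 0) (by simp)))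
    ((closure_mono (hs (fun s => max (-s) 0) (by simp))).trans h3)
  refine (hp.sub hm).congr (ae_of_all _ fun x => ?_)
  simp only [Pi.sub_apply]
  rw [abs_of_nonneg (le_max_right (W x) 0), abs_of_nonneg (le_max_right (-W x) 0), ← sub_mul]
  congr 1
  rcases le_total (W x) 0 with h | h
  · rw [max_eq_right h, max_eq_left (by linarith)]; ring
  · rw [max_eq_left h, max_eq_right (by linarith)]; ring

lemma Av_anti (hn : 1 ≤ n) (hU : WH C a U) {x : 𝔼 n} (hx : x ≠ 0) :
    AntitoneOn (fun t => Av (fun x => |U x|) t x) (Ioi ‖x‖⁻¹) := by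
  have hx : 0 < ‖x‖ := by simpa using hx
  have hU' : LI U := hU.int
  have hd : ∀ t ∈ Ioi ‖x‖⁻¹, 0 < t ∧ t⁻¹ < ‖x‖ := by
    intro t ht
    have h0 : 0 < t := (inv_pos.2 hx).trans ht
    exact ⟨h0, by rw [inv_lt_comm₀ h0 hx]; exact ht⟩
  refine antitoneOn_of_deriv_nonpos (convex_Ioi _) (fun t ht => ?_) (fun t ht => ?_) fun t ht => ?_
  · exact (Av_deriv hn hU'.abs (hd t ht).1 (hd t ht).2).continuousAt.continuousWithinAt
  · rw [interior_Ioi] at ht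
    exact (Av_deriv hn hU'.abs (hd t ht).1 (hd t ht).2).differentiableAt.differentiableWithinAt
  · rw [interior_Ioi] at ht
    obtain ⟨h0, h1⟩ := hd t ht
    rw [(Av_deriv hn hU'.abs h0 h1).deriv]
    have := hU.sub _ (TF_ker Pk_cd (fun _ => Pk_zero) h0 (ball_off h1)) fun z => Pk_nonneg _
    have h2 : 0 ≤ t ^ (n - 1) / t ^ 2 := by positivity
    nlinarith [mul_nonneg h2 this]

lemma ball_lt {x : 𝔼 n} {r : ℝ} (h : closedBall x r ⊆ {0}ᶜ) : r < ‖x‖ := by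
  by_contra h'
  refine h (show (0 : 𝔼 n) ∈ closedBall x r from ?_) rfl
  rw [mem_closedBall, dist_zero_left]; linarith

lemma Av_const (hn : 1 ≤ n) (hC : IsCone C) (hU : WH C a U) {x : 𝔼 n} {r : ℝ} (hr : 0 < r) (hb : closedBall x r ⊆ C)
    {t : ℝ} (ht : r⁻¹ ≤ t) : Av U t x = Av U r⁻¹ x := by
  have hU' : LI U := hU.int
  have hrx := ball_lt (hb.trans hC.ne)
  have hd : ∀ t ∈ Ici r⁻¹, 0 < t ∧ t⁻¹ < ‖x‖ := by
    intro t ht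
    have h0 : 0 < t := lt_of_lt_of_le (inv_pos.2 hr) ht
    exact ⟨h0, lt_of_le_of_lt (inv_le_of_inv_le₀ hr ht) hrx⟩
  have hz : ∀ t ∈ Ici r⁻¹, HasDerivAt (fun t => Av U t x) 0 t := by
    intro t ht
    obtain ⟨h0, h1⟩ := hd t ht
    have h2 := Av_deriv hn hU' h0 h1
    rw [hU.harm _ (TF_ker Pk_cd (fun _ => Pk_zero) h0 ((closedBall_subset_closedBall
      (inv_le_of_inv_le₀ hr ht)).trans hb)) fun z => Pk_nonneg _, mul_zero] at h2
    exact h2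
  have m1 : AntitoneOn (fun t => Av U t x) (Ici r⁻¹) := by
    refine antitoneOn_of_deriv_nonpos (convex_Ici _) (fun t ht => (hz t ht).continuousAt.continuousWithinAt)
      (fun t ht => (hz t (interior_subset ht)).differentiableAt.differentiableWithinAt) fun t ht => ?_
    rw [(hz t (interior_subset ht)).deriv]
  have m2 : MonotoneOn (fun t => Av U t x) (Ici r⁻¹) := by
    refine monotoneOn_of_deriv_nonneg (convex_Ici _) (fun t ht => (hz t ht).continuousAt.continuousWithinAt)
      (fun t ht => (hz t (interior_subset ht)).differentiableAt.differentiableWithinAt) fun t ht => ?_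
    rw [(hz t (interior_subset ht)).deriv]
  exact le_antisymm (m1 self_mem_Ici ht ht) (m2 self_mem_Ici ht ht)

/-- mass of the kernel -/
def m0 (n : ℕ) : ℝ := ∫ y : 𝔼 n, rk y

lemma rk_int : Integrable (rk (n := n)) :=
  rk_cd.continuous.integrable_of_hasCompactSupport (cs_ball fun _ => rk_zero)

lemma rk_pos_pt (hn : 1 ≤ n) : ∃ y : 𝔼 n, 0 < rk y := by
  obtain ⟨c, hc, h⟩ := exists_deriv_eq_slope expNegInvGlue (zero_lt_one' ℝ) glue_cd.continuous.continuousOn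
    (glue_cd.differentiable (by simp)).differentiableOn
  refine ⟨Real.sqrt (1 - c) • eb ⟨0, by omega⟩, ?_⟩
  have : ‖Real.sqrt (1 - c) • (eb ⟨0, by omega⟩ : 𝔼 n)‖ ^ 2 = 1 - c := by
    rw [norm_smul, mul_pow, Real.norm_eq_abs, sq_abs, Real.sq_sqrt (by linarith [hc.2])]
    simp [eb]
  unfold rk
  rw [this, sub_sub_cancel, h]
  have := expNegInvGlue.pos_of_pos zero_lt_one
  simp [expNegInvGlue.zero, this]

lemma m0_pos (hn : 1 ≤ n) : 0 < m0 n := by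
  obtain ⟨y, hy⟩ := rk_pos_pt hn
  exact rk_cd.continuous.integral_pos_of_hasCompactSupport_nonneg_nonzero (cs_ball fun _ => rk_zero)
    rk_nonneg hy.ne'

lemma ker_mass {t : ℝ} (ht : 0 < t) (x : 𝔼 n) : ∫ z, t ^ n * rk (t • (z - x)) = m0 n := by
  rw [integral_sub_right_eq_self (fun z => t ^ n * rk (t • z)) x, integral_const_mul,
    Measure.integral_comp_smul volume rk t, m0]
  simp only [finrank_euclideanSpace, Fintype.card_fin, smul_eq_mul]
  rw [abs_of_pos (by positivity)]
  field_simp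

lemma Av_hom (hU : WH C a U) {t s : ℝ} (hs : 0 < s) (x : 𝔼 n) : Av U t (s • x) = s ^ a * Av U (t * s) x := by
  unfold Av
  have h := Measure.integral_comp_smul volume (fun z : 𝔼 n => (t ^ n * rk (t • (z - s • x))) * U z) s
  simp only [finrank_euclideanSpace, Fintype.card_fin, smul_eq_mul] at h
  rw [abs_of_pos (by positivity), inv_mul_eq_div, eq_div_iff (by positivity)] at h
  rw [← h, ← integral_mul_const, ← integral_const_mul]
  congr; ext z
  rw [hU.hom s hs, ← smul_sub, smul_smul, mul_pow]; ring

lemma Av_leb {g : (𝔼 n) → ℝ} (hg : Integrable g) :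
    ∀ᵐ x, Tendsto (fun t => Av g t x) atTop (𝓝 (m0 n * g x)) := by
  filter_upwards [IsUnifLocDoublingMeasure.ae_tendsto_average_norm_sub volume hg.locallyIntegrable 1] with x hx
  have h1 := hx (l := atTop) (fun _ : ℝ => x) (fun t : ℝ => t⁻¹)
    (tendsto_inv_atTop_nhdsGT_zero) (by
      filter_upwards [eventually_gt_atTop 0] with t ht
      rw [mem_closedBall, dist_self]; positivity)
  obtain ⟨M, hM0, hM⟩ := bdd_ball (rk_cd (n := n)).continuous fun _ => rk_zero
  rw [tendsto_iff_norm_sub_tendsto_zero]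
  have h2 := h1.const_mul (M * volume.real (closedBall (0 : 𝔼 n) 1))
  rw [mul_zero] at h2
  refine squeeze_zero' (Eventually.of_forall fun t => norm_nonneg _) ?_ h2
  filter_upwards [eventually_gt_atTop 0] with t ht
  have hv : 0 < volume.real (closedBall (0 : 𝔼 n) 1) :=
    ENNReal.toReal_pos (measure_closedBall_pos _ _ one_pos).ne' measure_closedBall_lt_top.ne
  rw [setAverage_eq, Measure.addHaar_real_closedBall' volume x (inv_nonneg.2 ht.le), finrank_euclideanSpace, Fintype.card_fin,
    smul_eq_mul]
  have hK : Integrable (fun z => t ^ n * rk (t • (z - x))) := by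
    have := (TF_ker (W := univ) (rk_cd (n := n)) (fun _ => rk_zero) ht (subset_univ (closedBall x t⁻¹))).cmul (t ^ n)
    exact this.int
  have hKg : Integrable (fun z => (t ^ n * rk (t • (z - x))) * g z) := by
    refine (hg.norm.const_mul (t ^ n * M)).mono' (hK.1.mul hg.1) (ae_of_all _ fun z => ?_)
    rw [norm_mul, norm_mul, Real.norm_eq_abs, Real.norm_eq_abs, abs_of_pos (by positivity : 0 < t ^ n)]
    have := hM (t • (z - x))
    gcongr
  have e1 : Av g t x - m0 n * g x = ∫ z, (t ^ n * rk (t • (z - x))) * (g z - g x) := by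
    rw [← ker_mass ht x, ← integral_mul_const]
    unfold Av
    rw [← integral_sub hKg (hK.mul_const _)]
    congr; ext z; ring
  have e2 : ∫ z, (t ^ n * rk (t • (z - x))) * (g z - g x) =
      ∫ z in closedBall x t⁻¹, (t ^ n * rk (t • (z - x))) * (g z - g x) := by
    rw [setIntegral_eq_integral_of_forall_compl_eq_zero]
    intro z hz
    have := ball_tsupp (fun _ => rk_zero) ht x
    have h3 : z ∉ tsupport (fun z => rk (t • (z - x))) := fun h => hz (this h)
    simp [image_eq_zero_of_notMem_tsupport h3]
  rw [e1, e2]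
  have hi : IntegrableOn (fun z => ‖g z - g x‖) (closedBall x t⁻¹) :=
    (hg.integrableOn.sub (integrableOn_const measure_closedBall_lt_top.ne)).norm
  refine (norm_integral_le_of_norm_le (hi.const_mul (t ^ n * M)) (ae_of_all _ fun z => ?_)).trans (le_of_eq ?_)
  · rw [norm_mul, norm_mul, Real.norm_eq_abs, Real.norm_eq_abs (rk _), abs_of_pos (by positivity : 0 < t ^ n)]
    have := hM (t • (z - x))
    gcongr
  · rw [integral_const_mul, inv_pow]
    generalize (∫ z in closedBall x t⁻¹, ‖g z - g x‖) = I
    field_simp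

lemma Av_loc {x : 𝔼 n} {t : ℝ} (ht : 0 < t) {f g : (𝔼 n) → ℝ} (h : ∀ z, ‖z - x‖ ≤ t⁻¹ → f z = g z) :
    Av f t x = Av g t x := by
  unfold Av
  congr; ext z
  by_cases hz : ‖z - x‖ ≤ t⁻¹
  · rw [h z hz]
  · rw [rk_zero]; · simp
    rw [norm_smul, Real.norm_of_nonneg ht.le]
    rw [not_le, inv_lt_iff_one_lt_mul₀ ht] at hz
    linarith

lemma Av_lim (hn : 1 ≤ n) (hU : LI U) : ∀ᵐ x, Tendsto (fun t => Av U t x) atTop (𝓝 (m0 n * U x)) := by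
  let W : ℕ → (𝔼 n) → ℝ := fun N x => max 0 (min 1 (N * ‖x‖ - 1)) * max 0 (min 1 (N - ‖x‖))
  have hWs : ∀ N, Function.support (W N) ⊆ {x | 1 ≤ N * ‖x‖ ∧ ‖x‖ ≤ N} := by
    intro N x hx
    constructor
    · by_contra h
      refine hx ?_
      have : max 0 (min 1 (N * ‖x‖ - 1)) = 0 := max_eq_left ((min_le_right _ _).trans (by push Not at h; linarith))
      simp only [W, this, zero_mul]
    · by_contra h
      refine hx ?_
      have : max 0 (min 1 (N - ‖x‖)) = 0 := max_eq_left ((min_le_right _ _).trans (by push Not at h; linarith))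
      simp only [W, this, mul_zero]
  have hcl : ∀ N : ℕ, IsClosed {x : 𝔼 n | 1 ≤ N * ‖x‖ ∧ ‖x‖ ≤ N} := fun N =>
    IsClosed.and (isClosed_le continuous_const (continuous_const.mul continuous_norm))
      (isClosed_le continuous_norm continuous_const)
  have hg : ∀ N, Integrable (fun x => W N x * U x) := by
    intro N
    refine hU (W N) (by fun_prop) (HasCompactSupport.of_support_subset_isCompact (isCompact_closedBall 0 N) ?_)
      ((closure_minimal (hWs N) (hcl N)).trans ?_)
    · intro x hx
      rw [mem_closedBall_zero_iff]; exact (hWs N hx).2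
    · intro x hx h0
      rw [mem_singleton_iff] at h0
      subst h0
      have := hx.1
      simp at this
      linarith
  have : Nontrivial (𝔼 n) := by
    have : Nonempty (Fin n) := ⟨⟨0, by omega⟩⟩
    infer_instance
  have h0 : ∀ᵐ x : 𝔼 n, x ≠ 0 := by simp [ae_iff]
  filter_upwards [h0, ae_all_iff.2 fun N => Av_leb (hg N)] with x hx0 hx
  have hp : 0 < ‖x‖ := by simpa using hx0
  obtain ⟨N, hN⟩ := exists_nat_gt (max (4 / ‖x‖) (2 * ‖x‖ + 1))
  have hN1 : 4 < N * ‖x‖ := by rw [← div_lt_iff₀ hp]; exact (le_max_left _ _).trans_lt hN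
  have hN2 : 2 * ‖x‖ + 1 < N := (le_max_right _ _).trans_lt hN
  have hW1 : ∀ z, ‖z - x‖ ≤ ‖x‖ / 2 → W N z = 1 := by
    intro z hz
    have l1 : ‖x‖ / 2 ≤ ‖z‖ := by
      have := norm_sub_norm_le x z
      rw [norm_sub_rev] at this; linarith
    have l2 : ‖z‖ ≤ 2 * ‖x‖ := by
      have := norm_sub_norm_le z x
      linarith
    have l3 : 1 ≤ N * ‖z‖ - 1 := by nlinarith
    have l4 : 1 ≤ N - ‖z‖ := by linarith
    simp [W, min_eq_left l3, min_eq_left l4]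
  have h1 := hx N
  rw [hW1 x (by rw [sub_self, norm_zero]; positivity), one_mul] at h1
  refine h1.congr' ?_
  filter_upwards [eventually_gt_atTop (2 / ‖x‖)] with t ht
  have ht0 : 0 < t := lt_trans (by positivity) ht
  refine Av_loc ht0 fun z hz => ?_
  rw [hW1 z, one_mul]
  refine hz.trans ?_
  rw [inv_le_comm₀ ht0 (by positivity), inv_div]; exact ht.le

end P13

section P14
variable {U : (𝔼 n) → ℝ} {C : Set (𝔼 n)} {a : ℝ}

/-- the regular representative -/
def Fv (U : (𝔼 n) → ℝ) (x : 𝔼 n) : ℝ := limUnder atTop (fun t => Av U t x) / m0 n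

lemma Fv_tendsto (hn : 1 ≤ n) (hC : IsCone C) (hU : WH C a U) {x : 𝔼 n} {r : ℝ} (hr : 0 < r) (hb : closedBall x r ⊆ C) :
    Tendsto (fun t => Av U t x) atTop (𝓝 (Av U r⁻¹ x)) := by
  refine tendsto_const_nhds.congr' ?_
  filter_upwards [eventually_ge_atTop r⁻¹] with t ht
  exact (Av_const hn hC hU hr hb ht).symm

lemma Fv_eq (hn : 1 ≤ n) (hC : IsCone C) (hU : WH C a U) {x : 𝔼 n} {r : ℝ} (hr : 0 < r) (hb : closedBall x r ⊆ C) :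
    Fv U x = Av U r⁻¹ x / m0 n := by
  unfold Fv; rw [(Fv_tendsto hn hC hU hr hb).limUnder_eq]

lemma ball_in (hC : IsCone C) {x : 𝔼 n} (hx : x ∈ C) : ∃ r > 0, closedBall x r ⊆ C :=
  Metric.nhds_basis_closedBall.mem_iff.1 (hC.op.mem_nhds hx)

lemma Fv_lim (hn : 1 ≤ n) (hC : IsCone C) (hU : WH C a U) {x : 𝔼 n} (hx : x ∈ C) :
    Tendsto (fun t => Av U t x) atTop (𝓝 (m0 n * Fv U x)) := by
  obtain ⟨r, hr, hb⟩ := ball_in hC hx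
  rw [Fv_eq hn hC hU hr hb, mul_div_cancel₀ _ (m0_pos hn).ne']
  exact Fv_tendsto hn hC hU hr hb

lemma Fv_ae (hn : 1 ≤ n) (hC : IsCone C) (hU : WH C a U) : ∀ᵐ x, x ∈ C → Fv U x = U x := by
  filter_upwards [Av_lim hn hU.int] with x hx hxC
  have := tendsto_nhds_unique hx (Fv_lim hn hC hU hxC)
  exact (mul_left_cancel₀ (m0_pos hn).ne' this).symm

lemma Fv_hom (hn : 1 ≤ n) (hC : IsCone C) (hU : WH C a U) {x : 𝔼 n} (hx : x ∈ C) {s : ℝ} (hs : 0 < s) :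
    Fv U (s • x) = s ^ a * Fv U x := by
  have h1 := Fv_lim hn hC hU ((hC.dil_iff hs).2 hx)
  simp only [Av_hom hU hs] at h1
  have h2 := ((Fv_lim hn hC hU hx).comp (tendsto_id.atTop_mul_const hs)).const_mul (s ^ a)
  have := tendsto_nhds_unique h1 h2
  have h3 := (m0_pos hn).ne'
  refine mul_left_cancel₀ h3 ?_
  rw [this]; ring

lemma Fv_ne (hn : 1 ≤ n) (hC : IsCone C) (hU : WH C a U) : ∃ x ∈ C, Fv U x ≠ 0 := by
  by_contra! h
  refine hU.ne ?_
  filter_upwards [Fv_ae hn hC hU] with x hx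
  by_cases hxC : x ∈ C
  · rw [← hx hxC, h x hxC]; rfl
  · exact hU.off x hxC

open scoped Convolution in
lemma lap_conv {g κ : (𝔼 n) → ℝ} (hg : LocallyIntegrable g) (hκ : TF univ κ) (x : 𝔼 n) :
    lap (g ⋆[ContinuousLinearMap.mul ℝ ℝ, volume] κ) x = ∫ z, g z * lap κ (x - z) := by
  have hd : ∀ κ : (𝔼 n) → ℝ, TF univ κ → ∀ v : 𝔼 n, (fun x => fderiv ℝ (g ⋆[ContinuousLinearMap.mul ℝ ℝ, volume] κ) x v) =
      (g ⋆[ContinuousLinearMap.mul ℝ ℝ, volume] (fun a => fderiv ℝ κ a v)) := by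
    intro κ hκ v
    ext x
    have h1 : ContDiff ℝ 1 κ := hκ.1.of_le (by simp)
    rw [(hκ.2.1.hasFDerivAt_convolution_right (ContinuousLinearMap.mul ℝ ℝ) hg h1 x).fderiv]
    exact convolution_precompR_apply (ContinuousLinearMap.mul ℝ ℝ) hg (hκ.2.1.fderiv ℝ) (h1.continuous_fderiv one_ne_zero) x v
  have hT : ∀ κ : (𝔼 n) → ℝ, TF univ κ → ∀ v : 𝔼 n, TF univ (fun a => fderiv ℝ κ a v) := fun κ hκ v =>
    ⟨(hκ.1.fderiv_right (m := ∞) (by simp)).clm_apply contDiff_const, hκ.2.1.fderiv_apply ℝ v, subset_univ _⟩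
  have hsec : ∀ f : (𝔼 n) → ℝ, ContDiff ℝ ∞ f → ∀ x v, fderiv ℝ (fderiv ℝ f) x v v = fderiv ℝ (fun y => fderiv ℝ f y v) x v := by
    intro f hf x v
    have h1 : ContDiff ℝ ∞ (fderiv ℝ f) := hf.fderiv_right (by simp)
    rw [fderiv_clm_apply (h1.differentiable (by simp) x) (differentiableAt_const v)]
    simp
  have hcd : ContDiff ℝ ∞ (g ⋆[ContinuousLinearMap.mul ℝ ℝ, volume] κ) :=
    hκ.2.1.contDiff_convolution_right _ hg hκ.1
  have e : ∀ i, fderiv ℝ (fderiv ℝ (g ⋆[ContinuousLinearMap.mul ℝ ℝ, volume] κ)) x (eb i) (eb i) =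
      ∫ z, g z * fderiv ℝ (fun y => fderiv ℝ κ y (eb i)) (x - z) (eb i) := by
    intro i
    rw [hsec _ hcd, hd κ hκ]
    have := congrFun (hd _ (hT κ hκ (eb i)) (eb i)) x
    rw [this]; rfl
  rw [lap_eq, Finset.sum_congr rfl fun i _ => e i, ← integral_finsetSum]
  · congr; ext z
    rw [lap_eq, Finset.mul_sum]
    refine Finset.sum_congr rfl fun i _ => ?_
    rw [hsec κ hκ.1]
  · intro i _
    have := hT _ (hT κ hκ (eb i)) (eb i)
    exact this.2.1.convolutionExists_right (ContinuousLinearMap.mul ℝ ℝ) hg this.1.continuous x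

lemma rk_neg (y : 𝔼 n) : rk (-y) = rk y := by simp [rk]

open scoped Convolution in
lemma Fv_reg (hn : 1 ≤ n) (hC : IsCone C) (hU : WH C a U) {x : 𝔼 n} (hx : x ∈ C) :
    ContDiffAt ℝ ∞ (Fv U) x ∧ lap (Fv U) x = 0 := by
  obtain ⟨R, hR, hb⟩ := ball_in hC hx
  set r := R / 3 with hr
  have hr0 : 0 < r := by positivity
  let b : ContDiffBump x := ⟨2 * r, 3 * r, by positivity, by linarith⟩
  have hbt : tsupport b ⊆ C := by
    rw [b.tsupport_eq]
    refine Subset.trans ?_ hb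
    exact closedBall_subset_closedBall (by change 3 * r ≤ R; linarith)
  have hg : Integrable (fun z => b z * U z) := hU.int b b.continuous b.hasCompactSupport (hbt.trans hC.ne)
  set κ : (𝔼 n) → ℝ := fun y => (r⁻¹) ^ n * rk (r⁻¹ • y) with hκ
  have hκe : ∀ y, κ (-y) = κ y := fun y => by simp only [hκ, smul_neg, rk_neg]
  have hκT : TF univ κ := by
    have := (TF_ker (W := univ) (rk_cd (n := n)) (fun _ => rk_zero) (inv_pos.2 hr0) (x := 0) (subset_univ _)).cmul ((r⁻¹) ^ n)
    simpa only [sub_zero] using this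
  have hin : ∀ y ∈ ball x r, closedBall y r ⊆ closedBall x (2 * r) := by
    intro y hy z hz
    rw [mem_closedBall] at *
    rw [mem_ball] at hy
    have := dist_triangle z y x
    linarith
  have h2R : closedBall x (2 * r) ⊆ C := (closedBall_subset_closedBall (by linarith)).trans hb
  have hb1 : ∀ z ∈ closedBall x (2 * r), b z = 1 := fun z hz => b.one_of_mem_closedBall hz
  have hF : ∀ y ∈ ball x r, Fv U y = (m0 n)⁻¹ * ((fun z => b z * U z) ⋆[ContinuousLinearMap.mul ℝ ℝ, volume] κ) y := by
    intro y hy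
    rw [Fv_eq hn hC hU hr0 ((hin y hy).trans h2R), Av_loc (g := fun z => b z * U z) (inv_pos.2 hr0), div_eq_inv_mul, convolution_def]
    · unfold Av
      congr; ext z
      simp only [ContinuousLinearMap.mul_apply']
      rw [← hκe (y - z), neg_sub, mul_comm]
    · intro z hz
      rw [inv_inv] at hz
      rw [hb1 z (hin y hy (by rw [mem_closedBall, dist_eq_norm]; exact hz)), one_mul]
  have hev : Fv U =ᶠ[𝓝 x] fun y => (m0 n)⁻¹ * ((fun z => b z * U z) ⋆[ContinuousLinearMap.mul ℝ ℝ, volume] κ) y := by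
    filter_upwards [ball_mem_nhds x hr0] with y hy using hF y hy
  have hcd : ContDiff ℝ ∞ ((fun z => b z * U z) ⋆[ContinuousLinearMap.mul ℝ ℝ, volume] κ) :=
    hκT.2.1.contDiff_convolution_right _ hg.locallyIntegrable hκT.1
  constructor
  · exact (contDiff_const.mul hcd).contDiffAt.congr_of_eventuallyEq hev
  · have e1 : lap (Fv U) x = (m0 n)⁻¹ * lap ((fun z => b z * U z) ⋆[ContinuousLinearMap.mul ℝ ℝ, volume] κ) x := by
      have h1 : ContDiff ℝ ∞ (fderiv ℝ ((fun z => b z * U z) ⋆[ContinuousLinearMap.mul ℝ ℝ, volume] κ)) := hcd.fderiv_right (by simp)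
      have h2 : fderiv ℝ (Fv U) =ᶠ[𝓝 x] fun y => (m0 n)⁻¹ • fderiv ℝ ((fun z => b z * U z) ⋆[ContinuousLinearMap.mul ℝ ℝ, volume] κ) y := by
        filter_upwards [hev.fderiv (𝕜 := ℝ)] with y hy
        rw [hy]
        exact fderiv_const_mul (hcd.differentiable (by simp) y) _
      rw [lap_eq, lap_eq, h2.fderiv_eq, Finset.mul_sum]
      refine Finset.sum_congr rfl fun i _ => ?_
      have : fderiv ℝ (fun y => (m0 n)⁻¹ • fderiv ℝ ((fun z => b z * U z) ⋆[ContinuousLinearMap.mul ℝ ℝ, volume] κ) y) x = _ :=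
        fderiv_const_smul (h1.differentiable (by simp) x) (m0 n)⁻¹
      rw [this]; rfl
    have hψ : TF C (fun z => κ (z - x)) := by
      have := (TF_ker (W := C) (rk_cd (n := n)) (fun _ => rk_zero) (inv_pos.2 hr0) (x := x)
        (by rw [inv_inv]; exact (hin x (mem_ball_self hr0)).trans h2R)).cmul ((r⁻¹) ^ n)
      exact this
    have hψb : tsupport (fun z => κ (z - x)) ⊆ closedBall x (2 * r) := by
      have h1 := ball_tsupp (fun _ => rk_zero) (inv_pos.2 hr0) x
      rw [inv_inv] at h1
      refine Subset.trans (closure_mono ?_) (h1.trans (hin x (mem_ball_self hr0)))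
      intro z hz hz'
      refine hz ?_
      simp only [hκ, hz', mul_zero]
    have hs1 : ∀ z, lap (fun z => κ (z - x)) z = lap κ (z - x) := by
      intro z
      have := lap_scale hκT.1 1 x z
      simpa using this
    have hs2 : ∀ z, lap κ (-z) = lap κ z := by
      intro z
      have := lap_scale hκT.1 (-1) 0 z
      simp only [neg_smul, one_smul, sub_zero, hκe] at this
      simpa using this.symm
    rw [e1, lap_conv hg.locallyIntegrable hκT]
    have := hU.harm _ hψ fun z => mul_nonneg (by positivity) (rk_nonneg _)
    have e2 : ∫ z, (b z * U z) * lap κ (x - z) = ∫ z, lap (fun z => κ (z - x)) z * U z := by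
      congr; ext z
      by_cases hz : z ∈ closedBall x (2 * r)
      · rw [hb1 z hz, hs1, ← hs2 (x - z), neg_sub]; ring
      · have h0 : lap (fun z => κ (z - x)) z = 0 := lap_eq_zero fun h => hz (hψb h)
        rw [h0, ← hs2, neg_sub, ← hs1, h0]; ring
    rw [e2, this, mul_zero]

end P14

section P15
variable {U : (𝔼 n) → ℝ} {C : Set (𝔼 n)} {a : ℝ}

lemma ker_int (hU : LI U) {x : 𝔼 n} {t : ℝ} (ht0 : 0 < t) (ht : t⁻¹ < ‖x‖) :
    Integrable (fun z => (t ^ n * rk (t • (z - x))) * U z) := by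
  have hT := (TF_ker (W := {0}ᶜ) rk_cd (fun _ => rk_zero) ht0 (ball_off (x := x) ht)).cmul (t ^ n)
  exact hU _ hT.1.continuous hT.2.1 hT.2.2

lemma submean (hn : 1 ≤ n) (hC : IsCone C) (hU : WH C a U) {x : 𝔼 n} (hx : x ∈ C) {t : ℝ} (ht0 : 0 < t) (ht : t⁻¹ < ‖x‖) :
    m0 n * |Fv U x| ≤ Av (fun x => |U x|) t x := by
  have hx0 : x ≠ 0 := hC.ne hx
  have hp : 0 < ‖x‖ := by simpa using hx0
  have h1 := (Fv_lim hn hC hU hx).abs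
  rw [abs_mul, abs_of_pos (m0_pos hn)] at h1
  refine le_of_tendsto h1 ?_
  filter_upwards [eventually_ge_atTop t] with s hs
  have hs0 : 0 < s := ht0.trans_le hs
  have htm : t ∈ Ioi ‖x‖⁻¹ := by rw [mem_Ioi, inv_lt_comm₀ hp ht0]; exact ht
  refine le_trans ?_ (Av_anti hn hU hx0 htm (lt_of_lt_of_le htm hs) hs)
  unfold Av
  refine (abs_integral_le_integral_abs).trans (le_of_eq ?_)
  congr; ext z
  rw [abs_mul, abs_of_nonneg]
  exact mul_nonneg (by positivity) (rk_nonneg _)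

lemma rk_pos {y : 𝔼 n} (hy : ‖y‖ < 1) : 0 < rk y := by
  have hs : 0 < 1 - ‖y‖ ^ 2 := by nlinarith [norm_nonneg y]
  unfold rk
  set s := 1 - ‖y‖ ^ 2
  have e : expNegInvGlue =ᶠ[𝓝 s] fun s => Real.exp (-s⁻¹) := by
    filter_upwards [Ioi_mem_nhds hs] with w hw
    have hw : ¬ w ≤ 0 := not_le.2 hw
    simp [expNegInvGlue, hw]
  have hd : HasDerivAt (fun s : ℝ => Real.exp (-s⁻¹)) (Real.exp (-s⁻¹) * -(-(s ^ 2)⁻¹)) s :=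
    ((hasDerivAt_inv hs.ne').neg).exp
  rw [e.deriv_eq, hd.deriv]
  have := Real.exp_pos (-s⁻¹)
  have h2 : 0 < (s ^ 2)⁻¹ := by positivity
  rw [neg_neg]
  positivity

lemma rk_low (n : ℕ) : ∃ c > 0, ∀ y : 𝔼 n, ‖y‖ ≤ 3 / 4 → c ≤ rk y := by
  obtain ⟨y, hy, hm⟩ := (isCompact_closedBall (0 : 𝔼 n) (3 / 4)).exists_isMinOn ⟨0, mem_closedBall_self (by norm_num)⟩ rk_cd.continuous.continuousOn
  rw [mem_closedBall_zero_iff] at hy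
  exact ⟨rk y, rk_pos (by linarith), fun z hz => hm (by rw [mem_closedBall_zero_iff]; exact hz)⟩

lemma decay (hn : 1 ≤ n) (hC : IsCone C) (hU : WH C a U) {δ : ℝ} (hδ : 0 < δ) (hδ1 : δ ≤ 1) :
    ∃ θ, 0 ≤ θ ∧ θ < 1 ∧ ∀ (x0 v : 𝔼 n) (s B : ℝ), ‖v‖ ≤ 1 → 0 < s → 5 * s < ‖x0‖ → Disjoint (ball (x0 + s • v) (δ * s)) C → 0 ≤ B →
      (∀ z ∈ ball x0 (5 * s) ∩ C, |Fv U z| ≤ B) → ∀ y ∈ ball x0 s ∩ C, |Fv U y| ≤ θ * B := by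
  obtain ⟨c, hc, hlow⟩ := rk_low n
  set η : ℝ := (δ / 8) ^ n * (c * volume.real (closedBall (0 : 𝔼 n) 1)) with hη
  have hv : 0 < volume.real (closedBall (0 : 𝔼 n) 1) :=
    ENNReal.toReal_pos (measure_closedBall_pos _ _ one_pos).ne' measure_closedBall_lt_top.ne
  have hη0 : 0 < η := by positivity
  have hm := m0_pos hn
  refine ⟨max (1 - η / m0 n) 0, le_max_right _ _, max_lt (by linarith [div_pos hη0 hm]) one_pos, ?_⟩
  rintro x0 v s B hv1 hs hsx hdis hB hbd y ⟨hy, hyC⟩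
  rw [mem_ball, dist_eq_norm] at hy
  set t := (4 * s)⁻¹ with ht
  have ht0 : 0 < t := by positivity
  have hti : t⁻¹ = 4 * s := by rw [ht, inv_inv]
  have hyn : 4 * s < ‖y‖ := by
    have := norm_sub_norm_le x0 y
    rw [norm_sub_rev] at this; linarith
  have hsub := submean hn hC hU hyC ht0 (by rw [hti]; exact hyn)
  have hU' : LI U := hU.int
  have hI := ker_int hU'.abs (x := y) ht0 (by rw [hti]; exact hyn)
  have hK : Integrable (fun z => t ^ n * rk (t • (z - y))) := by
    have := (TF_ker (W := univ) (rk_cd (n := n)) (fun _ => rk_zero) ht0 (subset_univ (closedBall y t⁻¹))).cmul (t ^ n)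
    exact this.int
  have hK0 : ∀ z, 0 ≤ t ^ n * rk (t • (z - y)) := fun z => mul_nonneg (by positivity) (rk_nonneg _)
  set E := closedBall (x0 + s • v) (δ * s / 2) with hE
  have hEC : ∀ z ∈ E, z ∉ C := fun z hz hzC => disjoint_left.1 hdis
    ((closedBall_subset_ball (by have : 0 < δ * s := by positivity
                                 linarith)) hz) hzC
  have hEl : η ≤ ∫ z in E, t ^ n * rk (t • (z - y)) := by
    have e1 : η = ∫ z in E, t ^ n * c := by
      rw [setIntegral_const, hE, Measure.addHaar_real_closedBall' volume _ (by positivity), finrank_euclideanSpace, Fintype.card_fin,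
        smul_eq_mul, hη]
      have : (δ / 8) ^ n = (δ * s / 2) ^ n * t ^ n := by
        rw [← mul_pow]; congr 1; rw [ht]; field_simp; norm_num
      rw [this]; ring
    rw [e1]
    refine setIntegral_mono_on (integrableOn_const measure_closedBall_lt_top.ne) hK.integrableOn measurableSet_closedBall
      fun z hz => ?_
    refine mul_le_mul_of_nonneg_left (hlow _ ?_) (by positivity)
    rw [norm_smul, Real.norm_of_nonneg ht0.le, ht, inv_mul_le_iff₀ (by positivity)]
    rw [hE, mem_closedBall, dist_eq_norm] at hz
    have e2 : z - y = (z - (x0 + s • v)) + (s • v - (y - x0)) := by abel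
    have h3 := norm_add_le (z - (x0 + s • v)) (s • v - (y - x0))
    have h4 := norm_sub_le (s • v) (y - x0)
    rw [norm_smul, Real.norm_of_nonneg hs.le] at h4
    rw [e2]
    nlinarith
  have hle : Av (fun x => |U x|) t y ≤ ∫ z, (B * (t ^ n * rk (t • (z - y))) - B * E.indicator (fun z => t ^ n * rk (t • (z - y))) z) := by
    unfold Av
    refine integral_mono_ae hI ((hK.const_mul B).sub ((hK.indicator measurableSet_closedBall).const_mul B)) ?_
    filter_upwards [Fv_ae hn hC hU] with z hz
    by_cases hzy : t⁻¹ < ‖z - y‖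
    · have : rk (t • (z - y)) = 0 := by
        refine rk_zero ?_
        rw [norm_smul, Real.norm_of_nonneg ht0.le]
        rw [inv_lt_iff_one_lt_mul₀ ht0] at hzy
        linarith
      have h5 : E.indicator (fun z => t ^ n * rk (t • (z - y))) z = 0 := by
        by_cases hzE : z ∈ E
        · simp [indicator_of_mem hzE, this]
        · simp [indicator_of_notMem hzE]
      rw [h5, this]; simp
    by_cases hzC : z ∈ C
    · have h5 : z ∉ E := fun h => hEC z h hzC
      rw [indicator_of_notMem h5, ← hz hzC, mul_zero, sub_zero, mul_comm]
      refine mul_le_mul_of_nonneg_right (hbd z ⟨?_, hzC⟩) (hK0 z)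
      rw [mem_ball, dist_eq_norm]
      have e2 : z - x0 = (z - y) + (y - x0) := by abel
      have h3 := norm_add_le (z - y) (y - x0)
      rw [e2]; rw [hti] at hzy; push Not at hzy
      linarith
    · rw [hU.off z hzC, abs_zero, mul_zero, ← mul_sub]
      refine mul_nonneg hB (sub_nonneg.2 ?_)
      exact indicator_le_self' (fun z _ => hK0 z) z
  rw [integral_sub (hK.const_mul B) ((hK.indicator measurableSet_closedBall).const_mul B), integral_const_mul B, integral_const_mul B,
    integral_indicator measurableSet_closedBall, ker_mass ht0] at hle
  have h6 : m0 n * |Fv U y| ≤ m0 n * ((1 - η / m0 n) * B) := by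
    have : m0 n * ((1 - η / m0 n) * B) = B * m0 n - B * η := by field_simp
    rw [this]
    have := mul_le_mul_of_nonneg_left hEl hB
    linarith
  have h7 := le_of_mul_le_mul_left h6 hm
  refine h7.trans (mul_le_mul_of_nonneg_right (le_max_left _ _) hB)

lemma loc_bdd (hn : 1 ≤ n) (hC : IsCone C) (hU : WH C a U) {x0 : 𝔼 n} (hx0 : x0 ≠ 0) :
    ∃ B, 0 ≤ B ∧ ∀ y ∈ ball x0 (‖x0‖ / 4) ∩ C, |Fv U y| ≤ B := by
  have hp : 0 < ‖x0‖ := by simpa using hx0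
  have hU' : LI U := hU.int
  obtain ⟨b, hb1, hb0, hb2⟩ := hU'.dom (x := x0) (r := ‖x0‖ / 2) (by positivity) (by linarith)
  obtain ⟨M, hM0, hM⟩ := bdd_ball (rk_cd (n := n)).continuous fun _ => rk_zero
  set t := (‖x0‖ / 4)⁻¹ with ht
  have ht0 : 0 < t := by positivity
  have hti : t⁻¹ = ‖x0‖ / 4 := by rw [ht, inv_inv]
  have hm := m0_pos hn
  have hI0 : 0 ≤ ∫ z, b z * |U z| := integral_nonneg fun z => mul_nonneg (hb0 z) (abs_nonneg _)
  refine ⟨(m0 n)⁻¹ * ((t ^ n * M) * ∫ z, b z * |U z|), by positivity, ?_⟩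
  rintro y ⟨hy, hyC⟩
  rw [mem_ball, dist_eq_norm] at hy
  have hyn : t⁻¹ < ‖y‖ := by
    have := norm_sub_norm_le x0 y
    rw [norm_sub_rev] at this; rw [hti]; linarith
  rw [le_inv_mul_iff₀ hm]
  refine (submean hn hC hU hyC ht0 hyn).trans ?_
  rw [← integral_const_mul]
  unfold Av
  refine integral_mono (ker_int hU'.abs ht0 hyn) (hb1.const_mul _) fun z => ?_
  simp only
  by_cases hz : ‖z - x0‖ ≤ ‖x0‖ / 2
  · rw [hb2 z hz, one_mul]
    have := (le_abs_self _).trans (hM (t • (z - y)))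
    gcongr
  · rw [rk_zero]
    · have := hb0 z
      simp only [mul_zero, zero_mul]
      positivity
    · rw [norm_smul, Real.norm_of_nonneg ht0.le, ht, le_inv_mul_iff₀ (by positivity)]
      have e2 : z - x0 = (z - y) + (y - x0) := by abel
      have h3 := norm_add_le (z - y) (y - x0)
      rw [e2] at hz; push Not at hz
      linarith

/-- exterior cone-type condition -/
lemma ext_ball {x0 : 𝔼 n} (hCo : IsOpen C) (hx : x0 ∈ frontier C) {V : Set (𝔼 n)} {f : (𝔼 n) → ℝ} (hV : IsOpen V) (hxV : x0 ∈ V)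
    (hf : ContDiff ℝ 2 f) (hdf : fderiv ℝ f x0 ≠ 0) (he : C ∩ V = {y ∈ V | f y < 0}) :
    ∃ v : 𝔼 n, ‖v‖ ≤ 1 ∧ ∃ δ, 0 < δ ∧ δ ≤ 1 ∧ ∃ s0 > 0, ∀ s, 0 < s → s < s0 → Disjoint (ball (x0 + s • v) (δ * s)) C := by
  have hf0 : 0 ≤ f x0 := by
    by_contra! h
    have : x0 ∈ C ∩ V := by rw [he]; exact ⟨hxV, h⟩
    rw [hCo.frontier_eq] at hx
    exact hx.2 this.1
  set D := fderiv ℝ f x0 with hD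
  obtain ⟨w, hw⟩ : ∃ w, 0 < D w := by
    obtain ⟨w, hw⟩ : ∃ w, D w ≠ 0 := by
      by_contra! h
      exact hdf (ContinuousLinearMap.ext h)
    rcases lt_or_gt_of_ne hw with h | h
    · exact ⟨-w, by simpa using h⟩
    · exact ⟨w, h⟩
  have hw0 : w ≠ 0 := by rintro rfl; simp at hw
  have hwp : 0 < ‖w‖ := by simpa using hw0
  set v := ‖w‖⁻¹ • w with hv
  have hvn : ‖v‖ = 1 := by rw [hv, norm_smul, norm_inv, norm_norm]; field_simp
  set d := D v with hd
  have hd0 : 0 < d := by rw [hd, hv, map_smul]; exact mul_pos (inv_pos.2 hwp) hw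
  have hDn : 0 ≤ ‖D‖ := norm_nonneg _
  refine ⟨v, hvn.le, min 1 (d / (4 * (‖D‖ + 1))), by positivity, min_le_left _ _, ?_⟩
  set δ := min 1 (d / (4 * (‖D‖ + 1))) with hδ
  have hδ0 : 0 < δ := by positivity
  have hδ2 : ‖D‖ * δ ≤ d / 4 := by
    have h1 : δ ≤ d / (4 * (‖D‖ + 1)) := min_le_right _ _
    rw [le_div_iff₀ (by positivity)] at h1
    nlinarith
  have hfd : HasFDerivAt f D x0 := (hf.differentiable (by norm_num) x0).hasFDerivAt
  have ho := hfd.isLittleO.def (c := d / 8) (by positivity)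
  obtain ⟨ε, hε, hball⟩ := Metric.eventually_nhds_iff.1 (ho.and (hV.mem_nhds hxV))
  refine ⟨ε / 2, by positivity, fun s hs hs1 => ?_⟩
  rw [disjoint_left]
  intro z hz hzC
  rw [mem_ball, dist_eq_norm] at hz
  have e1 : z - x0 = s • v + (z - (x0 + s • v)) := by abel
  have hn1 : ‖z - x0‖ ≤ 2 * s := by
    rw [e1]
    refine (norm_add_le _ _).trans ?_
    rw [norm_smul, Real.norm_of_nonneg hs.le, hvn]
    have : δ ≤ 1 := min_le_left _ _
    nlinarith
  obtain ⟨h1, h2⟩ := hball (y := z) (by rw [dist_eq_norm]; linarith)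
  have hfz : f z < 0 := by
    have : z ∈ C ∩ V := ⟨hzC, h2⟩
    rw [he] at this
    exact this.2
  have h3 : D (z - x0) = s * d + D (z - (x0 + s • v)) := by
    conv_lhs => rw [e1]
    rw [map_add, map_smul, smul_eq_mul]
  have h4 := D.le_opNorm (z - (x0 + s • v))
  rw [Real.norm_eq_abs] at h4 h1
  have h5 := neg_abs_le (D (z - (x0 + s • v)))
  have h6 := neg_abs_le (f z - f x0 - D (z - x0))
  have h7 : ‖D‖ * ‖z - (x0 + s • v)‖ ≤ ‖D‖ * (δ * s) := by gcongr
  have h8 : ‖D‖ * (δ * s) ≤ d / 4 * s := by nlinarith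
  have h9 : d / 8 * ‖z - x0‖ ≤ d / 8 * (2 * s) := by gcongr
  have : 0 < d * s := by positivity
  linarith

lemma bdry (hn : 1 ≤ n) (hC : IsCone C) (hU : WH C a U) {x0 : 𝔼 n} (hx : x0 ∈ frontier C) (h0 : x0 ≠ 0)
    {V : Set (𝔼 n)} {f : (𝔼 n) → ℝ} (hV : IsOpen V) (hxV : x0 ∈ V)
    (hf : ContDiff ℝ 2 f) (hdf : fderiv ℝ f x0 ≠ 0) (he : C ∩ V = {y ∈ V | f y < 0}) :
    Tendsto (Fv U) (𝓝[C] x0) (𝓝 0) := by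
  obtain ⟨v, hv, δ, hδ, hδ1, s0, hs0, hdis⟩ := ext_ball hC.op hx hV hxV hf hdf he
  obtain ⟨θ, hθ0, hθ1, hdec⟩ := decay hn hC hU hδ hδ1
  obtain ⟨B, hB, hbd⟩ := loc_bdd hn hC hU h0
  have hp : 0 < ‖x0‖ := by simpa using h0
  set s1 := min s0 (‖x0‖ / 8) with hs1
  have hs10 : 0 < s1 := by positivity
  have hs1a : s1 ≤ s0 := min_le_left _ _
  have hs1b : s1 ≤ ‖x0‖ / 8 := min_le_right _ _
  have hk : ∀ k : ℕ, ∀ y ∈ ball x0 (s1 / 5 ^ k) ∩ C, |Fv U y| ≤ θ ^ k * B := by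
    intro k
    induction k with
    | zero =>
      intro y hy
      rw [pow_zero, one_mul]
      refine hbd y ⟨ball_subset_ball ?_ hy.1, hy.2⟩
      rw [pow_zero, div_one]; linarith
    | succ k ih =>
      have h5 : (1:ℝ) ≤ 5 ^ k := one_le_pow₀ (by norm_num)
      have e : 5 * (s1 / 5 ^ (k + 1)) = s1 / 5 ^ k := by rw [pow_succ]; field_simp
      have hle : s1 / 5 ^ k ≤ s1 := div_le_self hs10.le h5
      have hpos : 0 < s1 / 5 ^ (k + 1) := by positivity
      have e2 : θ ^ (k+1) * B = θ * (θ ^ k * B) := by rw [pow_succ']; ring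
      rw [e2]
      refine hdec x0 v (s1 / 5 ^ (k + 1)) (θ ^ k * B) hv hpos (by rw [e]; linarith)
        (hdis _ hpos (by linarith)) (by positivity) ?_
      rw [e]; exact ih
  rw [Metric.tendsto_nhds]
  intro ε hε
  have hl : Tendsto (fun k : ℕ => θ ^ k * B) atTop (𝓝 (0 * B)) := (tendsto_pow_atTop_nhds_zero_of_lt_one hθ0 hθ1).mul_const B
  rw [zero_mul] at hl
  obtain ⟨k, hk2⟩ := (hl.eventually (gt_mem_nhds hε)).exists
  have : ball x0 (s1 / 5 ^ k) ∩ C ∈ 𝓝[C] x0 := inter_comm C _ ▸ inter_mem_nhdsWithin C (ball_mem_nhds x0 (by positivity))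
  filter_upwards [this] with y hy
  rw [Real.dist_eq, sub_zero]
  exact (hk k y hy).trans_lt hk2

end P15


section P16

lemma euler_hom {C : Set (𝔼 n)} {F : (𝔼 n) → ℝ} {a : ℝ}
    (hh : ∀ x ∈ C, ∀ s > 0, F (s • x) = s ^ a * F x) {x : 𝔼 n} (hx : x ∈ C)
    (hd : DifferentiableAt ℝ F x) : Eu F x = a * F x := by
  have h1 : HasDerivAt (fun s : ℝ => s • x) ((1:ℝ) • x) 1 := (hasDerivAt_id (1:ℝ)).smul_const x
  have hd' : HasFDerivAt F (fderiv ℝ F x) ((1:ℝ) • x) := by rw [one_smul]; exact hd.hasFDerivAt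
  have h2 : HasDerivAt (fun s : ℝ => F (s • x)) (fderiv ℝ F x ((1:ℝ) • x)) 1 := hd'.comp_hasDerivAt (1:ℝ) h1
  have h3 : HasDerivAt (fun s : ℝ => s ^ a * F x) (a * (1:ℝ) ^ (a - 1) * F x) 1 :=
    (Real.hasDerivAt_rpow_const (Or.inl one_ne_zero)).mul_const (F x)
  have h4 : (fun s : ℝ => F (s • x)) =ᶠ[𝓝 1] fun s : ℝ => s ^ a * F x := by
    filter_upwards [lt_mem_nhds (zero_lt_one (α := ℝ))] with s hs
    exact hh x hx s hs
  have h5 := h2.unique (h3.congr_of_eventuallyEq h4)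
  rw [one_smul, Real.one_rpow, mul_one] at h5
  simpa [Dv] using h5

lemma sph_eig {C : Set (𝔼 n)} (hC : IsCone C) {F : (𝔼 n) → ℝ} {a : ℝ}
    (hh : ∀ x ∈ C, ∀ s > 0, F (s • x) = s ^ a * F x)
    (hF : ∀ x ∈ C, ContDiffAt ℝ ∞ F x) (hl : ∀ x ∈ C, lap F x = 0)
    {x : 𝔼 n} (hx : x ∈ C) (hx1 : ‖x‖ = 1) :
    lap (fun x => ‖x‖ ^ (-a) * F x) x = - (a * (a + n - 2)) * (‖x‖ ^ (-a) * F x) := by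
  have hne : ∀ y ∈ C, y ≠ 0 := fun y hy => by simpa using hC.ne hy
  have hFd : ∀ y ∈ C, DifferentiableAt ℝ F y := fun y hy => (hF y hy).differentiableAt (by simp)
  have hG : ∀ y ∈ C, ContDiffAt ℝ ∞ (fun x => ‖x‖ ^ (-a) * F x) y := fun y hy =>
    ((cd_norm_rpow (-a)).contDiffAt (open0.mem_nhds (hne y hy))).mul (hF y hy)
  have h2 : (2 : ℕ∞ω) ≤ ∞ := WithTop.coe_le_coe.2 (le_top : (2:ℕ∞) ≤ ⊤)
  have p1 := lap_polar ((hG x hx).of_le h2)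
  have p2 := lap_polar ((hF x hx).of_le h2)
  have eF : EqOn (Eu F) (fun y => a * F y) C := fun y hy => euler_hom hh hy (hFd y hy)
  have eFF : Eu (Eu F) x = a * (a * F x) := by
    rw [Dv_congr_open hC.op eF hx, Dv_const_mul a (hFd x hx)]
    exact congrArg _ (eF hx)
  have eG : EqOn (Eu (fun x => ‖x‖ ^ (-a) * F x)) (fun _ => 0) C := fun y hy => by
    rw [Dv_mul (da_rpow _ (hne y hy)) (hFd y hy), Eu_rpow _ (hne y hy), eF hy]
    ring
  have eGG : Eu (Eu (fun x => ‖x‖ ^ (-a) * F x)) x = 0 := by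
    rw [Dv_congr_open hC.op eG hx]; simp [Dv]
  have eL : ∀ i j, EqOn (Lr i j (fun x => ‖x‖ ^ (-a) * F x)) (fun y => ‖y‖ ^ (-a) * Lr i j F y) C := fun i j y hy => by
    rw [Dv_mul (da_rpow _ (hne y hy)) (hFd y hy), Lr_rpow _ _ _ (hne y hy)]
    ring
  have eLL : ∀ i j, Lr i j (Lr i j (fun x => ‖x‖ ^ (-a) * F x)) x = ‖x‖ ^ (-a) * Lr i j (Lr i j F) x := fun i j => by
    rw [Dv_congr_open hC.op (eL i j) hx, Dv_mul (da_rpow _ (hne x hx))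
      ((contDiffAt_Dv (k := 1) (hF x hx) (by rw [one_add_one_eq_two]; exact h2)).differentiableAt (by simp)), Lr_rpow _ _ _ (hne x hx)]
    ring
  have eD : Ds (fun x => ‖x‖ ^ (-a) * F x) x = ‖x‖ ^ (-a) * Ds F x := by
    unfold Ds
    rw [Finset.sum_congr rfl fun i _ => Finset.sum_congr rfl fun j _ => eLL i j]
    simp only [← Finset.mul_sum]; ring
  rw [eGG, eG hx, eD, hx1] at p1
  rw [eFF, eF hx, hl x hx, hx1] at p2
  rw [hx1]
  rw [Real.one_rpow] at p1 ⊢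
  linarith

lemma cone_nonempty {S : Set (𝔼 n)} (hS : IsSphDomain S) : (coneOf S).Nonempty := by
  obtain ⟨σ, hσ⟩ := hS.2.2.nonempty
  have h1 : ‖σ‖ = 1 := by simpa using hS.1 hσ
  refine ⟨σ, ?_, ?_⟩
  · rintro rfl; simp at h1
  · rw [h1]; simpa using hσ

lemma mem_cone_sph {S : Set (𝔼 n)} {σ : 𝔼 n} (h1 : ‖σ‖ = 1) : σ ∈ coneOf S ↔ σ ∈ S := by
  have h0 : σ ≠ 0 := by rintro rfl; simp at h1
  simp [coneOf, h0, h1]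

theorem eig_exists (hn : 2 ≤ n) {S : Set (𝔼 n)} (hS : IsC2SphDomain S) {lam : ℝ} {φ : (𝔼 n) → ℝ}
    (hL : Lim (coneOf S) lam φ) : lam ∈ spec S := by
  have hn1 : 1 ≤ n := by omega
  have hC := isCone_coneOf hS.1
  set C := coneOf S with hCd
  obtain ⟨a, ha⟩ : ∃ a : ℝ, a * (a + n - 2) = lam := by
    refine ⟨(-((n:ℝ)-2) + √(((n:ℝ)-2)^2 + 4 * lam)) / 2, ?_⟩
    have := Real.sq_sqrt (show 0 ≤ ((n:ℝ)-2)^2 + 4 * lam by have := hL.nn; positivity)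
    nlinarith
  have hU := hL.WH hn hC ha
  set U : (𝔼 n) → ℝ := fun x => ‖x‖ ^ a * φ x with hUd
  have hh : ∀ x ∈ C, ∀ s > 0, Fv U (s • x) = s ^ a * Fv U x := fun x hx s hs => Fv_hom hn1 hC hU hx hs
  have hreg : ∀ x ∈ C, ContDiffAt ℝ ∞ (Fv U) x := fun x hx => (Fv_reg hn1 hC hU hx).1
  have hlap : ∀ x ∈ C, lap (Fv U) x = 0 := fun x hx => (Fv_reg hn1 hC hU hx).2
  have hne : ∀ y ∈ C, y ≠ 0 := fun y hy => by simpa using hC.ne hy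
  set G : (𝔼 n) → ℝ := fun x => ‖x‖ ^ (-a) * Fv U x with hGd
  have hG : ∀ y ∈ C, ContDiffAt ℝ ∞ G y := fun y hy =>
    ((cd_norm_rpow (-a)).contDiffAt (open0.mem_nhds (hne y hy))).mul (hreg y hy)
  have hG0 : ∀ x ∈ C, ∀ s : ℝ, 0 < s → G (s • x) = G x := fun x hx s hs => by
    have hp : 0 < ‖x‖ := norm_pos_iff.2 (hne x hx)
    simp only [hGd]
    rw [hh x hx s hs, norm_smul, Real.norm_of_nonneg hs.le, Real.mul_rpow hs.le hp.le, Real.rpow_neg hs.le]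
    have : s ^ a ≠ 0 := (Real.rpow_pos_of_pos hs a).ne'
    field_simp
  have hext : (fun x => C.indicator G (‖x‖⁻¹ • x)) = C.indicator G := by
    ext x
    by_cases hx : x ∈ C
    · have hp : 0 < ‖x‖⁻¹ := inv_pos.2 (norm_pos_iff.2 (hne x hx))
      rw [indicator_of_mem hx, indicator_of_mem (hC.dil_iff hp |>.2 hx), hG0 x hx _ hp]
    · rw [indicator_of_notMem hx, indicator_of_notMem]
      by_cases h0 : x = 0
      · subst h0; simpa using hx
      · rwa [hC.dil_iff (inv_pos.2 (norm_pos_iff.2 h0))]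
  have hloc : ∀ x ∈ C, C.indicator G =ᶠ[𝓝 x] G := fun x hx =>
    (eqOn_indicator (s := C) (f := G)).eventuallyEq_of_mem (hC.op.mem_nhds hx)
  refine ⟨C.indicator G, ?_, ?_, ?_, ?_, ?_⟩
  · rw [hext]
    intro x hx
    by_cases hxC : x ∈ C
    · exact ((hG x hxC).continuousAt.congr (hloc x hxC).symm).continuousWithinAt
    have hxc : x ∈ closure C := by
      have h0 := norm_pos_iff.2 hx.1
      have h1 : ‖x‖ • (‖x‖⁻¹ • x) ∈ closure C := by
        refine map_mem_closure (f := fun y : 𝔼 n => ‖x‖ • y) (continuous_const_smul _) hx.2 ?_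
        intro σ hσ
        have h1 : ‖σ‖ = 1 := by simpa using hS.1.1 hσ
        exact (hC.dil_iff h0).2 ((mem_cone_sph h1).2 hσ)
      rwa [smul_inv_smul₀ h0.ne'] at h1
    have hxf : x ∈ frontier C := by rw [hC.op.frontier_eq]; exact ⟨hxc, hxC⟩
    obtain ⟨V, f, hV, hxV, hf, hdf, he⟩ := hS.2 x ⟨hxf, by simpa using hx.1⟩
    have hb := bdry hn1 hC hU hxf hx.1 hV hxV hf hdf he
    refine ContinuousAt.continuousWithinAt ?_
    rw [ContinuousAt, indicator_of_notMem hxC, ← nhdsWithin_univ, ← union_compl_self C, nhdsWithin_union, tendsto_sup]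
    constructor
    · have h2 : Tendsto (fun y : 𝔼 n => ‖y‖ ^ (-a)) (𝓝[C] x) (𝓝 (‖x‖ ^ (-a))) :=
        ((da_rpow (-a) hx.1).continuousAt).continuousWithinAt
      have h3 := h2.mul hb
      rw [mul_zero] at h3
      refine h3.congr' ?_
      filter_upwards [self_mem_nhdsWithin] with y hy
      rw [indicator_of_mem hy]
    · refine tendsto_const_nhds.congr' ?_
      filter_upwards [self_mem_nhdsWithin] with y hy
      rw [indicator_of_notMem hy]
  · rw [hext]
    intro x hx
    have h2 : (2 : ℕ∞ω) ≤ ∞ := WithTop.coe_le_coe.2 (le_top : (2:ℕ∞) ≤ ⊤)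
    exact (((hG x hx).of_le h2).congr_of_eventuallyEq (hloc x hx)).contDiffWithinAt
  · intro σ hσ
    have h1 : ‖σ‖ = 1 := by
      have : σ ∈ sphere (0:𝔼 n) 1 := closure_minimal hS.1.1 isClosed_sphere hσ.1
      simpa using this
    exact indicator_of_notMem (fun h => hσ.2 ((mem_cone_sph h1).1 h)) _
  · obtain ⟨x, hx, hx2⟩ := Fv_ne hn1 hC hU
    have hp : 0 < ‖x‖ := norm_pos_iff.2 (hne x hx)
    refine ⟨‖x‖⁻¹ • x, hx.2, ?_⟩
    rw [congrFun hext x, indicator_of_mem hx]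
    exact mul_ne_zero (Real.rpow_pos_of_pos hp _).ne' hx2
  · intro σ hσ
    have h1 : ‖σ‖ = 1 := by simpa using hS.1.1 hσ
    have hσC := (mem_cone_sph h1).2 hσ
    have e1 : sphLap (C.indicator G) σ = lap G σ := by
      unfold sphLap
      rw [hext, lap, lap]
      refine Finset.sum_congr rfl fun i _ => ?_
      rw [(Filter.EventuallyEq.iteratedFDeriv ℝ (hloc σ hσC) 2).self_of_nhds]
    rw [e1, sph_eig hC hh hreg hlap hσC h1, ha, indicator_of_mem hσC]
    ring

end P16


section P17

theorem rellich_aux (hn : 2 ≤ n) (α : ℝ)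
    (S : Set (𝔼 n)) (hS : IsC2SphDomain S)
    (Ω : Set (𝔼 n))
    (hΩ : Ω = coneOf S ∩ Metric.ball 0 1 ∨ Ω = coneOf S \ Metric.closedBall 0 1)
    (u : (𝔼 n) → ℝ) (hu : DirichletAdm Ω u) :
    ((gbar n α + sInf (spec S)) / 2) *
        (∫ x in Ω, ‖x‖ ^ (α - 4) * ((Real.log ‖x‖) ^ 2)⁻¹ * (u x) ^ 2) +
      (9 / 16) *
        (∫ x in Ω, ‖x‖ ^ (α - 4) * ((Real.log ‖x‖) ^ 4)⁻¹ * (u x) ^ 2) ≤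
      (∫ x in Ω, ‖x‖ ^ α * (lap u x) ^ 2) -
        muD (coneOf S) α * (∫ x in Ω, ‖x‖ ^ (α - 4) * (u x) ^ 2) := by
  have hC := isCone_coneOf hS.1
  obtain ⟨lam, φ, hL⟩ := exists_Lim hn hC (cone_nonempty hS.1)
  have hsp := eig_exists hn hS hL
  have hle : sInf (spec S) ≤ lam := by
    by_cases hb : BddBelow (spec S)
    · exact csInf_le hb hsp
    · rw [Real.sInf_of_not_bddBelow hb]; exact hL.nn
  have hsub : Ω ⊆ coneOf S ∩ W1 n := by
    rcases hΩ with h | h <;> rw [h] <;> intro x hx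
    · refine ⟨hx.1, hx.1.1, fun h1 => ?_⟩
      have h2 := hx.2
      rw [mem_ball_zero_iff, h1] at h2
      exact lt_irrefl _ h2
    · refine ⟨hx.1, hx.1.1, fun h1 => hx.2 ?_⟩
      rw [mem_closedBall_zero_iff, h1]
  have hu2 : DirichletAdm (coneOf S ∩ W1 n) u := ⟨hu.1, hu.2.1, hu.2.2.trans hsub⟩
  have key := main_C2 hn hC α hL.nn hL.poi hu2
  have h0 : ∀ x, x ∉ Ω → u x = 0 := fun x hx => image_eq_zero_of_notMem_tsupport fun h => hx (hu.2.2 h)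
  have hl0 : ∀ x, x ∉ Ω → lap u x = 0 := fun x hx => lap_eq_zero fun h => hx (hu.2.2 h)
  rw [setIntegral_eq_integral_of_forall_compl_eq_zero (fun x hx => by rw [h0 x hx]; ring),
    setIntegral_eq_integral_of_forall_compl_eq_zero (fun x hx => by rw [h0 x hx]; ring),
    setIntegral_eq_integral_of_forall_compl_eq_zero (fun x hx => by rw [hl0 x hx]; ring),
    setIntegral_eq_integral_of_forall_compl_eq_zero (fun x hx => by rw [h0 x hx]; ring)]
  refine le_trans ?_ key
  gcongr

end P17

end Aux

noncomputable section

/-- Theorem 3(iii) of the paper, Dirichlet case: improved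
Rellich inequality with two logarithmic remainder terms on cone-like domains for
compactly supported test functions. -/
theorem rellich_log_dirichlet {n : ℕ} (hn : 2 ≤ n) (α : ℝ)
    (S : Set (EuclideanSpace ℝ (Fin n))) (hS : IsC2SphDomain S)
    (Ω : Set (EuclideanSpace ℝ (Fin n)))
    (hΩ : Ω = coneOf S ∩ Metric.ball 0 1 ∨ Ω = coneOf S \ Metric.closedBall 0 1)
    (u : EuclideanSpace ℝ (Fin n) → ℝ) (hu : DirichletAdm Ω u) :
    ((gbar n α + sInf (spec S)) / 2) *
        (∫ x in Ω, ‖x‖ ^ (α - 4) * ((Real.log ‖x‖) ^ 2)⁻¹ * (u x) ^ 2) +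
      (9 / 16) *
        (∫ x in Ω, ‖x‖ ^ (α - 4) * ((Real.log ‖x‖) ^ 4)⁻¹ * (u x) ^ 2) ≤
      (∫ x in Ω, ‖x‖ ^ α * (lap u x) ^ 2) -
        muD (coneOf S) α * (∫ x in Ω, ‖x‖ ^ (α - 4) * (u x) ^ 2) := by
  exact rellich_aux hn α S hS Ω hΩ u hu

end
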